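/- arXiv:1705.00992 — 3 statements merged into one kernel-verified Lean document; each statement's English description precedes it below -/
import Mathlib

section
/- Relation between the dimer partition function of the shuriken-augmented graph and the partial boundary monomer-dimer partition function (Lemma 3.2): Let G be a finite simple graph with edge weights x : E(G) → R and vertex weights y : V(G) → R (R a commutative ring), and let B_1,…,B_b be pairwise disjoint cyclically ordered lists of distinct vertices of G, B_k = (v^k_1,…,v^k_{N_k}), where each N_k ≥ 4 is even. For β = (β_1,…,β_b) ∈ {0,1}^b, let G_β be the graph obtained from G by attaching, for each k, a disjoint copy of the shuriken graph S_{N_k}^{β_k} in which the tip v_j is identified with v^k_j for 1 ≤ j ≤ N_k, the inner vertices (and centre, if β_k = 1) being new vertices adjacent to no other vertices of G_β; the edges of G keep their weights x, each blade edge at a tip v is given weight y_v, and every other new edge is given weight 1. Let Z_D(G_β) be the sum, over all perfect matchings D of G_β, of the product of the weights of the edges of D, and let Z_MD^β(G) be the sum, over all matchings M of G such that every vertex of G not covered by M lies on some B_k and such that for each k the number of vertices of B_k not covered by M is congruent to β_k modulo 2, of (Π_{e ∈ M} x_e)(Π_{v not covered by M} y_v). Then Z_D(G_β) = 2^{#{k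 : β_k = 0}} (Π_{k : β_k = 1} N_k) · Z_MD^β(G). -/
open scoped BigOperators

noncomputable section

variable {V : Type*} [Fintype V] [DecidableEq V] {R : Type*} [CommRing R]

/-- The vertex type of the shuriken-augmented graph `G_β`: the original vertices of `G`
(`Sum.inl`), together with, for each boundary circuit `k`, the `N k` inner vertices
(`Sum.inr ⟨k, Sum.inl i⟩`) of the attached shuriken graph and, when `β k = 1`, its centre
(`Sum.inr ⟨k, Sum.inr _⟩`). -/
def BVert (b : ℕ) (N : Fin b → ℕ) (β : Fin b → Bool) : Type _ :=
  V ⊕ (Σ k : Fin b, Fin (N k) ⊕ Fin (cond (β k) 1 0))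

/-- The shuriken-augmented graph `G_β`: on top of the edges of `G`, for each circuit `k`
one attaches a copy of the shuriken graph `S_{N k}^{β k}` whose tip `v_j` is identified
with the circuit vertex `B k j`; its edges are the inner cycle edges (indices mod `N k`),
the blade edges (tip `B k t` adjacent to inner `t` and inner `(t + N k - 1) % N k`), and,
when `β k = 1`, the edges joining the centre to every inner vertex of circuit `k`. -/
def shurikenAugmented (G : SimpleGraph V) (b : ℕ) (N : Fin b → ℕ) (β : Fin b → Bool)
    (B : (k : Fin b) → Fin (N k) → V) : SimpleGraph (BVert (V := V) b N β) :=
  SimpleGraph.fromRel (fun p q =>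
    match p, q with
    | Sum.inl u, Sum.inl v => G.Adj u v
    | Sum.inl v, Sum.inr ⟨k, Sum.inl i⟩ =>
        ∃ t : Fin (N k), v = B k t ∧ (i = t ∨ i.1 = (t.1 + N k - 1) % N k)
    | Sum.inr ⟨k, Sum.inl i⟩, Sum.inr ⟨l, Sum.inl j⟩ => k = l ∧ j.1 = (i.1 + 1) % N k
    | Sum.inr ⟨k, Sum.inr _⟩, Sum.inr ⟨l, Sum.inl _⟩ => k = l
    | _, _ => False)

/-- The edge-weight function of `G_β` as a symmetric function on ordered pairs of
vertices: edges of `G` keep their weights `x`, each blade edge gets the vertex weight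
`y v` of its tip endpoint `v`, and every other new edge gets weight `1`. -/
def augWeightFun (b : ℕ) (N : Fin b → ℕ) (β : Fin b → Bool) (x : Sym2 V → R) (y : V → R) :
    BVert (V := V) b N β → BVert (V := V) b N β → R := fun p q =>
  match p, q with
  | Sum.inl u, Sum.inl v => x s(u, v)
  | Sum.inl u, Sum.inr _ => y u
  | Sum.inr _, Sum.inl v => y v
  | Sum.inr _, Sum.inr _ => 1

/-- The edge weights of `G_β`, as a function on unordered pairs. -/
def augWeight (b : ℕ) (N : Fin b → ℕ) (β : Fin b → Bool) (x : Sym2 V → R) (y : V → R) :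
    Sym2 (BVert (V := V) b N β) → R :=
  Sym2.lift ⟨augWeightFun b N β x y, by
    intro p q
    rcases p with u | ⟨k, i⟩ <;> rcases q with v | ⟨l, j⟩ <;>
      simp [augWeightFun, Sym2.eq_swap]⟩

/-- The dimer partition function of a weighted graph: the sum over all perfect matchings
of the product of the weights of their edges. -/
def dimerZ {W : Type*} (H : SimpleGraph W) (w : Sym2 W → R) : R :=
  ∑ᶠ M ∈ {M : H.Subgraph | M.IsPerfectMatching}, ∏ᶠ e ∈ M.edgeSet, w e

/-- The partial boundary monomer-dimer partition function `Z_MD^β(G)`: the sum over all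
matchings `M` of `G` such that every vertex not covered by `M` lies on some circuit
`B k` and such that, for each `k`, the number of vertices of circuit `k` not covered by
`M` is congruent to `β k` mod `2`, of the product of the edge weights of `M` times the
product of the vertex weights of the uncovered vertices. -/
def monomerDimerZ (G : SimpleGraph V) (x : Sym2 V → R) (y : V → R)
    (b : ℕ) (N : Fin b → ℕ) (β : Fin b → Bool) (B : (k : Fin b) → Fin (N k) → V) : R :=
  ∑ᶠ M ∈ {M : G.Subgraph | M.IsMatching ∧
      (∀ v : V, v ∉ M.verts → ∃ k t, v = B k t) ∧
      (∀ k : Fin b, Nat.card {t : Fin (N k) // B k t ∉ M.verts} % 2 = cond (β k) 1 0)},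
    (∏ᶠ e ∈ M.edgeSet, x e) * ∏ᶠ v ∈ M.vertsᶜ, y v

lemma finRotate_val {n : ℕ} (i : Fin n) : (finRotate n i).val = (i.val + 1) % n := by
  cases n with
  | zero => exact i.elim0
  | succ m => simp [Fin.val_add, Nat.add_mod]

lemma finRotate_eq_iff {n : ℕ} (i t : Fin n) :
    finRotate n i = t ↔ i.val = (t.val + n - 1) % n := by
  rw [Fin.ext_iff, finRotate_val]
  have hi := i.isLt
  have ht := t.isLt
  rcases Nat.lt_or_ge (i.val + 1) n with h | h
  · rw [Nat.mod_eq_of_lt h]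
    rcases Nat.eq_zero_or_pos t.val with h0 | h0
    · rw [h0, Nat.mod_eq_of_lt (by omega)]; omega
    · rw [show t.val + n - 1 = (t.val - 1) + n by omega, Nat.add_mod_right,
        Nat.mod_eq_of_lt (by omega)]
      omega
  · rw [show i.val + 1 = n by omega, Nat.mod_self]
    rcases Nat.eq_zero_or_pos t.val with h0 | h0
    · rw [h0, Nat.mod_eq_of_lt (by omega)]; omega
    · rw [show t.val + n - 1 = (t.val - 1) + n by omega, Nat.add_mod_right,
        Nat.mod_eq_of_lt (by omega)]
      omega

lemma finRotate_ne_self {n : ℕ} (hn : 4 ≤ n) (i : Fin n) : finRotate n i ≠ i := by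
  intro h
  have h1 := congrArg Fin.val h
  rw [finRotate_val] at h1
  have := i.isLt
  rcases Nat.lt_or_ge (i.val + 1) n with h | h
  · rw [Nat.mod_eq_of_lt h] at h1; omega
  · rw [show i.val + 1 = n by omega, Nat.mod_self] at h1; omega

lemma finRotate_finRotate_ne_self {n : ℕ} (hn : 4 ≤ n) (i : Fin n) :
    finRotate n (finRotate n i) ≠ i := by
  intro h
  have h1 := congrArg Fin.val h
  rw [finRotate_val, finRotate_val] at h1
  have := i.isLt
  rcases Nat.lt_or_ge (i.val + 1) n with h | h
  · rw [Nat.mod_eq_of_lt h] at h1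
    rcases Nat.lt_or_ge (i.val + 1 + 1) n with h' | h'
    · rw [Nat.mod_eq_of_lt h'] at h1; omega
    · rw [show i.val + 1 + 1 = n by omega, Nat.mod_self] at h1; omega
  · rw [show i.val + 1 = n by omega, Nat.mod_self, Nat.mod_eq_of_lt (by omega)] at h1; omega

/-- A function on a cycle that is invariant under rotation is constant. -/
lemma eq_of_finRotate_invariant {n : ℕ} {A : Type*} {e : Fin n → A}
    (he : ∀ t, e (finRotate n t) = e t) (i j : Fin n) : e i = e j := by
  cases n with
  | zero => exact i.elim0
  | succ m =>
    have h : ∀ t, e t = e 0 := by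
      intro t
      induction t using Fin.induction with
      | zero => rfl
      | succ t ih =>
        rw [← ih, ← he t.castSucc, finRotate_apply, Fin.coeSucc_eq_succ]
    rw [h i, h j]

/-- A function on a cycle with zero total is the difference of a function, whose value at one
point can be prescribed. -/
lemma exists_finRotate_difference {n : ℕ} {A : Type*} [AddCommGroup A] (d : Fin n → A)
    (hd : ∑ t, d t = 0) (i : Fin n) (a : A) :
    ∃ r : Fin n → A, (∀ t, r (finRotate n t) = r t + d (finRotate n t)) ∧ r i = a := by
  cases n with
  | zero => exact i.elim0
  | succ m =>
    set S : Fin (m + 1) → A := fun t => ∑ j ∈ Finset.Iic t, d j with hS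
    refine ⟨fun t => a + S t - S i, fun t => ?_, by simp⟩
    have key : S (finRotate _ t) = S t + d (finRotate _ t) := by
      induction t using Fin.lastCases with
      | last =>
        have h1 : S 0 = d 0 := by
          simp only [hS]
          rw [show Finset.Iic (0 : Fin (m + 1)) = {0} by ext j; simp]
          simp
        have h2 : S (Fin.last m) = 0 := by
          simp only [hS]
          rw [show Finset.Iic (Fin.last m) = Finset.univ by ext j; simp [Fin.le_last]]
          exact hd
        rw [finRotate_last, h1, h2, zero_add]
      | cast t =>
        rw [finRotate_apply, Fin.coeSucc_eq_succ]
        simp only [hS]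
        rw [show Finset.Iic t.succ = insert t.succ (Finset.Iic t.castSucc) by
          ext j
          simp only [Finset.mem_Iic, Finset.mem_insert, Fin.le_def, Fin.ext_iff, Fin.val_succ,
            Fin.val_castSucc]
          omega,
          Finset.sum_insert (by simp [Fin.le_def]), add_comm]
    simp only [key]
    abel

/-- Assignments to each inner vertex of a shuriken of a direction (`Sum.inl true` towards the next
position, `Sum.inl false` towards its own position) or of a centre, encoding the perfect matchings
of the shuriken graph whose covered tips are those in `τ`. -/
def IsBladeConfig {n : ℕ} {Z : Type*} (τ : Set (Fin n)) (s : Fin n → Bool ⊕ Z) : Prop :=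
  (∀ t, ((s t = Sum.inl true ↔ s (finRotate n t) = Sum.inl false) ↔ finRotate n t ∉ τ)) ∧
    ∀ z, ∃! t, s t = Sum.inr z

section
open scoped Classical

variable {n : ℕ} {Z : Type*}

/-- The indicator of the inner vertices directed towards the next position. -/
def forward (s : Fin n → Bool ⊕ Z) (t : Fin n) : ZMod 2 := if s t = Sum.inl true then 1 else 0

/-- The defect at a position: the increment of `forward` across it. -/
def defect (τ : Set (Fin n)) (s : Fin n → Bool ⊕ Z) (t : Fin n) : ZMod 2 :=
  1 + (if (s t).isRight then 1 else 0) + (if t ∈ τ then 1 else 0)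

lemma blade_iff_forward (τ : Set (Fin n)) (s : Fin n → Bool ⊕ Z) (t : Fin n) :
    ((s t = Sum.inl true ↔ s (finRotate n t) = Sum.inl false) ↔ finRotate n t ∉ τ) ↔
      forward s (finRotate n t) = forward s t + defect τ s (finRotate n t) := by
  unfold forward defect
  generalize finRotate n t = u
  by_cases hτ : u ∈ τ <;>
  rcases s t with (_ | _) | _ <;> rcases s u with (_ | _) | _ <;>
  simp only [hτ, if_true, if_false, reduceCtorEq, Sum.inl.injEq, Sum.isRight_inl,
    Sum.isRight_inr, Bool.true_eq_false, Bool.false_eq_true, not_true_eq_false,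
    not_false_eq_true] <;> decide

lemma sum_defect [Fintype Z] (τ : Set (Fin n)) (s : Fin n → Bool ⊕ Z)
    (hs : ∀ z, ∃! t, s t = Sum.inr z) :
    ∑ t, defect τ s t = n + Fintype.card Z + Nat.card τ := by
  have h1 : ∀ t, (if (s t).isRight then (1 : ZMod 2) else 0) =
      ∑ z, if s t = Sum.inr z then 1 else 0 := by
    intro t
    rcases s t with b | z <;> simp
  have h2 : ∀ z, (∑ t, if s t = Sum.inr z then (1 : ZMod 2) else 0) = 1 := by
    intro z
    obtain ⟨t, ht, hu⟩ := hs z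
    rw [Finset.sum_eq_single t (fun t' _ h => if_neg fun h' => h (hu t' h')) (by simp), if_pos ht]
  simp only [defect, Finset.sum_add_distrib, h1]
  rw [Finset.sum_comm]
  simp only [h2]
  simp [Fintype.card_subtype]

lemma IsBladeConfig.sum_eq_zero {τ : Set (Fin n)} {s : Fin n → Bool ⊕ Z}
    (h : IsBladeConfig τ s) : ∑ t, defect τ s t = 0 := by
  have h1 : ∑ t, forward s (finRotate n t) =
      ∑ t, forward s t + ∑ t, defect τ s (finRotate n t) := by
    rw [← Finset.sum_add_distrib]
    exact Finset.sum_congr rfl fun t _ => (blade_iff_forward τ s t).1 (h.1 t)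
  rw [Equiv.sum_comp (finRotate n) (forward s), Equiv.sum_comp (finRotate n) (defect τ s)] at h1
  simpa using h1

lemma IsBladeConfig.parity [Fintype Z] {τ : Set (Fin n)} {s : Fin n → Bool ⊕ Z}
    (h : IsBladeConfig τ s) (hn : Even n) (hZ : Fintype.card Z ≤ 1) :
    Nat.card τ % 2 = Fintype.card Z := by
  have h1 := (sum_defect τ s h.2).symm.trans h.sum_eq_zero
  have h2 : ((n + Fintype.card Z + Nat.card τ : ℕ) : ZMod 2) = 0 := by exact_mod_cast h1
  rw [ZMod.natCast_eq_zero_iff] at h2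
  obtain ⟨m, hm⟩ := hn
  omega

lemma natCast_add_card_add_card_eq_zero [Fintype Z] {τ : Set (Fin n)} (hn : Even n)
    (h : Nat.card τ % 2 = Fintype.card Z) : (n + Fintype.card Z + Nat.card τ : ZMod 2) = 0 := by
  have : ((n + Fintype.card Z + Nat.card τ : ℕ) : ZMod 2) = 0 := by
    rw [ZMod.natCast_eq_zero_iff]
    obtain ⟨m, hm⟩ := hn
    omega
  exact_mod_cast this

/-- Configurations with the same centre placement and the same value at one point agree. -/
lemma IsBladeConfig.ext {τ : Set (Fin n)} {s s' : Fin n → Bool ⊕ Z}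
    (h : IsBladeConfig τ s) (h' : IsBladeConfig τ s')
    (hc : ∀ t z, s t = Sum.inr z ↔ s' t = Sum.inr z) (i : Fin n) (hi : s i = s' i) : s = s' := by
  have hd : ∀ t, defect τ s t = defect τ s' t := by
    intro t
    have : (s t).isRight = (s' t).isRight := by
      have := hc t
      rcases h1 : s t with b | z <;> rcases h2 : s' t with b' | z' <;> simp_all
    simp only [defect, this]
  have hf : ∀ t, forward s t = forward s' t := by
    intro t
    have := eq_of_finRotate_invariant (e := fun t => forward s t - forward s' t) (fun t => by
      simp only [(blade_iff_forward τ s t).1 (h.1 t), (blade_iff_forward τ s' t).1 (h'.1 t), hd]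
      ring) t i
    simp only [forward, hi, sub_self] at this
    exact sub_eq_zero.1 this
  funext t
  have h1 := hc t
  have h2 := hf t
  unfold forward at h2
  rcases h3 : s t with (_ | _) | z <;> rcases h4 : s' t with (_ | _) | z' <;> simp_all

lemma exists_isBladeConfig [Fintype Z] {τ : Set (Fin n)} (hn : Even n)
    (hτ : Nat.card τ % 2 = Fintype.card Z) (g : Fin n → Bool ⊕ Z)
    (hg : ∀ z, ∃! t, g t = Sum.inr z) (i : Fin n) (hi : ∀ t, t ≠ i → (g t).isLeft) :
    ∃ s, IsBladeConfig τ s ∧ s i = g i := by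
  obtain ⟨r, hr, hri⟩ := exists_finRotate_difference (defect τ g)
    ((sum_defect τ g hg).trans (natCast_add_card_add_card_eq_zero hn hτ)) i (forward g i)
  set s : Fin n → Bool ⊕ Z := fun t => if t = i then g i else Sum.inl (decide (r t = 1)) with hs
  have hgs : ∀ t z, s t = Sum.inr z ↔ g t = Sum.inr z := by
    intro t z
    by_cases ht : t = i
    · simp [hs, ht]
    · have := hi t ht
      rcases h : g t with b | z' <;> simp_all
  have hd : ∀ t, defect τ s t = defect τ g t := by
    intro t
    have : (s t).isRight = (g t).isRight := by
      have h := hgs t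
      clear_value s
      rcases h1 : s t with b | z <;> rcases h2 : g t with b' | z' <;> rw [h1, h2] at h
      · rfl
      · simpa using h z'
      · simpa using h z
      · rfl
    simp only [defect, this]
  have hf : ∀ t, forward s t = r t := by
    intro t
    by_cases ht : t = i
    · subst ht; rw [hri]; simp [forward, hs]
    · have h01 : ∀ a : ZMod 2, (if a = 1 then 1 else 0) = a := by decide
      simp [forward, hs, ht, h01]
  refine ⟨s, ⟨fun t => ?_, fun z => ?_⟩, by simp [hs]⟩
  · rw [blade_iff_forward, hf, hf, hd, hr]
  · simpa only [hgs] using hg z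

lemma card_isBladeConfig_of_isEmpty [IsEmpty Z] {τ : Set (Fin n)} (hn : Even n) (i : Fin n)
    (hτ : Nat.card τ % 2 = 0) : Nat.card {s : Fin n → Bool ⊕ Z // IsBladeConfig τ s} = 2 := by
  have : Fintype Z := Fintype.ofIsEmpty
  let φ : {s : Fin n → Bool ⊕ Z // IsBladeConfig τ s} → Bool ⊕ Z := fun s => s.1 i
  have hφ : Function.Bijective φ := by
    constructor
    · intro s s' h
      exact Subtype.ext (s.2.ext s'.2 (fun _ z => isEmptyElim z) i h)
    · intro a
      have ha : a.isLeft := by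
        rcases a with b | z
        · rfl
        · exact isEmptyElim z
      obtain ⟨s, hs, hsi⟩ := exists_isBladeConfig hn (hτ.trans Fintype.card_eq_zero.symm)
        (fun _ : Fin n => a)
        (fun z => isEmptyElim z) i (fun _ _ => ha)
      exact ⟨⟨s, hs⟩, hsi⟩
  rw [Nat.card_eq_of_bijective φ hφ]
  simp

lemma card_isBladeConfig_of_unique [Unique Z] {τ : Set (Fin n)} (hn : Even n)
    (hτ : Nat.card τ % 2 = 1) : Nat.card {s : Fin n → Bool ⊕ Z // IsBladeConfig τ s} = n := by
  let φ : {s : Fin n → Bool ⊕ Z // IsBladeConfig τ s} → Fin n := fun s => (s.2.2 default).choose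
  have hφs : ∀ s : {s : Fin n → Bool ⊕ Z // IsBladeConfig τ s}, s.1 (φ s) = Sum.inr default := fun s => (s.2.2 default).choose_spec.1
  have hφu : ∀ (s : {s : Fin n → Bool ⊕ Z // IsBladeConfig τ s}) t, s.1 t = Sum.inr default → t = φ s :=
    fun s => (s.2.2 default).choose_spec.2
  have hφ : Function.Bijective φ := by
    constructor
    · intro s s' h
      refine Subtype.ext (s.2.ext s'.2 (fun t z => ?_) (φ s) ?_)
      · rw [Unique.eq_default z]
        exact ⟨fun ht => by rw [hφu s t ht, h]; exact hφs s',
          fun ht => by rw [hφu s' t ht, ← h]; exact hφs s⟩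
      · rw [hφs s, h, hφs s']
    · intro i
      obtain ⟨s, hs, hsi⟩ := exists_isBladeConfig hn (hτ.trans Fintype.card_unique.symm)
        (fun t : Fin n => if t = i then Sum.inr (default : Z) else Sum.inl true)
        (fun z => ⟨i, by simp [Unique.eq_default z], fun t ht => by
          by_contra h; simp [h] at ht⟩) i (fun t ht => by simp [ht])
      exact ⟨⟨s, hs⟩, (hφu ⟨s, hs⟩ i (by simpa using hsi)).symm⟩
  rw [Nat.card_eq_of_bijective φ hφ]
  simp

end
section Augmented

variable {U : Type*} {b : ℕ} {N : Fin b → ℕ} {β : Fin b → Bool}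

/-- The vertex of `G_β` coming from a vertex of `G`. -/
def tip (N : Fin b → ℕ) (β : Fin b → Bool) (v : U) : BVert (V := U) b N β := Sum.inl v

/-- The inner vertices of `G_β`. -/
def innerVertex (U : Type*) (β : Fin b → Bool) (p : Σ k, Fin (N k)) : BVert (V := U) b N β :=
  Sum.inr ⟨p.1, Sum.inl p.2⟩

/-- The centres of `G_β`. -/
def centre (U : Type*) (N : Fin b → ℕ) {k : Fin b} (z : Fin (cond (β k) 1 0)) :
    BVert (V := U) b N β :=
  Sum.inr ⟨k, Sum.inr z⟩

/-- The cyclic successor on the positions of all circuits. -/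
def rot : Equiv.Perm (Σ k, Fin (N k)) := Equiv.sigmaCongrRight fun k => finRotate (N k)

lemma rot_mk (k : Fin b) (i : Fin (N k)) : rot ⟨k, i⟩ = ⟨k, finRotate (N k) i⟩ := rfl

lemma rot_ne_self (hN4 : ∀ k, 4 ≤ N k) (p : Σ k, Fin (N k)) : rot p ≠ p := by
  obtain ⟨k, i⟩ := p
  simpa [rot_mk] using finRotate_ne_self (hN4 k) i

lemma rot_rot_ne_self (hN4 : ∀ k, 4 ≤ N k) (p : Σ k, Fin (N k)) : rot (rot p) ≠ p := by
  obtain ⟨k, i⟩ := p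
  have := finRotate_finRotate_ne_self (hN4 k) i
  simpa [rot_mk] using this

lemma tip_inj {v w : U} : tip N β v = tip N β w ↔ v = w := Sum.inl_injective.eq_iff

lemma inner_inj {p q : Σ k, Fin (N k)} : innerVertex U β p = innerVertex U β q ↔ p = q := by
  refine ⟨fun h => ?_, fun h => h ▸ rfl⟩
  obtain ⟨k, i⟩ := p
  obtain ⟨l, j⟩ := q
  have h := Sum.inr_injective h
  simp only [Sigma.mk.injEq] at h
  obtain ⟨rfl, h⟩ := h
  rw [Sum.inl_injective (eq_of_heq h)]

lemma centre_inj {k : Fin b} {z z' : Fin (cond (β k) 1 0)} :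
    centre U N z = centre U N z' ↔ z = z' := by
  refine ⟨fun h => ?_, fun h => h ▸ rfl⟩
  have h := Sum.inr_injective h
  simp only [Sigma.mk.injEq, true_and] at h
  exact Sum.inr_injective (eq_of_heq h)

lemma circuit_eq_of_centre_eq {k l : Fin b} {z : Fin (cond (β k) 1 0)}
    {z' : Fin (cond (β l) 1 0)} (h : centre U N z = centre U N z') : k = l :=
  congrArg Sigma.fst (Sum.inr_injective h)

lemma tip_ne_inner {v : U} {p : Σ k, Fin (N k)} : tip N β v ≠ innerVertex U β p := Sum.inl_ne_inr

lemma tip_ne_centre {v : U} {k : Fin b} {z : Fin (cond (β k) 1 0)} :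
    tip N β v ≠ centre U N z := Sum.inl_ne_inr

lemma inner_ne_centre {p : Σ k, Fin (N k)} {k : Fin b} {z : Fin (cond (β k) 1 0)} :
    innerVertex U β p ≠ centre U N z := by
  intro h
  obtain ⟨l, i⟩ := p
  have h := Sum.inr_injective h
  simp only [Sigma.mk.injEq] at h
  obtain ⟨rfl, h⟩ := h
  exact Sum.inl_ne_inr (eq_of_heq h)

lemma bVert_cases (a : BVert (V := U) b N β) :
    (∃ v, a = tip N β v) ∨ (∃ p, a = innerVertex U β p) ∨
      ∃ (k : Fin b) (z : Fin (cond (β k) 1 0)), a = centre U N z := by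
  rcases a with v | ⟨k, i | z⟩
  · exact Or.inl ⟨v, rfl⟩
  · exact Or.inr (Or.inl ⟨⟨k, i⟩, rfl⟩)
  · exact Or.inr (Or.inr ⟨k, z, rfl⟩)

variable {G : SimpleGraph U} {B : (k : Fin b) → Fin (N k) → U}

local notation "H" => shurikenAugmented G b N β B

lemma adj_tip_tip {v w : U} : SimpleGraph.Adj H (tip N β v) (tip N β w) ↔ G.Adj v w := by
  refine (SimpleGraph.fromRel_adj _ _ _).trans ⟨?_, fun h => ⟨fun h' => ?_, Or.inl h⟩⟩
  · rintro ⟨-, h | h⟩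
    · exact h
    · exact SimpleGraph.Adj.symm h
  · exact h.ne (tip_inj.1 h')

lemma adj_tip_inner {v : U} {p : Σ k, Fin (N k)} :
    SimpleGraph.Adj H (tip N β v) (innerVertex U β p) ↔
      v = B p.1 p.2 ∨ v = B (rot p).1 (rot p).2 := by
  obtain ⟨k, i⟩ := p
  refine (SimpleGraph.fromRel_adj _ _ _).trans ⟨?_, fun h => ⟨tip_ne_inner, Or.inl ?_⟩⟩
  · rintro ⟨-, ⟨t, rfl, rfl | h⟩ | h⟩
    · exact Or.inl rfl
    · exact Or.inr (by rw [rot_mk, (finRotate_eq_iff _ _).2 h])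
    · exact h.elim
  · rcases h with rfl | rfl
    · exact ⟨i, rfl, Or.inl rfl⟩
    · exact ⟨finRotate _ i, rfl, Or.inr ((finRotate_eq_iff _ _).1 rfl)⟩

lemma not_adj_tip_centre {v : U} {k : Fin b} {z : Fin (cond (β k) 1 0)} :
    ¬ SimpleGraph.Adj H (tip N β v) (centre U N z) := by
  intro h
  rcases ((SimpleGraph.fromRel_adj _ _ _).1 h).2 with h | h <;> exact h

lemma adj_inner_inner (hN4 : ∀ k, 4 ≤ N k) {p q : Σ k, Fin (N k)} :
    SimpleGraph.Adj H (innerVertex U β p) (innerVertex U β q) ↔ q = rot p ∨ p = rot q := by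
  have key : ∀ p q : Σ k, Fin (N k), (p.1 = q.1 ∧ q.2.1 = (p.2.1 + 1) % N p.1) ↔ q = rot p := by
    rintro ⟨k, i⟩ ⟨l, j⟩
    constructor
    · rintro ⟨h, h'⟩
      dsimp only at h h'
      subst h
      rw [rot_mk, Fin.ext (h'.trans (finRotate_val i).symm)]
    · rw [rot_mk]
      intro h
      simp only [Sigma.mk.injEq] at h
      obtain ⟨rfl, h⟩ := h
      rw [eq_of_heq h]
      exact ⟨rfl, finRotate_val i⟩
  refine (SimpleGraph.fromRel_adj _ _ _).trans ?_
  refine (and_congr_right' (or_congr (key p q) (key q p))).trans ?_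
  refine and_iff_right_of_imp fun h h' => ?_
  rw [inner_inj] at h'
  subst h'
  exact rot_ne_self hN4 p (h.elim id id).symm

lemma adj_inner_centre {p : Σ k, Fin (N k)} {k : Fin b} {z : Fin (cond (β k) 1 0)} :
    SimpleGraph.Adj H (innerVertex U β p) (centre U N z) ↔ k = p.1 := by
  refine (SimpleGraph.fromRel_adj _ _ _).trans ⟨?_, fun h => ⟨inner_ne_centre, Or.inr h⟩⟩
  rintro ⟨-, h | h⟩
  · exact h.elim
  · exact h

lemma not_adj_centre_centre {k l : Fin b} {z : Fin (cond (β k) 1 0)}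
    {z' : Fin (cond (β l) 1 0)} : ¬ SimpleGraph.Adj H (centre U N z) (centre U N z') := by
  intro h
  rcases ((SimpleGraph.fromRel_adj _ _ _).1 h).2 with h | h <;> exact h

open scoped Classical in
/-- The partner of an inner vertex with a given direction, if `S` is the set of vertices of `G`
that are not matched along blades. -/
def target (B : (k : Fin b) → Fin (N k) → U) (S : Set U) (p : Σ k, Fin (N k)) :
    Bool ⊕ Fin (cond (β p.1) 1 0) → BVert (V := U) b N β
  | Sum.inl true =>
      if B (rot p).1 (rot p).2 ∈ S then innerVertex U β (rot p) else tip N β (B (rot p).1 (rot p).2)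
  | Sum.inl false => if B p.1 p.2 ∈ S then innerVertex U β (rot.symm p) else tip N β (B p.1 p.2)
  | Sum.inr z => centre U N z

/-- Families of configurations whose tips are the circuit vertices outside `S`. -/
abbrev IsBladeFamily (B : (k : Fin b) → Fin (N k) → U) (S : Set U)
    (s : ∀ k, Fin (N k) → Bool ⊕ Fin (cond (β k) 1 0)) : Prop :=
  ∀ k, IsBladeConfig {t | B k t ∉ S} (s k)

variable {S : Set U} {s : ∀ k, Fin (N k) → Bool ⊕ Fin (cond (β k) 1 0)}

lemma IsBladeFamily.position (hs : IsBladeFamily B S s) (p : Σ k, Fin (N k)) :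
    (s p.1 p.2 = Sum.inl true ↔ s (rot p).1 (rot p).2 = Sum.inl false) ↔
      B (rot p).1 (rot p).2 ∈ S := by
  exact ((hs p.1).1 p.2).trans not_not

lemma target_injective (hN4 : ∀ k, 4 ≤ N k)
    (hB : Function.Injective fun p : Σ k, Fin (N k) => B p.1 p.2) (p : Σ k, Fin (N k)) :
    Function.Injective (target (β := β) B S p) := by
  have h1 : rot p ≠ rot.symm p := fun h =>
    rot_rot_ne_self hN4 p (by rw [h, Equiv.apply_symm_apply])
  have h2 : B (rot p).1 (rot p).2 ≠ B p.1 p.2 := fun h => rot_ne_self hN4 p (hB h)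
  intro σ σ' h
  rcases σ with (_ | _) | z <;> rcases σ' with (_ | _) | z' <;> unfold target at h <;>
    dsimp only at h <;> (try split_ifs at h) <;>
    simp_all [tip_inj, inner_inj, centre_inj, tip_ne_inner, tip_ne_inner.symm, tip_ne_centre,
      tip_ne_centre.symm, inner_ne_centre, inner_ne_centre.symm, h1.symm, h2.symm]

lemma target_eq_inner (hs : IsBladeFamily B S s) {p q : Σ k, Fin (N k)}
    (h : target B S p (s p.1 p.2) = innerVertex U β q) :
    target B S q (s q.1 q.2) = innerVertex U β p := by
  rcases hp : s p.1 p.2 with (_ | _) | z <;> rw [hp] at h <;> simp only [target] at h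
  · split_ifs at h with hS
    · rw [inner_inj] at h
      obtain rfl : p = rot q := by rw [← h, Equiv.apply_symm_apply]
      rw [((hs.position q).2 hS).2 hp]
      simp [target, hS]
    · exact absurd h tip_ne_inner
  · split_ifs at h with hS
    · rw [inner_inj] at h
      subst h
      rw [((hs.position p).2 hS).1 hp]
      simp [target, hS]
    · exact absurd h tip_ne_inner
  · exact absurd h.symm inner_ne_centre

lemma eq_tip_of_target_eq_tip {p : Σ k, Fin (N k)} {σ : Bool ⊕ Fin (cond (β p.1) 1 0)} {v : U}
    (h : target B S p σ = tip N β v) :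
    v ∉ S ∧ ((σ = Sum.inl true ∧ v = B (rot p).1 (rot p).2) ∨
      (σ = Sum.inl false ∧ v = B p.1 p.2)) := by
  rcases σ with (_ | _) | z <;> simp only [target] at h
  · split_ifs at h with hS
    · exact absurd h.symm tip_ne_inner
    · rw [tip_inj] at h; subst h; simp [hS]
  · split_ifs at h with hS
    · exact absurd h.symm tip_ne_inner
    · rw [tip_inj] at h; subst h; simp [hS]
  · exact absurd h.symm tip_ne_centre

lemma target_inj (hB : Function.Injective fun p : Σ k, Fin (N k) => B p.1 p.2)
    (hs : IsBladeFamily B S s) {p q : Σ k, Fin (N k)}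
    (h : target B S p (s p.1 p.2) = target B S q (s q.1 q.2)) : p = q := by
  rcases bVert_cases (target B S p (s p.1 p.2)) with ⟨v, hv⟩ | ⟨r, hr⟩ | ⟨k, z, hz⟩
  · have mixed : ∀ p q : Σ k, Fin (N k), v ∉ S → s p.1 p.2 = Sum.inl true →
        v = B (rot p).1 (rot p).2 → s q.1 q.2 = Sum.inl false → v = B q.1 q.2 → False := by
      intro p q hv h1 h2 h3 h4
      obtain rfl : rot p = q := hB (h2.symm.trans h4)
      exact hv (h4 ▸ (hs.position p).1 ⟨fun _ => h3, fun _ => h1⟩)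
    obtain ⟨hvS, h1⟩ := eq_tip_of_target_eq_tip hv
    obtain ⟨-, h2⟩ := eq_tip_of_target_eq_tip (h.symm.trans hv)
    rcases h1 with ⟨h1, h1'⟩ | ⟨h1, h1'⟩ <;> rcases h2 with ⟨h2, h2'⟩ | ⟨h2, h2'⟩
    · exact rot.injective (hB (h1'.symm.trans h2'))
    · exact (mixed p q hvS h1 h1' h2 h2').elim
    · exact (mixed q p hvS h2 h2' h1 h1').elim
    · exact hB (h1'.symm.trans h2')
  · exact inner_inj.1
      ((target_eq_inner hs hr).symm.trans (target_eq_inner hs (h.symm.trans hr)))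
  · have aux : ∀ p : Σ k, Fin (N k), target B S p (s p.1 p.2) = centre U N z →
        ∃ i, p = ⟨k, i⟩ ∧ s k i = Sum.inr z := by
      rintro ⟨l, i⟩ hp
      dsimp only at hp
      rcases hσ : s l i with (_ | _) | z' <;> rw [hσ] at hp <;> simp only [target] at hp
      · split_ifs at hp
        exacts [absurd hp inner_ne_centre, absurd hp tip_ne_centre]
      · split_ifs at hp
        exacts [absurd hp inner_ne_centre, absurd hp tip_ne_centre]
      · obtain rfl := circuit_eq_of_centre_eq hp
        exact ⟨i, rfl, by rw [hσ, centre_inj.1 hp]⟩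
    obtain ⟨i, rfl, hi⟩ := aux p hz
    obtain ⟨j, rfl, hj⟩ := aux q (h.symm.trans hz)
    rw [((hs k).2 z).unique hi hj]

lemma exists_target_eq_tip (hs : IsBladeFamily B S s) {v : U} (hv : v ∉ S)
    (hvB : ∃ k t, v = B k t) : ∃ p, target B S p (s p.1 p.2) = tip N β v := by
  obtain ⟨k, t, rfl⟩ := hvB
  obtain ⟨p, hp⟩ := rot.surjective (⟨k, t⟩ : Σ k, Fin (N k))
  have := hs.position p
  rw [hp] at this
  by_cases h : s k t = Sum.inl false
  · exact ⟨⟨k, t⟩, by simp [h, target, hv]⟩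
  · refine ⟨p, ?_⟩
    have h' : s p.1 p.2 = Sum.inl true := by
      by_contra h'
      exact hv (this.1 (by simp only [h', h]))
    have hp' : B (rot p).1 (rot p).2 = B k t := by rw [hp]
    simp [h', target, hp', hv]

lemma exists_target_eq_centre (hs : IsBladeFamily B S s) {k : Fin b}
    (z : Fin (cond (β k) 1 0)) : ∃ p, target B S p (s p.1 p.2) = centre U N z := by
  obtain ⟨i, hi, -⟩ := (hs k).2 z
  exact ⟨⟨k, i⟩, by simp [hi, target]⟩

lemma adj_target (hN4 : ∀ k, 4 ≤ N k) (p : Σ k, Fin (N k))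
    (σ : Bool ⊕ Fin (cond (β p.1) 1 0)) :
    SimpleGraph.Adj H (innerVertex U β p) (target B S p σ) := by
  rcases σ with (_ | _) | z <;> simp only [target]
  · split_ifs
    · exact (adj_inner_inner hN4).2 (Or.inr (by simp))
    · exact (adj_tip_inner.2 (Or.inl rfl)).symm
  · split_ifs
    · exact (adj_inner_inner hN4).2 (Or.inl rfl)
    · exact (adj_tip_inner.2 (Or.inr rfl)).symm
  · exact adj_inner_centre.2 rfl

/-- `D` restricts to `M` on `G` and matches the inner vertices in the directions `s`. -/
structure Encodes (M : G.Subgraph) (s : ∀ k, Fin (N k) → Bool ⊕ Fin (cond (β k) 1 0))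
    (D : SimpleGraph.Subgraph H) : Prop where
  adj_tip : ∀ v w, D.Adj (tip N β v) (tip N β w) ↔ M.Adj v w
  adj_inner : ∀ p : Σ k, Fin (N k), D.Adj (innerVertex U β p) (target B M.verts p (s p.1 p.2))

lemma exists_encodes (hN4 : ∀ k, 4 ≤ N k)
    (hB : Function.Injective fun p : Σ k, Fin (N k) => B p.1 p.2) {M : G.Subgraph}
    (hM : M.IsMatching) (hMB : ∀ v, v ∉ M.verts → ∃ k t, v = B k t)
    (hs : IsBladeFamily B M.verts s) :
    ∃ D : SimpleGraph.Subgraph H, D.IsPerfectMatching ∧ Encodes M s D := by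
  let T : (Σ k, Fin (N k)) → BVert (V := U) b N β := fun p => target B M.verts p (s p.1 p.2)
  let Rel : BVert (V := U) b N β → BVert (V := U) b N β → Prop := fun x y =>
    (∃ v w, x = tip N β v ∧ y = tip N β w ∧ M.Adj v w) ∨
      (∃ p, x = innerVertex U β p ∧ y = T p) ∨ (∃ p, y = innerVertex U β p ∧ x = T p)
  have hsymm : ∀ x y, Rel x y → Rel y x := by
    rintro x y (⟨v, w, hv, hw, h⟩ | h | h)
    · exact Or.inl ⟨w, v, hw, hv, h.symm⟩
    · exact Or.inr (Or.inr h)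
    · exact Or.inr (Or.inl h)
  have hadj : ∀ x y, Rel x y → SimpleGraph.Adj H x y := by
    rintro x y (⟨v, w, rfl, rfl, h⟩ | ⟨p, rfl, rfl⟩ | ⟨p, rfl, rfl⟩)
    · exact adj_tip_tip.2 h.adj_sub
    · exact adj_target hN4 p _
    · exact (adj_target hN4 p _).symm
  have htip : ∀ v p, tip N β v = T p → v ∉ M.verts := fun v p h =>
    (eq_tip_of_target_eq_tip h.symm).1
  have huniq : ∀ x y y', Rel x y → Rel x y' → y = y' := by
    rintro x y y' (⟨v, w, rfl, rfl, h⟩ | ⟨p, rfl, rfl⟩ | ⟨p, rfl, rfl⟩)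
      (⟨v', w', h1, rfl, h'⟩ | ⟨p', h1, rfl⟩ | ⟨p', rfl, h1⟩)
    · rw [tip_inj] at h1
      subst h1
      rw [(hM h.fst_mem).unique h h']
    · exact absurd h1 tip_ne_inner
    · exact absurd h.fst_mem (htip _ _ h1)
    · exact absurd h1.symm tip_ne_inner
    · rw [inner_inj.1 h1]
    · exact target_eq_inner hs h1.symm
    · exact absurd h'.fst_mem (htip _ _ h1.symm)
    · exact (target_eq_inner hs h1).symm
    · rw [target_inj hB hs h1]
  have hex : ∀ x, ∃ y, Rel x y := by
    intro x
    rcases bVert_cases x with ⟨v, rfl⟩ | ⟨p, rfl⟩ | ⟨k, z, rfl⟩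
    · by_cases hv : v ∈ M.verts
      · obtain ⟨w, hw, -⟩ := hM hv
        exact ⟨_, Or.inl ⟨v, w, rfl, rfl, hw⟩⟩
      · obtain ⟨p, hp⟩ := exists_target_eq_tip hs hv (hMB v hv)
        exact ⟨_, Or.inr (Or.inr ⟨p, rfl, hp.symm⟩)⟩
    · exact ⟨_, Or.inr (Or.inl ⟨p, rfl, rfl⟩)⟩
    · obtain ⟨p, hp⟩ := exists_target_eq_centre hs z
      exact ⟨_, Or.inr (Or.inr ⟨p, rfl, hp.symm⟩)⟩
  refine ⟨{ verts := Set.univ, Adj := Rel, adj_sub := hadj _ _,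
            edge_vert := fun _ => Set.mem_univ _, symm := ⟨hsymm⟩ },
    SimpleGraph.Subgraph.isPerfectMatching_iff.2 fun x => ?_, ⟨fun v w => ⟨?_, ?_⟩, ?_⟩⟩
  · obtain ⟨y, hy⟩ := hex x
    exact ⟨y, hy, fun y' hy' => huniq _ _ _ hy' hy⟩
  · rintro (⟨v', w', h1, h2, h⟩ | ⟨p, h1, -⟩ | ⟨p, h1, -⟩)
    · rwa [tip_inj.1 h1, tip_inj.1 h2]
    · exact absurd h1 tip_ne_inner
    · exact absurd h1 tip_ne_inner
  · exact fun h => Or.inl ⟨v, w, rfl, rfl, h⟩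
  · exact fun p => Or.inr (Or.inl ⟨p, rfl, rfl⟩)

lemma perfectMatching_ext {W : Type*} {K : SimpleGraph W} {D D' : K.Subgraph}
    (hD : D.IsPerfectMatching) (hD' : D'.IsPerfectMatching)
    (h : ∀ x, ∃ y, D.Adj x y ∧ D'.Adj x y) : D = D' := by
  refine SimpleGraph.Subgraph.ext (hD.2.verts_eq_univ.trans hD'.2.verts_eq_univ.symm) ?_
  rw [SimpleGraph.Subgraph.isPerfectMatching_iff] at hD hD'
  funext x y
  obtain ⟨z, hz, hz'⟩ := h x
  refine propext ⟨fun hy => ?_, fun hy => ?_⟩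
  · rwa [(hD x).unique hy hz]
  · rwa [(hD' x).unique hy hz']

lemma Encodes.subgraph_unique {M : G.Subgraph} (hM : M.IsMatching)
    (hMB : ∀ v, v ∉ M.verts → ∃ k t, v = B k t) (hs : IsBladeFamily B M.verts s)
    {D D' : SimpleGraph.Subgraph H} (hD : D.IsPerfectMatching) (hD' : D'.IsPerfectMatching)
    (h : Encodes M s D) (h' : Encodes M s D') : D = D' := by
  refine perfectMatching_ext hD hD' fun x => ?_
  rcases bVert_cases x with ⟨v, rfl⟩ | ⟨p, rfl⟩ | ⟨k, z, rfl⟩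
  · by_cases hv : v ∈ M.verts
    · obtain ⟨w, hw, -⟩ := hM hv
      exact ⟨_, (h.adj_tip v w).2 hw, (h'.adj_tip v w).2 hw⟩
    · obtain ⟨p, hp⟩ := exists_target_eq_tip hs hv (hMB v hv)
      exact ⟨_, hp ▸ (h.adj_inner p).symm, hp ▸ (h'.adj_inner p).symm⟩
  · exact ⟨_, h.adj_inner p, h'.adj_inner p⟩
  · obtain ⟨p, hp⟩ := exists_target_eq_centre hs z
    exact ⟨_, hp ▸ (h.adj_inner p).symm, hp ▸ (h'.adj_inner p).symm⟩

lemma Encodes.matching_unique {M M' : G.Subgraph} (hM : M.IsMatching) (hM' : M'.IsMatching)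
    {s s' : ∀ k, Fin (N k) → Bool ⊕ Fin (cond (β k) 1 0)} {D : SimpleGraph.Subgraph H}
    (h : Encodes M s D) (h' : Encodes M' s' D) : M = M' := by
  have hadj : M.Adj = M'.Adj := by
    funext v w
    exact propext ((h.adj_tip v w).symm.trans (h'.adj_tip v w))
  refine SimpleGraph.Subgraph.ext ?_ hadj
  rw [← hM.support_eq_verts, ← hM'.support_eq_verts]
  ext v
  simp only [SimpleGraph.Subgraph.mem_support, hadj]

lemma Encodes.family_unique (hN4 : ∀ k, 4 ≤ N k)
    (hB : Function.Injective fun p : Σ k, Fin (N k) => B p.1 p.2) {M : G.Subgraph}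
    {s s' : ∀ k, Fin (N k) → Bool ⊕ Fin (cond (β k) 1 0)} {D : SimpleGraph.Subgraph H}
    (hD : D.IsPerfectMatching) (h : Encodes M s D) (h' : Encodes M s' D) : s = s' := by
  rw [SimpleGraph.Subgraph.isPerfectMatching_iff] at hD
  funext k i
  exact target_injective hN4 hB ⟨k, i⟩
    ((hD _).unique (h.adj_inner ⟨k, i⟩) (h'.adj_inner ⟨k, i⟩))

/-- The restriction to `G` of a matching of `G_β`. -/
def restrictMatching (D : SimpleGraph.Subgraph H) : G.Subgraph where
  verts := {v | ∃ w, D.Adj (tip N β v) (tip N β w)}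
  Adj v w := D.Adj (tip N β v) (tip N β w)
  adj_sub h := adj_tip_tip.1 h.adj_sub
  edge_vert h := ⟨_, h⟩
  symm := ⟨fun _ _ h => h.symm⟩

lemma restrictMatching_isMatching {D : SimpleGraph.Subgraph H} (hD : D.IsPerfectMatching) :
    (restrictMatching D).IsMatching := by
  rw [SimpleGraph.Subgraph.isPerfectMatching_iff] at hD
  rintro v ⟨w, hw⟩
  exact ⟨w, hw, fun w' hw' => tip_inj.1 ((hD _).unique hw' hw)⟩

lemma exists_adj_inner {D : SimpleGraph.Subgraph H} (hD : D.IsPerfectMatching) {v : U}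
    (hv : v ∉ (restrictMatching D).verts) :
    ∃ p, D.Adj (tip N β v) (innerVertex U β p) ∧ (v = B p.1 p.2 ∨ v = B (rot p).1 (rot p).2) := by
  rw [SimpleGraph.Subgraph.isPerfectMatching_iff] at hD
  obtain ⟨y, hy, -⟩ := hD (tip N β v)
  rcases bVert_cases y with ⟨w, rfl⟩ | ⟨p, rfl⟩ | ⟨k, z, rfl⟩
  · exact absurd ⟨w, hy⟩ hv
  · exact ⟨p, hy, adj_tip_inner.1 hy.adj_sub⟩
  · exact absurd hy.adj_sub not_adj_tip_centre

lemma exists_adj_target (hN4 : ∀ k, 4 ≤ N k)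
    (hB : Function.Injective fun p : Σ k, Fin (N k) => B p.1 p.2) {D : SimpleGraph.Subgraph H}
    (hD : D.IsPerfectMatching) (p : Σ k, Fin (N k)) :
    ∃ σ, D.Adj (innerVertex U β p) (target B (restrictMatching D).verts p σ) := by
  have hD' := hD
  rw [SimpleGraph.Subgraph.isPerfectMatching_iff] at hD'
  have htip : ∀ {v p}, D.Adj (innerVertex U β p) (tip N β v) → v ∉ (restrictMatching D).verts := by
    rintro v p h ⟨w, hw⟩
    exact tip_ne_inner ((hD' _).unique hw h.symm)
  have hrot : ∀ {p}, D.Adj (innerVertex U β p) (innerVertex U β (rot p)) →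
      B (rot p).1 (rot p).2 ∈ (restrictMatching D).verts := by
    intro p h
    by_contra hv
    obtain ⟨q, hq, h1 | h1⟩ := exists_adj_inner hD hv
    · rw [← hB (a₁ := rot p) (a₂ := q) h1] at hq
      exact tip_ne_inner ((hD' _).unique hq.symm h.symm)
    · rw [← rot.injective (hB (a₁ := rot p) (a₂ := rot q) h1)] at hq
      exact tip_ne_inner ((hD' _).unique hq.symm h)
  obtain ⟨y, hy, -⟩ := hD' (innerVertex U β p)
  rcases bVert_cases y with ⟨v, rfl⟩ | ⟨q, rfl⟩ | ⟨k, z, rfl⟩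
  · have hv := htip hy
    rcases adj_tip_inner.1 hy.adj_sub.symm with rfl | rfl
    · exact ⟨Sum.inl false, by simpa only [target, if_neg hv] using hy⟩
    · exact ⟨Sum.inl true, by simpa only [target, if_neg hv] using hy⟩
  · rcases (adj_inner_inner hN4).1 hy.adj_sub with rfl | rfl
    · exact ⟨Sum.inl true, by simpa only [target, if_pos (hrot hy)] using hy⟩
    · exact ⟨Sum.inl false, by
        simpa only [target, if_pos (hrot hy.symm), Equiv.symm_apply_apply] using hy⟩
  · obtain rfl := adj_inner_centre.1 hy.adj_sub
    exact ⟨Sum.inr z, hy⟩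

lemma exists_isBladeFamily_encodes (hN4 : ∀ k, 4 ≤ N k)
    (hB : Function.Injective fun p : Σ k, Fin (N k) => B p.1 p.2) {D : SimpleGraph.Subgraph H}
    (hD : D.IsPerfectMatching) :
    ∃ s : ∀ k, Fin (N k) → Bool ⊕ Fin (cond (β k) 1 0),
      IsBladeFamily B (restrictMatching D).verts s ∧ Encodes (restrictMatching D) s D := by
  have hD' := hD
  rw [SimpleGraph.Subgraph.isPerfectMatching_iff] at hD'
  choose σ hσ using exists_adj_target hN4 hB hD
  have huniq : ∀ {p τ}, D.Adj (innerVertex U β p) (target B (restrictMatching D).verts p τ) →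
      σ p = τ := fun {p τ} h => target_injective hN4 hB p ((hD' _).unique (hσ p) h)
  have hpos : ∀ p : Σ k, Fin (N k), (σ p = Sum.inl true ↔ σ (rot p) = Sum.inl false) ↔
      B (rot p).1 (rot p).2 ∈ (restrictMatching D).verts := by
    intro p
    by_cases hv : B (rot p).1 (rot p).2 ∈ (restrictMatching D).verts
    · refine iff_of_true ⟨fun h => huniq ?_, fun h => huniq ?_⟩ hv
      · have := hσ p
        simp only [h, target, if_pos hv] at this
        simpa only [target, if_pos hv, Equiv.symm_apply_apply] using this.symm
      · have := hσ (rot p)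
        simp only [h, target, if_pos hv, Equiv.symm_apply_apply] at this
        simpa only [target, if_pos hv] using this.symm
    · refine iff_of_false (fun h => ?_) hv
      have hboth : ¬ (σ p = Sum.inl true ∧ σ (rot p) = Sum.inl false) := by
        rintro ⟨h1, h2⟩
        have h3 := hσ p
        have h4 := hσ (rot p)
        simp only [h1, h2, target, if_neg hv] at h3 h4
        exact rot_ne_self hN4 p (inner_inj.1 ((hD' _).unique h4.symm h3.symm))
      have hone : σ p = Sum.inl true ∨ σ (rot p) = Sum.inl false := by
        obtain ⟨q, hq, h1 | h1⟩ := exists_adj_inner hD hv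
        · rw [← hB (a₁ := rot p) (a₂ := q) h1] at hq
          exact Or.inr (huniq (by simpa only [target, if_neg hv] using hq.symm))
        · rw [← rot.injective (hB (a₁ := rot p) (a₂ := rot q) h1)] at hq
          exact Or.inl (huniq (by simpa only [target, if_neg hv] using hq.symm))
      tauto
  refine ⟨fun k i => σ ⟨k, i⟩, fun k => ⟨fun t => (hpos ⟨k, t⟩).trans not_not.symm, fun z => ?_⟩,
    fun v w => Iff.rfl, hσ⟩
  obtain ⟨y, hy, -⟩ := hD' (centre U N z)
  rcases bVert_cases y with ⟨w, rfl⟩ | ⟨⟨l, i⟩, rfl⟩ | ⟨l, z', rfl⟩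
  · exact absurd hy.adj_sub.symm not_adj_tip_centre
  · obtain rfl := adj_inner_centre.1 hy.adj_sub.symm
    refine ⟨i, huniq hy.symm, fun j hj => ?_⟩
    have h := hσ ⟨_, j⟩
    rw [show σ ⟨_, j⟩ = Sum.inr z from hj] at h
    have := inner_inj.1 ((hD' _).unique h.symm hy)
    simpa using this
  · exact absurd hy.adj_sub not_adj_centre_centre

lemma exists_of_not_mem_restrictMatching {D : SimpleGraph.Subgraph H}
    (hD : D.IsPerfectMatching) (v : U) (hv : v ∉ (restrictMatching D).verts) :
    ∃ k t, v = B k t := by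
  obtain ⟨p, -, h | h⟩ := exists_adj_inner hD hv
  exacts [⟨_, _, h⟩, ⟨_, _, h⟩]

instance [Finite U] : Finite (BVert (V := U) b N β) :=
  inferInstanceAs (Finite (U ⊕ (Σ k : Fin b, Fin (N k) ⊕ Fin (cond (β k) 1 0))))

lemma finprod_augWeight [Finite U] {R : Type*} [CommRing R] (x : Sym2 U → R) (y : U → R)
    {M : G.Subgraph} (hM : M.IsMatching) {D : SimpleGraph.Subgraph H} (hD : D.IsPerfectMatching)
    (h : ∀ v w, D.Adj (tip N β v) (tip N β w) ↔ M.Adj v w) :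
    ∏ᶠ e ∈ D.edgeSet, augWeight b N β x y e =
      (∏ᶠ e ∈ M.edgeSet, x e) * ∏ᶠ v ∈ M.vertsᶜ, y v := by
  rw [SimpleGraph.Subgraph.isPerfectMatching_iff] at hD
  choose f hf huniq using hD
  have hout : ∀ v, v ∉ M.verts → ∃ a, f (tip N β v) = Sum.inr a := by
    intro v hv
    have h1 := hf (tip N β v)
    rcases hfv : f (tip N β v) with w | a
    · rw [hfv] at h1
      exact absurd ((h v w).1 h1).fst_mem hv
    · exact ⟨a, rfl⟩
  set A : Set (Sym2 (BVert (V := U) b N β)) := Sym2.map (tip N β) '' M.edgeSet with hA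
  set C : Set (Sym2 (BVert (V := U) b N β)) :=
    (fun v => s(tip N β v, f (tip N β v))) '' M.vertsᶜ with hC
  have hdisj : Disjoint A C := by
    rw [Set.disjoint_left]
    rintro _ ⟨e, he, rfl⟩ ⟨v, hv, hve⟩
    obtain ⟨a, ha⟩ := hout v hv
    induction e with
    | h u w =>
      simp only [ha, Sym2.map_mk] at hve
      rcases Sym2.eq_iff.1 hve with ⟨-, h2⟩ | ⟨-, h2⟩
      · exact Sum.inr_ne_inl h2
      · exact Sum.inr_ne_inl h2
  have hsupp : ∏ᶠ e ∈ D.edgeSet, augWeight b N β x y e =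
      ∏ᶠ e ∈ A ∪ C, augWeight b N β x y e := by
    refine finprod_mem_inter_mulSupport_eq' _ _ _ fun e he => ⟨fun h1 => ?_, ?_⟩
    · have key : ∀ v a, D.Adj (tip N β v) (Sum.inr a) → s(tip N β v, Sum.inr a) ∈ C := by
        intro v a hva
        have h2 : f (tip N β v) = Sum.inr a := (huniq _ _ hva).symm
        refine ⟨v, fun hv => ?_, by simp only [h2]⟩
        obtain ⟨w, hw, -⟩ := hM hv
        exact Sum.inr_ne_inl (h2.symm.trans (huniq _ _ ((h v w).2 hw)).symm)
      induction e with
      | h p q =>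
        rw [SimpleGraph.Subgraph.mem_edgeSet] at h1
        rcases p with v | a <;> rcases q with w | c
        · exact Or.inl ⟨s(v, w), (h v w).1 h1, rfl⟩
        · exact Or.inr (key v c h1)
        · exact Or.inr ((congrArg (· ∈ C) Sym2.eq_swap).mp (key w a h1.symm))
        · exact absurd rfl he
    · clear he
      rintro (⟨e, he, rfl⟩ | ⟨v, -, rfl⟩)
      · revert he
        induction e with
        | h u w => exact fun he => (h u w).2 he
      · exact hf _
  rw [hsupp, finprod_mem_union hdisj (Set.toFinite _) (Set.toFinite _), hA, hC,
    finprod_mem_image, finprod_mem_image]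
  · congr 1
    · refine finprod_congr fun e => finprod_congr fun _ => ?_
      induction e with
      | h u w => rfl
    · refine finprod_congr fun v => finprod_congr fun hv => ?_
      obtain ⟨a, ha⟩ := hout v hv
      rw [ha]
      rfl
  · intro v hv w hw hvw
    obtain ⟨a, ha⟩ := hout v hv
    obtain ⟨c, hc⟩ := hout w hw
    simp only [ha, hc] at hvw
    rcases Sym2.eq_iff.1 hvw with ⟨h1, -⟩ | ⟨h1, -⟩
    · exact tip_inj.1 h1
    · exact absurd h1 Sum.inl_ne_inr
  · exact (Sym2.map.injective fun _ _ => tip_inj.1).injOn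

lemma card_isBladeFamily (hN4 : ∀ k, 4 ≤ N k) (hNeven : ∀ k, Even (N k))
    (hS : ∀ k : Fin b, Nat.card {t : Fin (N k) // B k t ∉ S} % 2 = cond (β k) 1 0) :
    Nat.card {s : ∀ k, Fin (N k) → Bool ⊕ Fin (cond (β k) 1 0) // IsBladeFamily B S s} =
      2 ^ (Finset.univ.filter fun k => β k = false).card *
        ∏ k ∈ Finset.univ.filter fun k => β k = true, N k := by
  have hk : ∀ k, Nat.card {s : Fin (N k) → Bool ⊕ Fin (cond (β k) 1 0) //
      IsBladeConfig {t | B k t ∉ S} s} = if β k = true then N k else 2 := by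
    intro k
    have hSk := hS k
    generalize β k = c at hSk
    cases c
    · exact card_isBladeConfig_of_isEmpty (Z := Fin 0) (hNeven k)
        ⟨0, by have := hN4 k; omega⟩ hSk
    · exact card_isBladeConfig_of_unique (Z := Fin 1) (hNeven k) hSk
  rw [Nat.card_congr Equiv.subtypePiEquivPi, Nat.card_pi]
  simp only [hk, Finset.prod_ite, Finset.prod_const, Bool.not_eq_true]
  rw [mul_comm]

end Augmented

/-- **Lemma 3.2**: relation between the dimer partition function of the
shuriken-augmented graph `G_β` and the partial boundary monomer-dimer partition function:
`Z_D(G_β) = 2^{#{k : β_k = 0}} (∏_{k : β_k = 1} N_k) · Z_MD^β(G)`, for any finite simple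
graph `G` with edge weights `x` and vertex weights `y`, any pairwise disjoint cyclically
ordered lists `B k` of distinct vertices of `G` of even lengths `N k ≥ 4`, and any
`β ∈ {0,1}^b`. -/
theorem dimerZ_shurikenAugmented_eq (G : SimpleGraph V) (x : Sym2 V → R) (y : V → R)
    (b : ℕ) (N : Fin b → ℕ) (hN4 : ∀ k, 4 ≤ N k) (hNeven : ∀ k, Even (N k))
    (B : (k : Fin b) → Fin (N k) → V)
    (hB : Function.Injective (fun p : Σ k : Fin b, Fin (N k) => B p.1 p.2))
    (β : Fin b → Bool) :
    dimerZ (shurikenAugmented G b N β B) (augWeight b N β x y) =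
      (2 : R) ^ (Finset.univ.filter fun k => β k = false).card *
        (∏ k ∈ Finset.univ.filter fun k => β k = true, (N k : R)) *
        monomerDimerZ G x y b N β B := by
  classical
  let XM : Type _ := ({M : G.Subgraph | M.IsMatching ∧
      (∀ v : V, v ∉ M.verts → ∃ k t, v = B k t) ∧
      (∀ k : Fin b, Nat.card {t : Fin (N k) // B k t ∉ M.verts} % 2 = cond (β k) 1 0)} :
        Set G.Subgraph)
  let Y := Σ M : XM, {s : ∀ k, Fin (N k) → Bool ⊕ Fin (cond (β k) 1 0) //
    IsBladeFamily B M.1.verts s}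
  let X : Type _ := ({D : (shurikenAugmented G b N β B).Subgraph | D.IsPerfectMatching} :
    Set (shurikenAugmented G b N β B).Subgraph)
  have : Finite (shurikenAugmented G b N β B).Subgraph :=
    Finite.of_injective
      (fun D : (shurikenAugmented G b N β B).Subgraph => (D.verts, D.Adj))
      fun D D' h => SimpleGraph.Subgraph.ext (congrArg Prod.fst h) (congrArg Prod.snd h)
  have : Finite G.Subgraph :=
    Finite.of_injective (fun D : G.Subgraph => (D.verts, D.Adj))
      fun D D' h => SimpleGraph.Subgraph.ext (congrArg Prod.fst h) (congrArg Prod.snd h)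
  have : Fintype X := Fintype.ofFinite _
  have : Fintype XM := Fintype.ofFinite _
  choose g hg using fun m : Y =>
    exists_encodes (β := β) hN4 hB m.1.2.1 m.1.2.2.1 m.2.2
  let φ : Y → X := fun m => ⟨g m, (hg m).1⟩
  have hφ : Function.Bijective φ := by
    constructor
    · rintro ⟨⟨M, hM⟩, s, hs⟩ ⟨⟨M', hM'⟩, s', hs'⟩ h
      have h1 := (hg ⟨⟨M, hM⟩, s, hs⟩).2
      have h2 := (hg ⟨⟨M', hM'⟩, s', hs'⟩).2
      rw [← show g ⟨⟨M, hM⟩, s, hs⟩ = g ⟨⟨M', hM'⟩, s', hs'⟩ from congrArg Subtype.val h] at h2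
      obtain rfl := h1.matching_unique hM.1 hM'.1 h2
      obtain rfl := h1.family_unique hN4 hB (hg _).1 h2
      rfl
    · rintro ⟨D, hD⟩
      obtain ⟨s, hs, hsD⟩ := exists_isBladeFamily_encodes hN4 hB hD
      have hM := restrictMatching_isMatching hD
      have hMB := exists_of_not_mem_restrictMatching hD
      have hpar : ∀ k : Fin b,
          Nat.card {t : Fin (N k) // B k t ∉ (restrictMatching D).verts} % 2 =
            cond (β k) 1 0 := by
        intro k
        have := (hs k).parity (hNeven k) (by cases β k <;> simp)
        rwa [Fintype.card_fin] at this
      let m : Y := ⟨⟨restrictMatching D, hM, hMB, hpar⟩, s, hs⟩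
      exact ⟨m, Subtype.ext (Encodes.subgraph_unique hM hMB hs (hg m).1 hD (hg m).2 hsD)⟩
  unfold dimerZ monomerDimerZ
  rw [← finsum_set_coe_eq_finsum_mem, ← finsum_set_coe_eq_finsum_mem]
  refine (finsum_eq_sum_of_fintype (α := X) _).trans ?_
  refine Eq.trans ?_ (congrArg _ (finsum_eq_sum_of_fintype (α := XM) _).symm)
  rw [← Fintype.sum_bijective φ hφ _ _ fun m =>
    (finprod_augWeight x y m.1.2.1 (hg m).1 (hg m).2.adj_tip).symm, Fintype.sum_sigma,
    Finset.mul_sum]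
  refine Finset.sum_congr rfl fun M _ => ?_
  dsimp only
  rw [Finset.sum_const, Finset.card_univ, ← Nat.card_eq_fintype_card,
    card_isBladeFamily hN4 hNeven M.2.2.2, nsmul_eq_mul]
  push_cast
  rfl

end
end

section
/- Pfaffian identity for one boundary circuit of even monomer parity (Equation (0) in the proof of Proposition 3.3): Let N = 2n ≥ 4 be even, let R be a commutative ring, let y_1,…,y_N ∈ R, and let S be an arbitrary skew-symmetric N×N matrix over R. Define the N×N matrix A by a_{1,1} = -y_1, a_{1,N} = y_1, a_{i,i-1} = a_{i,i} = (-1)^i y_i for 2 ≤ i ≤ N, and all other entries 0. Define the skew-symmetric N×N matrix B by b_{i,i+1} = -1 = -b_{i+1,i} for 1 ≤ i ≤ N-1, b_{1,N} = -1 = -b_{N,1}, and all other entries 0. Define the skew-symmetric N×N matrix M by m_{ij} = s_{ij} + (-1)^{i+j} y_i y_j for i < j. Then the Pfaffian of the 2N×2N block matrix [[S, A],[-Aᵀ, B]] equals 2·(-1)^n·Pf(M). -/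
open Matrix

/-- The Pfaffian of a matrix indexed by `Fin m` (intended for even `m`), defined as the
sum over all partitions of the index set into pairs (encoded by their canonical
representative permutations `σ`, sending the positions `2k, 2k+1` to the pair `(i_k, j_k)`
with `i_k < j_k` and `i_1 < i_2 < ⋯`) of the sign of `σ` times the product of the
corresponding entries. -/
def pf {R : Type*} [CommRing R] {m : ℕ} (A : Matrix (Fin m) (Fin m) R) : R :=
  ∑ σ ∈ Finset.univ.filter (fun σ : Equiv.Perm (Fin m) =>
      (∀ k : Fin (m / 2), σ ⟨2 * k.1, by have := k.2; omega⟩ < σ ⟨2 * k.1 + 1, by have := k.2; omega⟩) ∧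
      (∀ k l : Fin (m / 2), k < l →
        σ ⟨2 * k.1, by have := k.2; omega⟩ < σ ⟨2 * l.1, by have := l.2; omega⟩)),
    (Equiv.Perm.sign σ : ℤ) • ∏ k : Fin (m / 2),
      A (σ ⟨2 * k.1, by have := k.2; omega⟩) (σ ⟨2 * k.1 + 1, by have := k.2; omega⟩)

/-- The `N × N` blade-edge matrix `A` (even type, 1-based description):
`a_{1,1} = -y_1`, `a_{1,N} = y_1`, `a_{i,i-1} = a_{i,i} = (-1)^i y_i` for `2 ≤ i ≤ N`,
all other entries `0`.  (Here indices are 0-based, whence the exponent `i.1 + 1`.) -/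
def shurA {R : Type*} [CommRing R] (N : ℕ) (y : Fin N → R) : Matrix (Fin N) (Fin N) R :=
  fun i j =>
    if i.1 = 0 then (if j.1 = 0 then -y i else if j.1 = N - 1 then y i else 0)
    else if j.1 + 1 = i.1 ∨ j.1 = i.1 then (-1 : R) ^ (i.1 + 1) * y i else 0

/-- The `N × N` inner-cycle matrix `B` (even type, 1-based description):
`b_{i,i+1} = -1 = -b_{i+1,i}` for `1 ≤ i ≤ N-1`, `b_{1,N} = -1 = -b_{N,1}`,
all other entries `0`. -/
def shurB {R : Type*} [CommRing R] (N : ℕ) : Matrix (Fin N) (Fin N) R :=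
  fun i j =>
    if i.1 + 1 = j.1 then -1
    else if j.1 + 1 = i.1 then 1
    else if i.1 = 0 ∧ j.1 = N - 1 then -1
    else if j.1 = 0 ∧ i.1 = N - 1 then 1
    else 0

/-- The modified matrix `M` with `m_{ij} = s_{ij} + (-1)^{i+j} y_i y_j` for `i < j`,
extended skew-symmetrically (the parity of `i.1 + j.1` in 0-based indices agrees with
that of `i + j` in 1-based ones). -/
def modM {R : Type*} [CommRing R] (N : ℕ) (S : Matrix (Fin N) (Fin N) R) (y : Fin N → R) :
    Matrix (Fin N) (Fin N) R :=
  fun i j =>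
    S i j + (if i < j then (-1 : R) ^ (i.1 + j.1) * y i * y j
             else if j < i then -((-1 : R) ^ (i.1 + j.1) * y i * y j) else 0)

/-- The canonical representatives over which the sum defining `pf` runs. -/
def IsCanonicalPairing {n : ℕ} (σ : Equiv.Perm (Fin (2 * n))) : Prop :=
  (∀ k : Fin n, σ ⟨2 * k.1, by omega⟩ < σ ⟨2 * k.1 + 1, by omega⟩) ∧
    ∀ k l : Fin n, k < l → σ ⟨2 * k.1, by omega⟩ < σ ⟨2 * l.1, by omega⟩

open Classical in
theorem pf_two_mul {R : Type*} [CommRing R] (n : ℕ) (A : Matrix (Fin (2 * n)) (Fin (2 * n)) R) :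
    pf A = ∑ σ : Equiv.Perm (Fin (2 * n)) with IsCanonicalPairing σ,
      (Equiv.Perm.sign σ : ℤ) • ∏ k : Fin n,
        A (σ ⟨2 * k.1, by omega⟩) (σ ⟨2 * k.1 + 1, by omega⟩) := by
  have h : n = 2 * n / 2 := by omega
  unfold pf
  refine Finset.sum_congr ?_ fun σ _ => ?_
  · ext σ
    rw [Finset.mem_filter, Finset.mem_filter]
    refine and_congr_right fun _ => and_congr ?_ ?_
    · exact (Fin.castOrderIso h).symm.forall_congr fun _ => Iff.rfl
    · exact (Fin.castOrderIso h).symm.forall_congr fun _ =>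
        (Fin.castOrderIso h).symm.forall_congr fun _ => Iff.rfl
  · congr 1
    exact Fintype.prod_equiv (finCongr h.symm) _ _ fun _ => rfl

theorem pf_congr_of_lt {R : Type*} [CommRing R] {m : ℕ} {A B : Matrix (Fin m) (Fin m) R}
    (h : ∀ i j, i < j → A i j = B i j) : pf A = pf B := by
  unfold pf
  refine Finset.sum_congr rfl fun σ hσ => ?_
  congr 1
  exact Finset.prod_congr rfl fun k _ => h _ _ ((Finset.mem_filter.1 hσ).2.1 k)

theorem pf_map {R T : Type*} [CommRing R] [CommRing T] {m : ℕ} (f : R →+* T)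
    (A : Matrix (Fin m) (Fin m) R) : pf (A.map f) = f (pf A) := by
  simp [pf, map_sum, map_prod, Matrix.map_apply]

theorem pf_zero {R : Type*} [CommRing R] (A : Matrix (Fin (2 * 0)) (Fin (2 * 0)) R) :
    pf A = 1 := by
  rw [pf_two_mul]
  simp [IsCanonicalPairing]

/-- Prepend the pair `(0, j + 1)` to a permutation of the remaining indices. -/
def prependPair {m : ℕ} (j : Fin (m + 1)) (τ : Equiv.Perm (Fin m)) : Equiv.Perm (Fin (m + 2)) :=
  Equiv.Perm.decomposeFin.symm
    (0, (Fin.cycleRange j)⁻¹ * Equiv.Perm.decomposeFin.symm (0, τ))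

theorem prependPair_zero {m : ℕ} (j : Fin (m + 1)) (τ : Equiv.Perm (Fin m)) :
    prependPair j τ 0 = 0 := by
  simp [prependPair]

theorem prependPair_one {m : ℕ} (j : Fin (m + 1)) (τ : Equiv.Perm (Fin m)) :
    prependPair j τ 1 = j.succ := by
  rw [← Fin.succ_zero_eq_one, prependPair, Equiv.Perm.decomposeFin_symm_apply_succ]
  simp [Equiv.Perm.inv_def]

theorem prependPair_succ_succ {m : ℕ} (j : Fin (m + 1)) (τ : Equiv.Perm (Fin m)) (i : Fin m) :
    prependPair j τ i.succ.succ = (j.succAbove (τ i)).succ := by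
  rw [prependPair, Equiv.Perm.decomposeFin_symm_apply_succ]
  simp [Equiv.Perm.inv_def]

theorem sign_prependPair {m : ℕ} (j : Fin (m + 1)) (τ : Equiv.Perm (Fin m)) :
    Equiv.Perm.sign (prependPair j τ) = (-1) ^ (j : ℕ) * Equiv.Perm.sign τ := by
  simp [prependPair, Fin.sign_cycleRange]

theorem prependPair_injective {m : ℕ} :
    Function.Injective fun p : Fin (m + 1) × Equiv.Perm (Fin m) => prependPair p.1 p.2 := by
  rintro ⟨j, τ⟩ ⟨j', τ'⟩ h
  have h : prependPair j τ = prependPair j' τ' := h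
  have h1 := congrArg (fun σ => σ 1) h
  simp only [prependPair_one, Fin.succ_inj] at h1
  subst h1
  refine Prod.ext rfl (Equiv.ext fun i => ?_)
  have h2 := congrArg (fun σ => σ i.succ.succ) h
  simpa only [prependPair_succ_succ, Fin.succ_inj, Fin.succAbove_right_inj] using h2

theorem exists_decomposeFin_symm_zero {m : ℕ} (σ : Equiv.Perm (Fin (m + 1))) (h : σ 0 = 0) :
    ∃ τ, σ = Equiv.Perm.decomposeFin.symm (0, τ) := by
  obtain ⟨⟨p, τ⟩, rfl⟩ := Equiv.Perm.decomposeFin.symm.surjective σ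
  rw [Equiv.Perm.decomposeFin_symm_apply_zero] at h
  exact ⟨τ, by rw [h]⟩

theorem exists_prependPair {m : ℕ} (σ : Equiv.Perm (Fin (m + 2))) (h : σ 0 = 0) :
    ∃ j τ, σ = prependPair j τ := by
  obtain ⟨σ', rfl⟩ := exists_decomposeFin_symm_zero σ h
  obtain ⟨τ, hτ⟩ := exists_decomposeFin_symm_zero (Fin.cycleRange (σ' 0) * σ') (by simp)
  exact ⟨σ' 0, τ, by rw [prependPair, ← hτ, inv_mul_cancel_left]⟩

theorem isCanonicalPairing_prependPair {n : ℕ} (j : Fin (2 * n + 1))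
    (τ : Equiv.Perm (Fin (2 * n))) :
    IsCanonicalPairing (n := n + 1) (prependPair j τ) ↔ IsCanonicalPairing τ := by
  have h2 : ∀ (i : ℕ) (hi : i < 2 * n), prependPair j τ ⟨i + 2, by omega⟩ =
      (j.succAbove (τ ⟨i, hi⟩)).succ := fun i hi => prependPair_succ_succ j τ ⟨i, hi⟩
  have hlt : ∀ a b : Fin (2 * n), (j.succAbove a).succ < (j.succAbove b).succ ↔ a < b := by
    intro a b
    rw [Fin.succ_lt_succ_iff, Fin.succAbove_lt_succAbove_iff]
  have h0 : prependPair j τ ⟨0, by omega⟩ = 0 := prependPair_zero j τ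
  have h1 : prependPair j τ ⟨1, by omega⟩ = j.succ := prependPair_one j τ
  unfold IsCanonicalPairing
  constructor
  · rintro ⟨ha, hb⟩
    refine ⟨fun k => ?_, fun k l hkl => ?_⟩
    · have := ha k.succ
      rw [← hlt, ← h2, ← h2]
      exact this
    · have := hb k.succ l.succ (Fin.succ_lt_succ_iff.2 hkl)
      rw [← hlt, ← h2, ← h2]
      exact this
  · rintro ⟨ha, hb⟩
    refine ⟨fun k => ?_, fun k l hkl => ?_⟩
    · refine Fin.cases ?_ (fun k => ?_) k
      · exact (h0.trans_lt (Fin.succ_pos j)).trans_eq h1.symm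
      · have := (hlt _ _).2 (ha k)
        rw [← h2, ← h2] at this
        exact this
    · obtain ⟨l, rfl⟩ := Fin.exists_succ_eq.2 (Fin.ne_zero_of_lt hkl)
      revert hkl
      refine Fin.cases (fun _ => ?_) (fun k hkl => ?_) k
      · have := Fin.succ_pos (j.succAbove (τ ⟨2 * l.1, by omega⟩))
        rw [← h2] at this
        exact h0.trans_lt this
      · have := (hlt _ _).2 (hb k l (Fin.succ_lt_succ_iff.1 hkl))
        rw [← h2, ← h2] at this
        exact this

theorem IsCanonicalPairing.apply_zero {n : ℕ} {σ : Equiv.Perm (Fin (2 * (n + 1)))}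
    (h : IsCanonicalPairing σ) : σ ⟨0, by omega⟩ = ⟨0, by omega⟩ := by
  obtain ⟨⟨i, hi⟩, h0⟩ := σ.surjective ⟨0, by omega⟩
  have key : ∀ a, ¬ σ a < σ ⟨i, hi⟩ := fun a => by
    rw [h0, Fin.lt_def]
    exact Nat.not_lt_zero _
  obtain ⟨k, rfl | rfl⟩ := Nat.even_or_odd' i
  · rcases Nat.eq_zero_or_pos k with rfl | hk
    · exact h0
    · exact absurd (h.2 ⟨0, by omega⟩ ⟨k, by omega⟩ hk) (key _)
  · exact absurd (h.1 ⟨k, by omega⟩) (key _)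

/-- Expansion of the Pfaffian along the first row. -/
theorem pf_succ {R : Type*} [CommRing R] (n : ℕ)
    (A : Matrix (Fin (2 * (n + 1))) (Fin (2 * (n + 1))) R) :
    pf A = ∑ j : Fin (2 * n + 1), (-1) ^ (j : ℕ) * A (0 : Fin (2 * n + 2)) j.succ *
      pf (A.submatrix (fun i : Fin (2 * n) => (j.succAbove i).succ)
        (fun i : Fin (2 * n) => (j.succAbove i).succ)) := by
  classical
  rw [pf_two_mul]
  simp_rw [pf_two_mul, Finset.mul_sum]
  rw [← Finset.sum_product']
  symm
  refine Finset.sum_bij (fun p _ => prependPair p.1 p.2) ?_ ?_ ?_ ?_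
  · rintro ⟨j, τ⟩ h
    simp only [Finset.mem_product, Finset.mem_filter, Finset.mem_univ, true_and] at h ⊢
    exact (isCanonicalPairing_prependPair j τ).2 h
  · intro p _ q _ h
    exact prependPair_injective h
  · intro σ hσ
    have hσ := (Finset.mem_filter.1 hσ).2
    obtain ⟨j, τ, rfl⟩ := exists_prependPair (m := 2 * n) σ hσ.apply_zero
    refine ⟨(j, τ), ?_, rfl⟩
    simpa using (isCanonicalPairing_prependPair j τ).1 hσ
  · rintro ⟨j, τ⟩ _
    have h2 : ∀ (i : ℕ) (hi : i < 2 * n), prependPair j τ ⟨i + 2, by omega⟩ =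
        (j.succAbove (τ ⟨i, hi⟩)).succ := fun i hi => prependPair_succ_succ j τ ⟨i, hi⟩
    rw [Fin.prod_univ_succ]
    have e0 : A ((prependPair j τ : Equiv.Perm (Fin (2 * n + 2))) ⟨2 * (0 : Fin (n + 1)).1, by simp⟩)
        ((prependPair j τ : Equiv.Perm (Fin (2 * n + 2))) ⟨2 * (0 : Fin (n + 1)).1 + 1, by simp⟩) =
        A (0 : Fin (2 * n + 2)) j.succ :=
      congrArg₂ A (prependPair_zero j τ) (prependPair_one j τ)
    have e1 : ∀ k : Fin n,
        A ((prependPair j τ : Equiv.Perm (Fin (2 * n + 2))) ⟨2 * k.succ.1, by rw [Fin.val_succ]; omega⟩)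
        ((prependPair j τ : Equiv.Perm (Fin (2 * n + 2))) ⟨2 * k.succ.1 + 1, by rw [Fin.val_succ]; omega⟩) =
        A (j.succAbove (τ ⟨2 * k.1, by omega⟩)).succ
          (j.succAbove (τ ⟨2 * k.1 + 1, by omega⟩)).succ := fun k =>
      congrArg₂ A (h2 _ _) (h2 _ _)
    have es : Equiv.Perm.sign (prependPair j τ : Equiv.Perm (Fin (2 * (n + 1)))) =
        (-1) ^ (j : ℕ) * Equiv.Perm.sign τ := sign_prependPair j τ
    erw [e0, Finset.prod_congr rfl fun k _ => e1 k, es]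
    simp only [zsmul_eq_mul, Matrix.submatrix_apply]
    push_cast
    ring

section Berezin

open ExteriorAlgebra CliffordAlgebra

variable {R V : Type*} [CommRing R] [AddCommGroup V] [Module R V]

theorem contractLeft_ι_mul_exterior (d : Module.Dual R V) (a : V) (x : ExteriorAlgebra R V) :
    contractLeft (Q := (0 : QuadraticForm R V)) d (ExteriorAlgebra.ι R a * x) =
      d a • x - ExteriorAlgebra.ι R a * contractLeft (Q := (0 : QuadraticForm R V)) d x :=
  contractLeft_ι_mul d a x

/-- Contraction is an antiderivation, evaluated on a product of vectors. -/
theorem contractLeft_ιMulti (d : Module.Dual R V) (m : ℕ) (v : Fin (m + 1) → V) :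
    contractLeft (Q := (0 : QuadraticForm R V)) d (ιMulti R (m + 1) v) =
      ∑ j : Fin (m + 1), ((-1) ^ (j : ℕ) * d (v j)) • ιMulti R m fun i => v (j.succAbove i) := by
  induction m with
  | zero =>
    rw [ιMulti_succ_apply, contractLeft_ι_mul_exterior]
    simp [contractLeft_one]
  | succ m ih =>
    rw [ιMulti_succ_apply, contractLeft_ι_mul_exterior, Fin.sum_univ_succ, ih, Finset.mul_sum,
      sub_eq_add_neg, ← Finset.sum_neg_distrib]
    refine congrArg₂ (· + ·) ?_ (Finset.sum_congr rfl fun j _ => ?_)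
    · simp [Matrix.vecTail, Function.comp_def]
    · rw [ιMulti_succ_apply (R := R) (fun i => v (j.succ.succAbove i)), mul_smul_comm, ← neg_smul]
      simp [Matrix.vecTail, Function.comp_def, pow_succ]

theorem contractLeft_mul_of_eq_zero (d : Module.Dual R V) (x y : ExteriorAlgebra R V)
    (hy : contractLeft (Q := (0 : QuadraticForm R V)) d y = 0) :
    contractLeft (Q := (0 : QuadraticForm R V)) d (x * y) =
      contractLeft (Q := (0 : QuadraticForm R V)) d x * y := by
  induction x using CliffordAlgebra.left_induction with
  | algebraMap r =>
    rw [contractLeft_algebraMap_mul, contractLeft_algebraMap]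
    simp [hy]
  | add x x' hx hx' => rw [add_mul, map_add, map_add, hx, hx', add_mul]
  | ι_mul x v hx =>
    rw [mul_assoc, contractLeft_ι_mul, contractLeft_ι_mul, hx, sub_mul, smul_mul_assoc, mul_assoc]

theorem ι_mul_ιMulti_mul_eq_zero (u : V) (x : ExteriorAlgebra R V)
    (hx : ExteriorAlgebra.ι R u * x = 0) (m : ℕ) (v : Fin m → V) :
    ExteriorAlgebra.ι R u * (ιMulti R m v * x) = 0 := by
  induction m with
  | zero => simpa using hx
  | succ m ih =>
    rw [ιMulti_succ_apply, mul_assoc, ← mul_assoc, eq_neg_of_add_eq_zero_left (ι_add_mul_swap u _),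
      neg_mul, mul_assoc, ih, mul_zero, neg_zero]

theorem ιMulti_add_mul (x : ExteriorAlgebra R V) (m : ℕ) (v u : Fin m → V)
    (hu : ∀ i, ExteriorAlgebra.ι R (u i) * x = 0) :
    ιMulti R m (v + u) * x = ιMulti R m v * x := by
  induction m with
  | zero => simp
  | succ m ih =>
    have h := ih (Matrix.vecTail v) (Matrix.vecTail u) fun i => hu i.succ
    rw [ιMulti_succ_apply, ιMulti_succ_apply, mul_assoc, mul_assoc, Matrix.tail_add, h,
      Pi.add_apply, map_add, add_mul, ι_mul_ιMulti_mul_eq_zero _ _ (hu 0), add_zero]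

theorem neg_toQuadraticMap_of_isAlt {ω : LinearMap.BilinForm R V} (hω : ω.IsAlt) :
    (-ω).toQuadraticMap = (0 : QuadraticForm R V) - 0 := by
  ext v
  simp [hω.self_eq_zero v]

/-- The scalar part of the exterior algebra deformed by an alternating form; on products of vectors
it is the Pfaffian of their Gram matrix. -/
noncomputable def gramPfaffian (ω : LinearMap.BilinForm R V) (hω : ω.IsAlt) :
    ExteriorAlgebra R V →ₗ[R] R :=
  (algebraMapInv (M := V)).toLinearMap ∘ₗ changeForm (neg_toQuadraticMap_of_isAlt hω)

variable {ω : LinearMap.BilinForm R V} (hω : ω.IsAlt)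

theorem gramPfaffian_one : gramPfaffian ω hω 1 = 1 := by
  have : changeForm (neg_toQuadraticMap_of_isAlt hω) (1 : ExteriorAlgebra R V) = 1 :=
    changeForm_one _
  rw [gramPfaffian, LinearMap.comp_apply, this]
  exact map_one (algebraMapInv (M := V))

theorem gramPfaffian_ι_mul (v : V) (x : ExteriorAlgebra R V) :
    gramPfaffian ω hω (ExteriorAlgebra.ι R v * x) =
      gramPfaffian ω hω (contractLeft (Q := (0 : QuadraticForm R V)) (ω v) x) := by
  have h : changeForm (neg_toQuadraticMap_of_isAlt hω) (ExteriorAlgebra.ι R v * x) =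
      ExteriorAlgebra.ι R v * changeForm (neg_toQuadraticMap_of_isAlt hω) x +
        changeForm (neg_toQuadraticMap_of_isAlt hω)
          (contractLeft (Q := (0 : QuadraticForm R V)) (ω v) x) := by
    refine (changeForm_ι_mul _ v x).trans ?_
    rw [changeForm_contractLeft, LinearMap.neg_apply, map_neg, LinearMap.neg_apply, sub_neg_eq_add]
  have h0 : algebraMapInv (ExteriorAlgebra.ι R v) = 0 := by simp [algebraMapInv]
  have h1 : ∀ z : ExteriorAlgebra R V,
      algebraMapInv (ExteriorAlgebra.ι R v * z) = 0 := fun z => by rw [map_mul, h0, zero_mul]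
  rw [gramPfaffian, LinearMap.comp_apply, LinearMap.comp_apply, h, map_add]
  exact (congrArg (· + _) (h1 _)).trans (zero_add _)

theorem gramPfaffian_ιMulti_succ_succ (m : ℕ) (v : Fin (m + 2) → V) :
    gramPfaffian ω hω (ιMulti R (m + 2) v) =
      ∑ j : Fin (m + 1), (-1) ^ (j : ℕ) * ω (v 0) (v j.succ) *
        gramPfaffian ω hω (ιMulti R m fun i => v (j.succAbove i).succ) := by
  rw [ιMulti_succ_apply, gramPfaffian_ι_mul, contractLeft_ιMulti, map_sum]
  simp only [map_smul, smul_eq_mul]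
  rfl

theorem gramPfaffian_ιMulti (n : ℕ) (v : Fin (2 * n) → V) :
    gramPfaffian ω hω (ιMulti R (2 * n) v) = pf (Matrix.of fun i j => ω (v i) (v j)) := by
  induction n with
  | zero =>
    rw [pf_zero]
    exact (congrArg _ (ιMulti_zero_apply v)).trans (gramPfaffian_one hω)
  | succ n ih =>
    rw [pf_succ]
    refine (gramPfaffian_ιMulti_succ_succ hω (2 * n) v).trans (Finset.sum_congr rfl fun j _ => ?_)
    rw [ih]
    rfl

/-- `gramPfaffian` is multiplicative across orthogonal factors. -/
theorem gramPfaffian_ιMulti_mul (y : ExteriorAlgebra R V) (n : ℕ) (v : Fin (2 * n) → V)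
    (hv : ∀ i, contractLeft (Q := (0 : QuadraticForm R V)) (ω (v i)) y = 0) :
    gramPfaffian ω hω (ιMulti R (2 * n) v * y) =
      gramPfaffian ω hω (ιMulti R (2 * n) v) * gramPfaffian ω hω y := by
  induction n with
  | zero =>
    have h : ιMulti R (2 * 0) v = 1 := ιMulti_zero_apply v
    rw [h, gramPfaffian_one, one_mul, one_mul]
  | succ n ih =>
    change Fin (2 * n + 2) → V at v
    have h : gramPfaffian ω hω (ιMulti R (2 * n + 2) v * y) =
        gramPfaffian ω hω (ιMulti R (2 * n + 2) v) * gramPfaffian ω hω y := by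
      rw [gramPfaffian_ιMulti_succ_succ, ιMulti_succ_apply, mul_assoc, gramPfaffian_ι_mul,
        contractLeft_mul_of_eq_zero _ _ _ (hv 0), contractLeft_ιMulti, Finset.sum_mul, map_sum,
        Finset.sum_mul]
      refine Finset.sum_congr rfl fun j _ => ?_
      rw [smul_mul_assoc, map_smul, smul_eq_mul, mul_assoc (_ * _)]
      exact congrArg _ (ih (fun i => v (j.succAbove i).succ) fun i => hv _)
    exact h

end Berezin

theorem pf_path {R : Type*} [CommRing R] (n : ℕ) :
    pf (Matrix.of fun i j : Fin (2 * n) =>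
      if i.1 + 1 = j.1 then (-1 : R) else if j.1 + 1 = i.1 then 1 else 0) = (-1) ^ n := by
  induction n with
  | zero => rw [pf_zero, pow_zero]
  | succ n ih =>
    have b : ∀ j : Fin (2 * n + 1), (0 : Fin (2 * n + 2)).1 + 1 = j.succ.1 ↔ j.1 = 0 := by
      intro j
      rw [Fin.val_zero, Fin.val_succ]
      omega
    rw [pf_succ, Fintype.sum_eq_single 0, pow_succ, ← ih]
    · rw [Matrix.of_apply, if_pos ((b 0).2 rfl)]
      simp only [Fin.val_zero, pow_zero, neg_one_mul, mul_neg_one]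
      refine congrArg _ (congrArg pf ?_)
      ext i j
      simp only [Matrix.submatrix_apply, Matrix.of_apply, Fin.succAbove_zero, Fin.val_succ,
        Nat.add_right_cancel_iff]
    · intro j hj
      have hj : j.1 ≠ 0 := fun h => hj (Fin.ext h)
      rw [Matrix.of_apply, if_neg (mt (b j).1 hj), if_neg (by simp), mul_zero, zero_mul]

theorem pf_shurB {R : Type*} [CommRing R] (n : ℕ) (hn : 2 ≤ n) :
    pf (shurB (R := R) (2 * n)) = 2 * (-1) ^ n := by
  obtain ⟨n, rfl⟩ : ∃ k, n = k + 1 := ⟨n - 1, by omega⟩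
  have h0 : ∀ i : Fin (2 * n), ((0 : Fin (2 * n + 1)).succAbove i).succ.1 = i.1 + 2 := by simp
  have h1 : ∀ i : Fin (2 * n), ((Fin.last (2 * n)).succAbove i).succ.1 = i.1 + 1 := by simp
  have e0 : (shurB (R := R) (2 * (n + 1))).submatrix
      (fun i : Fin (2 * n) => ((0 : Fin (2 * n + 1)).succAbove i).succ)
      (fun i : Fin (2 * n) => ((0 : Fin (2 * n + 1)).succAbove i).succ) =
      Matrix.of fun i j : Fin (2 * n) =>
        if i.1 + 1 = j.1 then (-1 : R) else if j.1 + 1 = i.1 then 1 else 0 := by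
    ext i j
    simp only [Matrix.submatrix_apply, shurB, h0, Matrix.of_apply]
    grind
  have e1 : (shurB (R := R) (2 * (n + 1))).submatrix
      (fun i : Fin (2 * n) => ((Fin.last (2 * n)).succAbove i).succ)
      (fun i : Fin (2 * n) => ((Fin.last (2 * n)).succAbove i).succ) =
      Matrix.of fun i j : Fin (2 * n) =>
        if i.1 + 1 = j.1 then (-1 : R) else if j.1 + 1 = i.1 then 1 else 0 := by
    ext i j
    simp only [Matrix.submatrix_apply, shurB, h1, Matrix.of_apply]
    grind
  have hne : (0 : Fin (2 * n + 1)) ≠ Fin.last (2 * n) := by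
    rw [Ne, Fin.ext_iff, Fin.val_zero, Fin.val_last]
    omega
  have b : ∀ j : Fin (2 * n + 1), shurB (R := R) (2 * (n + 1)) (0 : Fin (2 * n + 2)) j.succ =
      if j.1 = 0 ∨ j.1 = 2 * n then -1 else 0 := by
    intro j
    simp only [shurB, Fin.val_zero, Fin.val_succ]
    grind
  rw [pf_succ, Fintype.sum_eq_add 0 (Fin.last (2 * n)) hne, e0, e1, pf_path, b, b]
  · simp
    ring
  · rintro j ⟨hj0, hj1⟩
    have : ¬(j.1 = 0 ∨ j.1 = 2 * n) := fun h => h.elim (fun h => hj0 (Fin.ext h))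
      fun h => hj1 (Fin.ext h)
    rw [b, if_neg this, mul_zero, zero_mul]

theorem toBilin'_isAlt {R ι : Type*} [CommRing R] [Invertible (2 : R)] [Fintype ι] [DecidableEq ι]
    (X : Matrix ι ι R) (hX : Xᵀ = -X) : (Matrix.toBilin' X).IsAlt := by
  intro v
  have h : Matrix.toBilin' X v v = -Matrix.toBilin' X v v := by
    rw [Matrix.toBilin'_apply']
    nth_rewrite 1 [Matrix.dotProduct_mulVec, ← Matrix.mulVec_transpose, hX, Matrix.neg_mulVec,
      neg_dotProduct, dotProduct_comm]
    rfl
  have h2 : (2 : R) * Matrix.toBilin' X v v = 0 := by linear_combination h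
  exact (isUnit_of_invertible (2 : R)).mul_right_eq_zero.1 h2

theorem gramPfaffian_ιMulti_of_eq {R V : Type*} [CommRing R] [AddCommGroup V] [Module R V]
    {ω : LinearMap.BilinForm R V} (hω : ω.IsAlt) {m n : ℕ} (h : m = 2 * n) (v : Fin m → V) :
    gramPfaffian ω hω (ExteriorAlgebra.ιMulti R m v) =
      pf (Matrix.of fun i j => ω (v i) (v j)) := by
  subst h
  exact gramPfaffian_ιMulti hω n v

/-- Schur complement formula for Pfaffians, with `K` playing the role of `-A B⁻¹`. -/
theorem pf_fromBlocks {R : Type*} [CommRing R] [Invertible (2 : R)] {n n' : ℕ}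
    (S : Matrix (Fin (2 * n)) (Fin (2 * n)) R) (A K : Matrix (Fin (2 * n)) (Fin (2 * n')) R)
    (B : Matrix (Fin (2 * n')) (Fin (2 * n')) R) (hS : Sᵀ = -S) (hB : Bᵀ = -B)
    (hK : K * B = -A) :
    pf (Matrix.reindex finSumFinEquiv finSumFinEquiv (Matrix.fromBlocks S A (-Aᵀ) B)) =
      pf (S - K * Aᵀ) * pf B := by
  set X := Matrix.fromBlocks S A (-Aᵀ) B with hX
  have hω : (Matrix.toBilin' X).IsAlt := toBilin'_isAlt X <| by
    rw [hX, Matrix.fromBlocks_transpose, Matrix.fromBlocks_neg, hS, hB]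
    simp
  set ω := Matrix.toBilin' X with hωdef
  let e : Fin (2 * n) → (Fin (2 * n) ⊕ Fin (2 * n') → R) := fun i => Pi.single (Sum.inl i) 1
  let f : Fin (2 * n') → (Fin (2 * n) ⊕ Fin (2 * n') → R) := fun i => Pi.single (Sum.inr i) 1
  let u : Fin (2 * n) → (Fin (2 * n) ⊕ Fin (2 * n') → R) := fun i => ∑ j, K i j • f j
  have hee : ∀ i j, ω (e i) (e j) = S i j := fun i j => by
    rw [hωdef, Matrix.toBilin'_single, hX, Matrix.fromBlocks_apply₁₁]
  have hef : ∀ i j, ω (e i) (f j) = A i j := fun i j => by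
    rw [hωdef, Matrix.toBilin'_single, hX, Matrix.fromBlocks_apply₁₂]
  have hfe : ∀ i j, ω (f i) (e j) = -A j i := fun i j => by
    rw [hωdef, Matrix.toBilin'_single, hX, Matrix.fromBlocks_apply₂₁, Matrix.neg_apply,
      Matrix.transpose_apply]
  have hff : ∀ i j, ω (f i) (f j) = B i j := fun i j => by
    rw [hωdef, Matrix.toBilin'_single, hX, Matrix.fromBlocks_apply₂₂]
  have hvf : ∀ i j, ω ((e + u) i) (f j) = 0 := fun i j => by
    have h : (K * B) i j = -A i j := by rw [hK, Matrix.neg_apply]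
    rw [Matrix.mul_apply] at h
    simp [u, hef, hff, LinearMap.sum_apply, h]
  have hve : ∀ i j, ω ((e + u) i) (e j) = (S - K * Aᵀ) i j := fun i j => by
    simp [u, hee, hfe, LinearMap.sum_apply, Matrix.mul_apply, sub_eq_add_neg]
  have hvv : ∀ i j, ω ((e + u) i) ((e + u) j) = (S - K * Aᵀ) i j := fun i j => by
    have : ω ((e + u) i) (u j) = 0 := by simp only [u, map_sum, map_smul, hvf, smul_zero,
      Finset.sum_const_zero]
    rw [Pi.add_apply e u j, map_add, hve, this, add_zero]
  have hu : ∀ i, ExteriorAlgebra.ι R (u i) * ExteriorAlgebra.ιMulti R (2 * n') f = 0 := fun i => by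
    simp only [u, map_sum, map_smul, Finset.sum_mul, smul_mul_assoc]
    refine Finset.sum_eq_zero fun j _ => ?_
    rw [ExteriorAlgebra.ιMulti_apply, ExteriorAlgebra.ι_mul_prod_list, smul_zero]
  have hc : ∀ i, CliffordAlgebra.contractLeft (Q := (0 : QuadraticForm R _)) (ω ((e + u) i))
      (ExteriorAlgebra.ιMulti R (2 * n') f) = 0 := fun i => by
    obtain _ | n' := n'
    · exact (congrArg _ (ExteriorAlgebra.ιMulti_zero_apply f)).trans
        (CliffordAlgebra.contractLeft_one _ _)
    · refine (contractLeft_ιMulti _ (2 * n' + 1) f).trans (Finset.sum_eq_zero fun j _ => ?_)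
      rw [hvf, mul_zero, zero_smul]
  have key := gramPfaffian_ιMulti_mul hω _ n (e + u) hc
  rw [ιMulti_add_mul _ _ _ _ hu, ExteriorAlgebra.ιMulti_mul_ιMulti,
    gramPfaffian_ιMulti_of_eq hω (Nat.mul_add 2 n n').symm, gramPfaffian_ιMulti,
    gramPfaffian_ιMulti] at key
  have hvvM : (Matrix.of fun i j => ω ((e + u) i) ((e + u) j)) = S - K * Aᵀ := by
    ext i j
    exact hvv i j
  have hffM : (Matrix.of fun i j => ω (f i) (f j)) = B := by
    ext i j
    exact hff i j
  rw [hvvM, hffM] at key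
  rw [← key]
  congr 1
  ext i j
  have ha : ∀ k, Fin.append e f k = Pi.single (finSumFinEquiv.symm k) 1 := fun k => by
    refine Fin.addCases (fun k => ?_) (fun k => ?_) k <;> simp [e, f]
  rw [Matrix.of_apply, ha, ha, hωdef, Matrix.toBilin'_single]
  rfl

theorem shurB_transpose {R : Type*} [CommRing R] (N : ℕ) (hN : 3 ≤ N) :
    (shurB (R := R) N)ᵀ = -shurB N := by
  ext i j
  simp only [Matrix.transpose_apply, Matrix.neg_apply, shurB]
  grind

/-- The matrix `-A B⁻¹` for `A = shurA N y` and `B = shurB N`. -/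
def negShurAMulInvB {R : Type*} [CommRing R] [Invertible (2 : R)] (N : ℕ) (y : Fin N → R) :
    Matrix (Fin N) (Fin N) R :=
  fun i j => (-1) ^ i.1 * y i * ⅟(2 : R) * if i ≤ j then 1 else -1

theorem negShurAMulInvB_mul_shurB {R : Type*} [CommRing R] [Invertible (2 : R)] (N : ℕ)
    (hN : 3 ≤ N) (y : Fin N → R) : negShurAMulInvB N y * shurB N = -shurA N y := by
  have h2 : ⅟(2 : R) * 2 = 1 := invOf_mul_self _
  have hsum : ∀ (g : Fin N → R) (l : Fin N), ∑ j, g j * shurB N j l =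
      (if h : l.1 = 0 then g ⟨N - 1, by omega⟩ else -g ⟨l.1 - 1, by omega⟩) +
      (if h : l.1 = N - 1 then -g ⟨0, by omega⟩ else g ⟨l.1 + 1, by omega⟩) := by
    intro g l
    rw [Fintype.sum_eq_add (if h : l.1 = 0 then ⟨N - 1, by omega⟩ else ⟨l.1 - 1, by omega⟩)
      (if h : l.1 = N - 1 then ⟨0, by omega⟩ else ⟨l.1 + 1, by omega⟩)]
    · simp only [shurB]
      grind
    · grind
    · intro j hj
      simp only [shurB]
      grind
  ext i l
  rw [Matrix.mul_apply, hsum, Matrix.neg_apply]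
  simp only [negShurAMulInvB, shurA, Fin.le_def]
  have hp := pow_succ (-1 : R) i.1
  have hp0 : i.1 = 0 → (-1 : R) ^ i.1 = 1 := fun h => by rw [h, pow_zero]
  generalize (-1 : R) ^ (i.1 + 1) = q at *
  generalize (-1 : R) ^ i.1 = p at *
  generalize y i = z at *
  generalize ⅟(2 : R) = t at *
  split_ifs <;> first | omega | grind

theorem sub_negShurAMulInvB_mul {R : Type*} [CommRing R] [Invertible (2 : R)] (N : ℕ)
    (hN : 2 ≤ N) (S : Matrix (Fin N) (Fin N) R) (y : Fin N → R) :
    S - negShurAMulInvB N y * (shurA N y)ᵀ = modM N S y := by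
  have h2 : ⅟(2 : R) * 2 = 1 := invOf_mul_self _
  have hsum : ∀ (g : Fin N → R) (j : Fin N), ∑ l, g l * shurA N y j l =
      if h : j.1 = 0 then y j * (g ⟨N - 1, by omega⟩ - g j)
      else (-1) ^ (j.1 + 1) * y j * (g ⟨j.1 - 1, by omega⟩ + g j) := by
    intro g j
    rw [Fintype.sum_eq_add (if h : j.1 = 0 then ⟨N - 1, by omega⟩ else ⟨j.1 - 1, by omega⟩) j]
    · simp only [shurA]
      grind
    · grind
    · intro l hl
      simp only [shurA]
      grind
  ext i j
  rw [Matrix.sub_apply, Matrix.mul_apply]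
  simp only [Matrix.transpose_apply]
  rw [hsum]
  simp only [negShurAMulInvB, modM, Fin.le_def, Fin.lt_def, pow_add]
  have hp0 : j.1 = 0 → (-1 : R) ^ j.1 = 1 := fun h => by rw [h, pow_zero]
  generalize (-1 : R) ^ j.1 = q at *
  generalize (-1 : R) ^ i.1 = p at *
  generalize ⅟(2 : R) = t at *
  split_ifs <;> first | omega | grind

theorem pf_block_of_invertible_two {R : Type*} [CommRing R] [Invertible (2 : R)] (n : ℕ)
    (hn : 2 ≤ n) (y : Fin (2 * n) → R) (S : Matrix (Fin (2 * n)) (Fin (2 * n)) R) (hS : Sᵀ = -S) :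
    pf (Matrix.reindex finSumFinEquiv finSumFinEquiv
        (Matrix.fromBlocks S (shurA (2 * n) y) (-(shurA (2 * n) y)ᵀ) (shurB (2 * n)))) =
      2 * (-1 : R) ^ n * pf (modM (2 * n) S y) := by
  rw [pf_fromBlocks S _ _ _ hS (shurB_transpose _ (by omega))
    (negShurAMulInvB_mul_shurB _ (by omega) y), sub_negShurAMulInvB_mul _ (by omega), pf_shurB n hn,
    mul_comm]

/-- A skew-symmetric matrix over `ℤ[y_i, s_{ij}]` with zero diagonal and independent entries above
it. -/
noncomputable def genericSkew (N : ℕ) :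
    Matrix (Fin N) (Fin N) (MvPolynomial (Fin N ⊕ Fin N × Fin N) ℤ) :=
  fun i j =>
    if i < j then MvPolynomial.X (Sum.inr (i, j))
    else if j < i then -MvPolynomial.X (Sum.inr (j, i)) else 0

theorem genericSkew_transpose (N : ℕ) : (genericSkew N)ᵀ = -genericSkew N := by
  ext1 i j
  rw [Matrix.transpose_apply, Matrix.neg_apply, genericSkew, genericSkew]
  rcases lt_trichotomy i j with h | rfl | h
  · simp [h, h.not_gt]
  · simp
  · simp [h, h.not_gt]

theorem shurA_map {R T : Type*} [CommRing R] [CommRing T] (f : R →+* T) (N : ℕ) (y : Fin N → R) :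
    (shurA N y).map f = shurA N (f ∘ y) := by
  ext i j
  simp only [Matrix.map_apply, shurA, Function.comp_apply]
  split_ifs <;> simp

theorem shurB_map {R T : Type*} [CommRing R] [CommRing T] (f : R →+* T) (N : ℕ) :
    (shurB N).map f = shurB N := by
  ext i j
  simp only [Matrix.map_apply, shurB]
  split_ifs <;> simp

theorem modM_map {R T : Type*} [CommRing R] [CommRing T] (f : R →+* T) (N : ℕ)
    (S : Matrix (Fin N) (Fin N) R) (y : Fin N → R) :
    (modM N S y).map f = modM N (S.map f) (f ∘ y) := by
  ext i j
  simp only [Matrix.map_apply, modM, Function.comp_apply]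
  split_ifs <;> simp

theorem pf_block_map {R T : Type*} [CommRing R] [CommRing T] (f : R →+* T) (N : ℕ)
    (S : Matrix (Fin N) (Fin N) R) (y : Fin N → R) :
    f (pf (Matrix.reindex finSumFinEquiv finSumFinEquiv
        (Matrix.fromBlocks S (shurA N y) (-(shurA N y)ᵀ) (shurB N)))) =
      pf (Matrix.reindex finSumFinEquiv finSumFinEquiv
        (Matrix.fromBlocks (S.map f) (shurA N (f ∘ y)) (-(shurA N (f ∘ y))ᵀ) (shurB N))) := by
  rw [← pf_map, ← shurA_map, ← shurB_map f, Matrix.reindex_apply, Matrix.reindex_apply,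
    ← Matrix.submatrix_map, Matrix.fromBlocks_map]
  congr 3
  ext i j
  simp

theorem pf_block_generic (n : ℕ) (hn : 2 ≤ n) :
    pf (Matrix.reindex finSumFinEquiv finSumFinEquiv
        (Matrix.fromBlocks (genericSkew (2 * n)) (shurA (2 * n) (MvPolynomial.X ∘ Sum.inl))
          (-(shurA (2 * n) (MvPolynomial.X ∘ Sum.inl))ᵀ) (shurB (2 * n)))) =
      2 * (-1) ^ n * pf (modM (2 * n) (genericSkew (2 * n)) (MvPolynomial.X ∘ Sum.inl)) := by
  have hinj := MvPolynomial.map_injective (σ := Fin (2 * n) ⊕ Fin (2 * n) × Fin (2 * n))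
    (Int.castRingHom ℚ) Int.cast_injective
  let _ : Invertible (2 : MvPolynomial (Fin (2 * n) ⊕ Fin (2 * n) × Fin (2 * n)) ℚ) :=
    (Invertible.map (MvPolynomial.C (R := ℚ)) 2).copy _ (map_ofNat _ 2).symm
  apply hinj
  rw [pf_block_map, pf_block_of_invertible_two n hn, map_mul, ← pf_map, modM_map]
  · simp
  · ext1 i j
    simpa using congrArg (MvPolynomial.map (Int.castRingHom ℚ))
      (congrFun (congrFun (genericSkew_transpose (2 * n)) i) j)

/-- **Equation (0) in the proof of Proposition 3.3** (one boundary circuit of even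
monomer parity): for even `N = 2n ≥ 4`, any `y_1, …, y_N ∈ R` and any skew-symmetric
`N × N` matrix `S`, the Pfaffian of the `2N × 2N` block matrix `[[S, A], [-Aᵀ, B]]`
equals `2 ⬝ (-1)^n ⬝ Pf(M)`. -/
theorem pf_block_even_circuit {R : Type*} [CommRing R] (n : ℕ) (hn : 2 ≤ n)
    (y : Fin (2 * n) → R) (S : Matrix (Fin (2 * n)) (Fin (2 * n)) R) (hS : Sᵀ = -S) :
    pf (Matrix.reindex finSumFinEquiv finSumFinEquiv
        (Matrix.fromBlocks S (shurA (2 * n) y) (-(shurA (2 * n) y)ᵀ) (shurB (2 * n)))) =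
      2 * (-1 : R) ^ n * pf (modM (2 * n) S y) := by
  let φ : MvPolynomial (Fin (2 * n) ⊕ Fin (2 * n) × Fin (2 * n)) ℤ →+* R :=
    MvPolynomial.eval₂Hom (Int.castRingHom R) (Sum.elim y fun p => S p.1 p.2)
  have hy : φ ∘ MvPolynomial.X ∘ Sum.inl = y := by
    ext i
    simp [φ]
  have hlt : ∀ i j, i < j → φ (genericSkew (2 * n) i j) = S i j := fun i j hij => by
    simp [φ, genericSkew, hij]
  have h := congrArg φ (pf_block_generic n hn)
  rw [pf_block_map, map_mul, ← pf_map, modM_map, hy] at h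
  have hblock : pf (Matrix.reindex finSumFinEquiv finSumFinEquiv
      (Matrix.fromBlocks S (shurA (2 * n) y) (-(shurA (2 * n) y)ᵀ) (shurB (2 * n)))) =
      pf (Matrix.reindex finSumFinEquiv finSumFinEquiv
        (Matrix.fromBlocks ((genericSkew (2 * n)).map φ) (shurA (2 * n) y)
          (-(shurA (2 * n) y)ᵀ) (shurB (2 * n)))) := by
    refine pf_congr_of_lt fun i j => ?_
    refine Fin.addCases (fun i => ?_) (fun i => ?_) i <;>
      refine Fin.addCases (fun j => ?_) (fun j => ?_) j
    all_goals
      intro hij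
      simp only [Matrix.reindex_apply, Matrix.submatrix_apply, finSumFinEquiv_symm_apply_castAdd,
        finSumFinEquiv_symm_apply_natAdd, Matrix.fromBlocks_apply₁₁, Matrix.fromBlocks_apply₁₂,
        Matrix.fromBlocks_apply₂₁, Matrix.fromBlocks_apply₂₂, Matrix.map_apply]
    exact (hlt i j hij).symm
  have hmod : pf (modM (2 * n) S y) =
      pf (modM (2 * n) ((genericSkew (2 * n)).map φ) y) :=
    pf_congr_of_lt fun i j hij => by rw [modM, modM, Matrix.map_apply, hlt i j hij]
  rw [hblock, hmod, h, map_mul, map_ofNat, map_pow, map_neg, map_one]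
end

section
/- Pfaffian identity for two boundary circuits of odd monomer parity (Equation (1) in the proof of Proposition 3.3, global form): Let N_1 = 2n_1 ≥ 4 and N_2 = 2n_2 ≥ 4 be even, let R be a commutative ring, let y^1_1,…,y^1_{N_1}, y^2_1,…,y^2_{N_2} ∈ R, and let W be an arbitrary skew-symmetric (N_1+N_2)×(N_1+N_2) matrix over R, with indices grouped into a first block of size N_1 (circuit 1) and a second block of size N_2 (circuit 2). For k = 1,2 define the N_k×(N_k+1) matrix A_1^k by a_{1,1} = -y^k_1, a_{1,N_k} = -y^k_1, a_{i,i-1} = a_{i,i} = (-1)^i y^k_i for 2 ≤ i ≤ N_k, last column identically 0, and all other entries 0; and define the skew-symmetric (N_k+1)×(N_k+1) matrix B_1^k by b_{i,i+1} = -1 = -b_{i+1,i} for 1 ≤ i ≤ N_k-1, b_{1,N_k} = 1 = -b_{N_k,1}, b_{i,N_k+1} = (-1)^i = -b_{N_k+1,i} for 1 ≤ i ≤ N_k, and all other entries 0. Let A be the skew-symmetric matrix of size N_1+N_2+(N_1+1)+(N_2+1), with index blocks ordered as circuit 1, inner block 1 (size N_1+1), circuit 2, inner block 2 (size N_2+1),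 whose entries among the circuit indices agree with W, whose block between circuit k and inner block k is A_1^k, whose block within inner block k is B_1^k, and whose entries between an inner block and any index outside its own circuit and inner block are 0. Let M be the skew-symmetric matrix of size N_1+N_2+2, with indices ordered as circuit 1 (positions 1,…,N_1), a virtual index for circuit 1 (position N_1+1), circuit 2 (positions N_1+2,…,N_1+N_2+1), and a virtual index for circuit 2 (position N_1+N_2+2), whose entries among the original indices are those of W plus the correction (-1)^{i+j} y_i y_j for i < j whenever positions i and j both lie in the same circuit (where y_i denotes the weight of the circuit vertex at position i), whose entry m_{i,v_k} for position i in circuit k and v_k the virtual index of circuit k equals (-1)^{i+v_k} y_i (i.e. the virtual index has weight 1 and belongs to circuit k), and all of whose other entries involving a virtual index are 0. Then Pf(A) = (-1)^{n_1+n_2} N_1 N_2 Pf(M). -/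
open Matrix

/-- The `N × (N+1)` blade-edge matrix `A_1` (odd type, 1-based description):
`a_{1,1} = -y_1`, `a_{1,N} = -y_1`, `a_{i,i-1} = a_{i,i} = (-1)^i y_i` for `2 ≤ i ≤ N`,
last column identically `0`, all other entries `0`. -/
def shurA1 {R : Type*} [CommRing R] (N : ℕ) (y : Fin N → R) :
    Matrix (Fin N) (Fin (N + 1)) R := fun i j =>
  if i.1 = 0 then (if j.1 = 0 then -y i else if j.1 = N - 1 then -y i else 0)
  else if j.1 + 1 = i.1 ∨ j.1 = i.1 then (-1 : R) ^ (i.1 + 1) * y i else 0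

/-- The `(N+1) × (N+1)` inner matrix `B_1` (odd type, 1-based description):
`b_{i,i+1} = -1 = -b_{i+1,i}` for `1 ≤ i ≤ N-1`, `b_{1,N} = 1 = -b_{N,1}`,
`b_{i,N+1} = (-1)^i = -b_{N+1,i}` for `1 ≤ i ≤ N`, all other entries `0`. -/
def shurB1 {R : Type*} [CommRing R] (N : ℕ) : Matrix (Fin (N + 1)) (Fin (N + 1)) R :=
  fun i j =>
    if i.1 + 1 = j.1 ∧ j.1 ≤ N - 1 then -1
    else if j.1 + 1 = i.1 ∧ i.1 ≤ N - 1 then 1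
    else if i.1 = 0 ∧ j.1 = N - 1 then 1
    else if j.1 = 0 ∧ i.1 = N - 1 then -1
    else if j.1 = N ∧ i.1 ≤ N - 1 then (-1 : R) ^ (i.1 + 1)
    else if i.1 = N ∧ j.1 ≤ N - 1 then -(-1 : R) ^ (j.1 + 1)
    else 0

/-- The big matrix `A`, with index blocks ordered as circuit 1 (size `N1`), inner
block 1 (size `N1+1`), circuit 2 (size `N2`), inner block 2 (size `N2+1`): among circuit
indices it agrees with `W`, the block between circuit `k` and inner block `k` is
`A_1^k` (and its negative transpose), the block within inner block `k` is `B_1^k`, and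
all entries between an inner block and indices outside its own circuit/inner block
are `0`. -/
def bigA {R : Type*} [CommRing R] (N1 N2 : ℕ)
    (W : Matrix (Fin (N1 + N2)) (Fin (N1 + N2)) R) (y1 : Fin N1 → R) (y2 : Fin N2 → R) :
    Matrix (Fin N1 ⊕ (Fin (N1 + 1) ⊕ (Fin N2 ⊕ Fin (N2 + 1))))
           (Fin N1 ⊕ (Fin (N1 + 1) ⊕ (Fin N2 ⊕ Fin (N2 + 1)))) R := fun p q =>
  match p, q with
  | Sum.inl i, Sum.inl j => W (Fin.castAdd N2 i) (Fin.castAdd N2 j)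
  | Sum.inl i, Sum.inr (Sum.inl j) => shurA1 N1 y1 i j
  | Sum.inl i, Sum.inr (Sum.inr (Sum.inl j)) => W (Fin.castAdd N2 i) (Fin.natAdd N1 j)
  | Sum.inl _, Sum.inr (Sum.inr (Sum.inr _)) => 0
  | Sum.inr (Sum.inl i), Sum.inl j => -shurA1 N1 y1 j i
  | Sum.inr (Sum.inl i), Sum.inr (Sum.inl j) => shurB1 N1 i j
  | Sum.inr (Sum.inl _), Sum.inr (Sum.inr _) => 0
  | Sum.inr (Sum.inr (Sum.inl i)), Sum.inl j => W (Fin.natAdd N1 i) (Fin.castAdd N2 j)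
  | Sum.inr (Sum.inr (Sum.inl _)), Sum.inr (Sum.inl _) => 0
  | Sum.inr (Sum.inr (Sum.inl i)), Sum.inr (Sum.inr (Sum.inl j)) =>
      W (Fin.natAdd N1 i) (Fin.natAdd N1 j)
  | Sum.inr (Sum.inr (Sum.inl i)), Sum.inr (Sum.inr (Sum.inr j)) => shurA1 N2 y2 i j
  | Sum.inr (Sum.inr (Sum.inr _)), Sum.inl _ => 0
  | Sum.inr (Sum.inr (Sum.inr _)), Sum.inr (Sum.inl _) => 0
  | Sum.inr (Sum.inr (Sum.inr i)), Sum.inr (Sum.inr (Sum.inl j)) => -shurA1 N2 y2 j i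
  | Sum.inr (Sum.inr (Sum.inr i)), Sum.inr (Sum.inr (Sum.inr j)) => shurB1 N2 i j

/-- The weight of the index `i` of a circuit block of size `N+1`: the vertex weight
`y_i` for the circuit vertices (positions `< N`) and `1` for the virtual vertex
(last position). -/
def vWeight {R : Type*} [CommRing R] (N : ℕ) (y : Fin N → R) (i : Fin (N + 1)) : R :=
  if h : i.1 < N then y ⟨i.1, h⟩ else 1

/-- The skew-symmetric correction term within one circuit block (of size `N+1`,
the last index being the virtual vertex): `(-1)^{i+j} y_i y_j` for `i < j`
(positions within the block; the parity of the sum of positions is intrinsic). -/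
def corr {R : Type*} [CommRing R] (N : ℕ) (y : Fin N → R) (i j : Fin (N + 1)) : R :=
  if i.1 < j.1 then (-1 : R) ^ (i.1 + j.1) * vWeight N y i * vWeight N y j
  else if j.1 < i.1 then -((-1 : R) ^ (i.1 + j.1) * vWeight N y i * vWeight N y j)
  else 0

/-- The modified matrix `M`, with indices ordered as circuit 1, virtual index 1,
circuit 2, virtual index 2: among the original circuit indices it is `W` plus the
same-circuit correction `(-1)^{i+j} y_i y_j` (for `i < j`, extended skew-symmetrically);
the entries between a circuit vertex and the virtual vertex of the same circuit are the
corresponding corrections (the virtual vertex having weight `1`); and all other entries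
involving a virtual index are `0`. -/
def bigM {R : Type*} [CommRing R] (N1 N2 : ℕ)
    (W : Matrix (Fin (N1 + N2)) (Fin (N1 + N2)) R) (y1 : Fin N1 → R) (y2 : Fin N2 → R) :
    Matrix (Fin (N1 + 1) ⊕ Fin (N2 + 1)) (Fin (N1 + 1) ⊕ Fin (N2 + 1)) R := fun p q =>
  match p, q with
  | Sum.inl i, Sum.inl j =>
      (if hi : i.1 < N1 then if hj : j.1 < N1 then
          W (Fin.castAdd N2 ⟨i.1, hi⟩) (Fin.castAdd N2 ⟨j.1, hj⟩) else 0 else 0)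
        + corr N1 y1 i j
  | Sum.inl i, Sum.inr j =>
      if hi : i.1 < N1 then if hj : j.1 < N2 then
        W (Fin.castAdd N2 ⟨i.1, hi⟩) (Fin.natAdd N1 ⟨j.1, hj⟩) else 0 else 0
  | Sum.inr i, Sum.inl j =>
      if hi : i.1 < N2 then if hj : j.1 < N1 then
        W (Fin.natAdd N1 ⟨i.1, hi⟩) (Fin.castAdd N2 ⟨j.1, hj⟩) else 0 else 0
  | Sum.inr i, Sum.inr j =>
      (if hi : i.1 < N2 then if hj : j.1 < N2 then
          W (Fin.natAdd N1 ⟨i.1, hi⟩) (Fin.natAdd N1 ⟨j.1, hj⟩) else 0 else 0)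
        + corr N2 y2 i j

namespace Pfaffian

variable {R : Type*} [CommRing R] {h : ℕ}

/-- The enumeration of `Fin (2 * h)` by `h` consecutive pairs `(2 * k, 2 * k + 1)`. -/
def pairEquiv (h : ℕ) : Fin h × Fin 2 ≃ Fin (2 * h) :=
  finProdFinEquiv.trans (finCongr (Nat.mul_comm h 2))

@[simp]
lemma pairEquiv_val (p : Fin h × Fin 2) : (pairEquiv h p).1 = p.2.1 + 2 * p.1.1 := rfl

/-- `σ` is the canonical representative of a partition into pairs. -/
def IsCanonical (σ : Equiv.Perm (Fin (2 * h))) : Prop :=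
  (∀ k, σ (pairEquiv h (k, 0)) < σ (pairEquiv h (k, 1))) ∧
    ∀ k l, k < l → σ (pairEquiv h (k, 0)) < σ (pairEquiv h (l, 0))

/-- The summand of the Pfaffian attached to a permutation. -/
def term (A : Matrix (Fin (2 * h)) (Fin (2 * h)) R) (σ : Equiv.Perm (Fin (2 * h))) : R :=
  ((Equiv.Perm.sign σ : ℤ) : R) *
    ∏ k, A (σ (pairEquiv h (k, 0))) (σ (pairEquiv h (k, 1)))

open Classical in
lemma pf_eq_sum_term (A : Matrix (Fin (2 * h)) (Fin (2 * h)) R) :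
    pf A = ∑ σ with IsCanonical σ, term A σ := by
  have key : ∀ c (hc : c = 2 * h / 2),
      pf A = ∑ σ ∈ Finset.univ.filter (fun σ : Equiv.Perm (Fin (2 * h)) =>
      (∀ k : Fin c, σ ⟨2 * k.1, by have := k.2; omega⟩ < σ ⟨2 * k.1 + 1, by have := k.2; omega⟩) ∧
      (∀ k l : Fin c, k < l →
        σ ⟨2 * k.1, by have := k.2; omega⟩ < σ ⟨2 * l.1, by have := l.2; omega⟩)),
    (Equiv.Perm.sign σ : ℤ) • ∏ k : Fin c,
      A (σ ⟨2 * k.1, by have := k.2; omega⟩) (σ ⟨2 * k.1 + 1, by have := k.2; omega⟩) := by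
    rintro c rfl
    rfl
  have e0 : ∀ k : Fin h, pairEquiv h (k, 0) = ⟨2 * k.1, by omega⟩ := fun k => by
    ext; simp
  have e1 : ∀ k : Fin h, pairEquiv h (k, 1) = ⟨2 * k.1 + 1, by omega⟩ := fun k => by
    ext; simp [add_comm]
  rw [key h (by omega)]
  simp only [IsCanonical, term, e0, e1, zsmul_eq_mul]

/-- The sum of the Pfaffian summands over all permutations. -/
def fullSum (A : Matrix (Fin (2 * h)) (Fin (2 * h)) R) : R := ∑ σ, term A σ

/-- The permutation of `Fin (2 * h)` which permutes the pairs by `π` and the two elements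
of each pair by `ε`. -/
def pairPerm (g : Equiv.Perm (Fin h) × (Fin h → Equiv.Perm (Fin 2))) :
    Equiv.Perm (Fin (2 * h)) :=
  (pairEquiv h).permCongr
    (Equiv.prodCongrRight g.2 * Equiv.prodCongrLeft fun _ => g.1)

lemma pairPerm_apply (g : Equiv.Perm (Fin h) × (Fin h → Equiv.Perm (Fin 2)))
    (k : Fin h) (e : Fin 2) :
    pairPerm g (pairEquiv h (k, e)) = pairEquiv h (g.1 k, g.2 (g.1 k) e) := by
  simp [pairPerm, Equiv.permCongr_apply]

lemma sign_pairPerm (g : Equiv.Perm (Fin h) × (Fin h → Equiv.Perm (Fin 2))) :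
    Equiv.Perm.sign (pairPerm g) = ∏ k, Equiv.Perm.sign (g.2 k) := by
  rw [pairPerm, Equiv.Perm.sign_permCongr, map_mul, Equiv.Perm.sign_prodCongrRight,
    Equiv.Perm.sign_prodCongrLeft]
  simp

/-- A matrix which is skew-symmetric with zero diagonal. -/
def IsAlt {ι : Type*} (A : Matrix ι ι R) : Prop := (∀ i j, A j i = -A i j) ∧ ∀ i, A i i = 0

lemma IsAlt.apply_perm {A : Matrix (Fin (2 * h)) (Fin (2 * h)) R} (hA : IsAlt A)
    (f : Fin 2 → Fin (2 * h)) (ε : Equiv.Perm (Fin 2)) :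
    A (f (ε 0)) (f (ε 1)) = ((Equiv.Perm.sign ε : ℤ) : R) * A (f 0) (f 1) := by
  have : ε = 1 ∨ ε = Equiv.swap 0 1 := by revert ε; decide
  rcases this with rfl | rfl
  · simp
  · simp [hA.1 (f 0) (f 1)]

lemma term_mul_pairPerm {A : Matrix (Fin (2 * h)) (Fin (2 * h)) R} (hA : IsAlt A)
    (σ : Equiv.Perm (Fin (2 * h))) (g : Equiv.Perm (Fin h) × (Fin h → Equiv.Perm (Fin 2))) :
    term A (σ * pairPerm g) = term A σ := by
  have hs : ∀ u : ℤˣ, ((u : ℤ) : R) * ((u : ℤ) : R) = 1 := fun u => by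
    rcases Int.units_eq_one_or u with rfl | rfl <;> simp
  simp only [term, Equiv.Perm.mul_apply, pairPerm_apply, map_mul, sign_pairPerm]
  rw [Equiv.prod_comp g.1 (fun k => A (σ (pairEquiv h (k, g.2 k 0)))
    (σ (pairEquiv h (k, g.2 k 1))))]
  simp only [fun k => hA.apply_perm (fun e => σ (pairEquiv h (k, e))) (g.2 k),
    Finset.prod_mul_distrib]
  have := hs (∏ k, Equiv.Perm.sign (g.2 k))
  push_cast at this ⊢
  linear_combination ((Equiv.Perm.sign σ : ℤ) : R) *
    (∏ k, A (σ (pairEquiv h (k, 0))) (σ (pairEquiv h (k, 1)))) * this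

lemma existsUnique_strictMono_comp {n : ℕ} {α : Type*} [LinearOrder α] {f : Fin n → α}
    (hf : Function.Injective f) : ∃! π : Equiv.Perm (Fin n), StrictMono (f ∘ π) := by
  refine ⟨Tuple.sort f,
    (Tuple.monotone_sort f).strictMono_of_injective (hf.comp (Tuple.sort f).injective), ?_⟩
  intro π hπ
  have := Tuple.unique_monotone hπ.monotone (Tuple.monotone_sort f)
  ext1 i
  exact hf (congrFun this i)

lemma existsUnique_isCanonical_mul (σ : Equiv.Perm (Fin (2 * h))) :
    ∃! g : Equiv.Perm (Fin h) × (Fin h → Equiv.Perm (Fin 2)),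
      IsCanonical (σ * pairPerm g) := by
  have two : ∀ f : Fin 2 → Fin (2 * h), StrictMono f ↔ f 0 < f 1 := fun f => by
    simp [Fin.strictMono_iff_lt_succ]
  have inj : ∀ k, Function.Injective fun e : Fin 2 => σ (pairEquiv h (k, e)) := fun k e e' hh => by
    simpa using hh
  choose ε hε hε' using fun k => existsUnique_strictMono_comp (inj k)
  have inj' : Function.Injective fun k => σ (pairEquiv h (k, ε k 0)) := fun k k' hh => by
    have := (pairEquiv h).injective (σ.injective hh)
    exact congrArg Prod.fst this
  obtain ⟨π, hπ, hπ'⟩ := existsUnique_strictMono_comp inj'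
  refine ⟨(π, ε), ?_, ?_⟩
  · simp only [IsCanonical, Equiv.Perm.mul_apply, pairPerm_apply]
    exact ⟨fun k => (two _).1 (hε (π k)), fun k l hkl => hπ hkl⟩
  · rintro ⟨π₁, ε₁⟩ ⟨h1, h2⟩
    simp only [Equiv.Perm.mul_apply, pairPerm_apply] at h1 h2
    have hh : ε₁ = ε := by
      funext k
      refine hε' k _ ((two _).2 ?_)
      simpa using h1 (π₁.symm k)
    subst hh
    rw [hπ' π₁ fun k l hkl => h2 k l hkl]

lemma card_mul_pf_eq_fullSum {A : Matrix (Fin (2 * h)) (Fin (2 * h)) R} (hA : IsAlt A) :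
    (Fintype.card (Equiv.Perm (Fin h) × (Fin h → Equiv.Perm (Fin 2))) : R) * pf A =
      fullSum A := by
  classical
  have h1 : ∀ σ : Equiv.Perm (Fin (2 * h)),
      term A σ = ∑ g, if IsCanonical (σ * pairPerm g) then term A (σ * pairPerm g) else 0 := by
    intro σ
    obtain ⟨g, hg, hg'⟩ := existsUnique_isCanonical_mul σ
    rw [Finset.sum_eq_single g, if_pos hg, term_mul_pairPerm hA]
    · intro b _ hb
      rw [if_neg fun hc => hb (hg' b hc)]
    · simp
  rw [fullSum, Finset.sum_congr rfl fun σ _ => h1 σ, Finset.sum_comm]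
  have h2 : ∀ g, ∑ σ, (if IsCanonical (σ * pairPerm g) then term A (σ * pairPerm g) else 0)
      = pf A := by
    intro g
    rw [pf_eq_sum_term, Finset.sum_filter]
    exact Equiv.sum_comp (Equiv.mulRight (pairPerm g))
      fun σ => if IsCanonical σ then term A σ else 0
  simp [h2]

lemma fullSum_congr_mul (A P : Matrix (Fin (2 * h)) (Fin (2 * h)) R) :
    fullSum (P * A * Pᵀ) = P.det * fullSum A := by
  classical
  have h1 : ∀ σ : Equiv.Perm (Fin (2 * h)), term (P * A * Pᵀ) σ =
      ∑ f : Fin (2 * h) → Fin (2 * h),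
        (∏ k, A (f (pairEquiv h (k, 0))) (f (pairEquiv h (k, 1)))) *
          (((Equiv.Perm.sign σ : ℤ) : R) * ∏ i, P (σ i) (f i)) := by
    intro σ
    have e1 : ∀ i j, (P * A * Pᵀ) i j = ∑ p : Fin 2 → Fin (2 * h),
        P i (p 0) * P j (p 1) * A (p 0) (p 1) := by
      intro i j
      rw [← (finTwoArrowEquiv _).symm.sum_comp, Fintype.sum_prod_type]
      simp only [Matrix.mul_apply, Matrix.transpose_apply, Finset.sum_mul, finTwoArrowEquiv]
      rw [Finset.sum_comm]
      refine Finset.sum_congr rfl fun a _ => Finset.sum_congr rfl fun b _ => ?_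
      simp
      ring
    simp only [term, e1, Finset.prod_univ_sum, Fintype.piFinset_univ, Finset.mul_sum]
    let E : (Fin h → Fin 2 → Fin (2 * h)) ≃ (Fin (2 * h) → Fin (2 * h)) :=
      (Equiv.curry _ _ _).symm.trans ((pairEquiv h).arrowCongr (Equiv.refl _))
    refine Fintype.sum_equiv E _ _ fun p => ?_
    have hE : ∀ k e, E p (pairEquiv h (k, e)) = p k e := by
      intro k e
      simp [E]
    rw [← Equiv.prod_comp (pairEquiv h) fun i => P (σ i) (E p i), Fintype.prod_prod_type]
    simp only [hE, Fin.prod_univ_two, Finset.prod_mul_distrib]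
    ring
  have h2 : ∀ f : Fin (2 * h) → Fin (2 * h),
      ∑ σ : Equiv.Perm (Fin (2 * h)), ((Equiv.Perm.sign σ : ℤ) : R) * ∏ i, P (σ i) (f i) =
        (P.submatrix id f).det := by
    intro f
    rw [Matrix.det_apply']
    rfl
  simp only [fullSum, h1]
  rw [Finset.sum_comm]
  simp only [← Finset.mul_sum, h2]
  rw [Finset.mul_sum]
  symm
  refine Finset.sum_of_injOn (fun σ : Equiv.Perm (Fin (2 * h)) => (σ : Fin (2 * h) → Fin (2 * h)))
    (fun σ _ τ _ hst => Equiv.coe_fn_injective hst) (fun _ _ => Finset.mem_coe.2 (Finset.mem_univ _))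
    ?_ ?_
  · intro f _ hf
    have : ¬ Function.Injective f := fun hi => hf
      ⟨Equiv.ofBijective f (Finite.injective_iff_bijective.1 hi), by simp, rfl⟩
    rw [Function.Injective] at this
    push Not at this
    obtain ⟨a, b, hab, hne⟩ := this
    rw [Matrix.det_zero_of_column_eq hne (fun k => by simp [hab]), mul_zero]
  · intro σ _
    rw [Matrix.det_permute', term]
    ring

lemma map_pf {S : Type*} [CommRing S] (φ : R →+* S) {m : ℕ} (A : Matrix (Fin m) (Fin m) R) :
    φ (pf A) = pf (A.map φ) := by
  simp [pf]

lemma pf_congr_mul_of_domain {S : Type*} [CommRing S] [IsDomain S] [CharZero S]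
    {A : Matrix (Fin (2 * h)) (Fin (2 * h)) S} (hA : IsAlt A)
    (P : Matrix (Fin (2 * h)) (Fin (2 * h)) S) : pf (P * A * Pᵀ) = P.det * pf A := by
  have hPA : IsAlt (P * A * Pᵀ) := by
    have hT : Aᵀ = -A := by ext i j; exact hA.1 i j
    have hT' : (P * A * Pᵀ)ᵀ = -(P * A * Pᵀ) := by
      simp [Matrix.transpose_mul, hT, Matrix.mul_assoc]
    refine ⟨fun i j => congrFun (congrFun hT' i) j, fun i => ?_⟩
    have := congrFun (congrFun hT' i) i
    simp only [Matrix.transpose_apply, Matrix.neg_apply] at this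
    exact self_eq_neg.1 this
  have h0 : (Fintype.card (Equiv.Perm (Fin h) × (Fin h → Equiv.Perm (Fin 2))) : S) ≠ 0 :=
    Nat.cast_ne_zero.2 Fintype.card_ne_zero
  refine mul_left_cancel₀ h0 ?_
  rw [card_mul_pf_eq_fullSum hPA, fullSum_congr_mul, ← card_mul_pf_eq_fullSum hA]
  ring

/-- The Pfaffian of a congruent matrix. -/
lemma pf_congr_mul {A : Matrix (Fin (2 * h)) (Fin (2 * h)) R} (hA : IsAlt A)
    (P : Matrix (Fin (2 * h)) (Fin (2 * h)) R) : pf (P * A * Pᵀ) = P.det * pf A := by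
  let I := Fin (2 * h) × Fin (2 * h)
  let G : Matrix (Fin (2 * h)) (Fin (2 * h)) (MvPolynomial (I ⊕ I) ℤ) := Matrix.of fun i j =>
    if i < j then MvPolynomial.X (Sum.inl (i, j))
    else if j < i then -MvPolynomial.X (Sum.inl (j, i)) else 0
  let Q : Matrix (Fin (2 * h)) (Fin (2 * h)) (MvPolynomial (I ⊕ I) ℤ) := Matrix.of fun i j =>
    MvPolynomial.X (Sum.inr (i, j))
  let φ : MvPolynomial (I ⊕ I) ℤ →+* R := MvPolynomial.eval₂Hom (Int.castRingHom R)
    (Sum.elim (fun p => A p.1 p.2) fun p => P p.1 p.2)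
  have hG : IsAlt G := by
    refine ⟨fun i j => ?_, fun i => by simp [G]⟩
    rcases lt_trichotomy i j with hij | rfl | hij
    · simp [G, hij, hij.not_gt]
    · simp [G]
    · simp [G, hij, hij.not_gt]
  have hQ : Q.map φ = P := by
    ext i j
    simp [Q, φ]
  have hGA : G.map φ = A := by
    ext i j
    rcases lt_trichotomy i j with hij | rfl | hij
    · simp [G, φ, hij]
    · simp [G, hA.2]
    · simp [G, φ, hij, hij.not_gt, hA.1 j i]
  have := congrArg φ (pf_congr_mul_of_domain hG Q)
  rw [map_pf, map_mul, map_pf, Matrix.map_mul, Matrix.map_mul, hGA, Matrix.transpose_map, hQ,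
    RingHom.map_det, RingHom.mapMatrix_apply, hQ] at this
  exact this

/-- The extension of a permutation of `Fin (2 * h)` by the identity on the last pair. -/
def extendPerm (τ : Equiv.Perm (Fin (2 * h))) : Equiv.Perm (Fin (2 * (h + 1))) :=
  (finSumFinEquiv (m := 2 * h) (n := 2)).permCongr (Equiv.Perm.sumCongr τ 1)

lemma sign_extendPerm (τ : Equiv.Perm (Fin (2 * h))) :
    Equiv.Perm.sign (extendPerm τ) = Equiv.Perm.sign τ := by
  rw [extendPerm, Equiv.Perm.sign_permCongr, Equiv.Perm.sign_sumCongr]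
  simp

lemma extendPerm_castSucc (τ : Equiv.Perm (Fin (2 * h))) (k : Fin h) (e : Fin 2) :
    (extendPerm τ (pairEquiv (h + 1) (k.castSucc, e)) : Fin (2 * h + 2)) =
      Fin.castAdd 2 (τ (pairEquiv h (k, e))) := by
  have : pairEquiv (h + 1) (k.castSucc, e) =
      finSumFinEquiv (m := 2 * h) (n := 2) (Sum.inl (pairEquiv h (k, e))) := by
    ext; simp
  rw [this, extendPerm, Equiv.permCongr_apply, Equiv.symm_apply_apply]
  rfl

lemma extendPerm_last (τ : Equiv.Perm (Fin (2 * h))) (e : Fin 2) :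
    extendPerm τ (pairEquiv (h + 1) (Fin.last h, e)) = pairEquiv (h + 1) (Fin.last h, e) := by
  have : pairEquiv (h + 1) (Fin.last h, e) =
      finSumFinEquiv (m := 2 * h) (n := 2) (Sum.inr e) := by
    ext; simp [add_comm]
  rw [this, extendPerm, Equiv.permCongr_apply, Equiv.symm_apply_apply]
  rfl

lemma extendPerm_injective : Function.Injective (extendPerm (h := h)) := by
  intro σ τ hst
  have := (finSumFinEquiv (m := 2 * h) (n := 2)).permCongr.injective hst
  ext1 i
  simpa using congrArg (fun f => f (Sum.inl i)) this

lemma exists_extendPerm {σ : Equiv.Perm (Fin (2 * (h + 1)))}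
    (hσ : ∀ e, σ (pairEquiv (h + 1) (Fin.last h, e)) = pairEquiv (h + 1) (Fin.last h, e)) :
    ∃ τ, extendPerm τ = σ := by
  set E := finSumFinEquiv (m := 2 * h) (n := 2)
  have hE : ∀ e, pairEquiv (h + 1) (Fin.last h, e) = E (Sum.inr e) := fun e => by
    ext; simp [E, add_comm]
  simp only [hE] at hσ
  have hmem : E.symm.permCongr σ ∈ (Equiv.Perm.sumCongrHom (Fin (2 * h)) (Fin 2)).range := by
    apply Equiv.Perm.mem_sumCongrHom_range_of_perm_mapsTo_inl
    rintro _ ⟨i, rfl⟩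
    rcases hx : E.symm.permCongr σ (Sum.inl i) with a | b
    · exact ⟨a, rfl⟩
    · exfalso
      simp only [Equiv.permCongr_apply, Equiv.symm_symm] at hx
      rw [Equiv.symm_apply_eq, ← hσ b] at hx
      simp at hx
  obtain ⟨⟨τ, ρ⟩, hτ⟩ := hmem
  have hρ : ρ = 1 := by
    ext1 e
    have := congrArg (fun f => f (Sum.inr e)) hτ
    simpa [hσ] using this
  subst hρ
  refine ⟨τ, ?_⟩
  have : E.permCongr (E.symm.permCongr σ) = σ := by ext; simp
  rw [← this, ← hτ]
  rfl

lemma isCanonical_extendPerm {τ : Equiv.Perm (Fin (2 * h))} :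
    IsCanonical (extendPerm τ) ↔ IsCanonical τ := by
  have h1 : ∀ (k : Fin h) (e : Fin 2),
      (extendPerm τ (pairEquiv (h + 1) (k.castSucc, e))).1 = (τ (pairEquiv h (k, e))).1 :=
    fun k e => congrArg Fin.val (extendPerm_castSucc τ k e)
  have h2 : ∀ e : Fin 2,
      (extendPerm τ (pairEquiv (h + 1) (Fin.last h, e))).1 = e.1 + 2 * h := fun e => by
    rw [extendPerm_last]; simp
  simp only [IsCanonical, Fin.forall_fin_succ', Fin.lt_def, h1, h2]
  constructor
  · rintro ⟨⟨ha, -⟩, hb, -⟩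
    exact ⟨ha, fun k l hkl => (hb k).1 l hkl⟩
  · rintro ⟨ha, hb⟩
    refine ⟨⟨ha, by simp⟩, fun k => ⟨fun l hkl => hb k l hkl, fun _ => ?_⟩, fun k hk => ?_, ?_⟩
    · simp
    · simp at hk
      omega
    · simp

lemma IsCanonical.fixes_last_pair {σ : Equiv.Perm (Fin (2 * (h + 1)))} (hσ : IsCanonical σ)
    {k : Fin (h + 1)} (hk : ∀ e, σ (pairEquiv (h + 1) (k, e)) = pairEquiv (h + 1) (Fin.last h, e)) :
    ∀ e, σ (pairEquiv (h + 1) (Fin.last h, e)) = pairEquiv (h + 1) (Fin.last h, e) := by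
  rcases (Fin.le_last k).eq_or_lt with rfl | hlt
  · exact hk
  · exfalso
    have h1 := hσ.2 k _ hlt
    have h2 := hσ.1 (Fin.last h)
    rw [hk 0] at h1
    simp only [Fin.lt_def, pairEquiv_val, Fin.val_last] at h1 h2
    have := (σ (pairEquiv (h + 1) (Fin.last h, 1))).2
    simp at h1
    omega

/-- If one of the last two indices is only matched with the other one, the last pair splits off
from the Pfaffian. -/
lemma pf_split_last_pair (A : Matrix (Fin (2 * (h + 1))) (Fin (2 * (h + 1))) R)
    (hA : ∃ e, ∀ i j, i < j → (i = pairEquiv (h + 1) (Fin.last h, e) ∨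
      j = pairEquiv (h + 1) (Fin.last h, e)) → i ≠ pairEquiv (h + 1) (Fin.last h, 0) →
      A i j = 0) :
    pf A = A (pairEquiv (h + 1) (Fin.last h, 0)) (pairEquiv (h + 1) (Fin.last h, 1)) *
      pf (A.submatrix (Fin.castAdd 2 : Fin (2 * h) → _) (Fin.castAdd 2 : Fin (2 * h) → _)) := by
  classical
  rw [pf_eq_sum_term, pf_eq_sum_term, Finset.mul_sum]
  symm
  refine Finset.sum_of_injOn extendPerm extendPerm_injective.injOn ?_ ?_ ?_
  · intro τ hτ
    simpa [isCanonical_extendPerm] using hτ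
  · intro σ hσ hne
    have hc : IsCanonical σ := by simpa using hσ
    obtain ⟨e, he⟩ := hA
    have hfix : ¬ ∀ e, σ (pairEquiv (h + 1) (Fin.last h, e)) = pairEquiv (h + 1) (Fin.last h, e) := by
      intro hf
      obtain ⟨τ, rfl⟩ := exists_extendPerm hf
      exact hne ⟨τ, by simpa [isCanonical_extendPerm] using hc, rfl⟩
    obtain ⟨⟨k, e'⟩, hk⟩ := ((pairEquiv (h + 1)).trans σ).surjective
      (pairEquiv (h + 1) (Fin.last h, e))
    simp only [Equiv.trans_apply] at hk
    rw [term, Finset.prod_eq_zero (Finset.mem_univ k), mul_zero]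
    have hlt := hc.1 k
    refine he _ _ hlt ?_ fun h0 => hfix (hc.fixes_last_pair (k := k) ?_)
    · revert hk; fin_cases e'
      · exact fun hk => Or.inl hk
      · exact fun hk => Or.inr hk
    · rw [Fin.forall_fin_two]
      refine ⟨h0, ?_⟩
      rw [h0] at hlt
      ext
      have h3 := (σ (pairEquiv (h + 1) (k, 1))).2
      simp only [Fin.lt_def, pairEquiv_val, Fin.val_last] at hlt ⊢
      simp at hlt ⊢
      omega
  · intro τ _
    rw [term, term, sign_extendPerm, Fin.prod_univ_castSucc, extendPerm_last, extendPerm_last]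
    have : ∀ k : Fin h, A (extendPerm τ (pairEquiv (h + 1) (k.castSucc, 0)))
        (extendPerm τ (pairEquiv (h + 1) (k.castSucc, 1))) =
        A (Fin.castAdd 2 (τ (pairEquiv h (k, 0)))) (Fin.castAdd 2 (τ (pairEquiv h (k, 1)))) :=
      fun k => congrArg₂ A (extendPerm_castSucc τ k 0) (extendPerm_castSucc τ k 1)
    simp only [this, Matrix.submatrix_apply]
    ring

/-- The Pfaffian of the `m × m` upper left corner of an infinite matrix. -/
def natPf (m : ℕ) (A : ℕ → ℕ → R) : R := pf (Matrix.of fun i j : Fin m => A i j)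

/-- The skew-symmetric matrix with the same entries as `A` above the diagonal. -/
def skew (A : ℕ → ℕ → R) (i j : ℕ) : R := if i < j then A i j else if j < i then -A j i else 0

lemma skew_of_lt {A : ℕ → ℕ → R} {i j : ℕ} (hij : i < j) : skew A i j = A i j := if_pos hij

lemma skew_of_gt {A : ℕ → ℕ → R} {i j : ℕ} (hij : j < i) : skew A i j = -A j i := by
  rw [skew, if_neg hij.not_gt, if_pos hij]

lemma skew_self {A : ℕ → ℕ → R} (i : ℕ) : skew A i i = 0 := by simp [skew]

lemma skew_swap {A : ℕ → ℕ → R} (i j : ℕ) : skew A j i = -skew A i j := by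
  rcases lt_trichotomy i j with hij | rfl | hij
  · rw [skew_of_gt hij, skew_of_lt hij]
  · simp [skew_self]
  · rw [skew_of_gt hij, skew_of_lt hij, neg_neg]

lemma natPf_congr {m : ℕ} (hm : Even m) {A B : ℕ → ℕ → R}
    (hAB : ∀ i j, i < j → j < m → A i j = B i j) : natPf m A = natPf m B := by
  obtain ⟨h, rfl⟩ := even_iff_two_dvd.1 hm
  classical
  rw [natPf, natPf, pf_eq_sum_term, pf_eq_sum_term]
  refine Finset.sum_congr rfl fun σ hσ => ?_
  have hc : IsCanonical σ := by simpa using hσ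
  rw [term, term]
  congr 1
  exact Finset.prod_congr rfl fun k _ => hAB _ _ (hc.1 k) (Fin.is_lt _)

lemma natPf_split {m : ℕ} (hm : Even m) {A : ℕ → ℕ → R}
    (hA : (∀ i < m, A i m = 0) ∨ ∀ i < m, A i (m + 1) = 0) :
    natPf (m + 2) A = A m (m + 1) * natPf m A := by
  obtain ⟨h, rfl⟩ := even_iff_two_dvd.1 hm
  have h0 : ((pairEquiv (h + 1) (Fin.last h, 0) : Fin (2 * (h + 1))) : ℕ) = 2 * h := by simp
  have h1 : ((pairEquiv (h + 1) (Fin.last h, 1) : Fin (2 * (h + 1))) : ℕ) = 2 * h + 1 := by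
    simp [add_comm]
  have := pf_split_last_pair (h := h) (Matrix.of fun i j : Fin (2 * (h + 1)) => A i j) ?_
  · simp only [Matrix.of_apply, h0, h1] at this
    exact this
  · have hne : ∀ {i : Fin (2 * (h + 1))} {e}, i ≠ pairEquiv (h + 1) (Fin.last h, e) →
        i.1 ≠ (pairEquiv (h + 1) (Fin.last h, e)).1 := fun hi hh => hi (Fin.ext hh)
    rcases hA with hA | hA
    · refine ⟨0, fun i j hij hor hi => ?_⟩
      rcases hor with rfl | rfl
      · exact absurd rfl hi
      · rw [Fin.lt_def, h0] at hij
        rw [Matrix.of_apply, h0]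
        exact hA _ hij
    · refine ⟨1, fun i j hij hor hi => ?_⟩
      have hi' := hne hi
      rw [h0] at hi'
      rw [Fin.lt_def] at hij
      rcases hor with rfl | rfl
      · rw [h1] at hij
        omega
      · rw [h1] at hij
        rw [Matrix.of_apply, h1]
        exact hA _ (by omega)

lemma sum_mul_skew_mul (m : ℕ) (A : ℕ → ℕ → R) (t : ℕ → R) :
    ∑ p : Fin m × Fin m, t p.1 * skew A p.1 p.2 * t p.2 = 0 := by
  refine Finset.sum_involution (fun p _ => p.swap) (fun p _ => ?_) (fun p _ hp hp' => hp ?_)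
    (fun _ _ => Finset.mem_univ _) fun _ _ => Prod.swap_swap _
  · simp only [Prod.fst_swap, Prod.snd_swap]
    rw [skew_swap p.1.1 p.2.1]
    ring
  · rw [show p.2 = p.1 from congrArg Prod.fst hp', skew_self]
    ring

/-- The effect on the Pfaffian of a congruence by `1 + s tᵀ`. -/
lemma natPf_rank_one {m : ℕ} (hm : Even m) (A : ℕ → ℕ → R) (s t : ℕ → R) :
    natPf m (fun i j => A i j + s i * (∑ l ∈ Finset.range m, t l * skew A l j) -
      s j * ∑ l ∈ Finset.range m, t l * skew A l i) =
    (1 + ∑ l ∈ Finset.range m, t l * s l) * natPf m A := by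
  rw [natPf_congr hm (A := A) (B := skew A) fun i j hij _ => (skew_of_lt hij).symm]
  obtain ⟨h, rfl⟩ := even_iff_two_dvd.1 hm
  let u : Fin (2 * h) → R := fun i => s i
  let v : Fin (2 * h) → R := fun i => t i
  have hB : IsAlt (Matrix.of fun i j : Fin (2 * h) => skew A i j) :=
    ⟨fun i j => skew_swap _ _, fun i => skew_self _⟩
  have key := pf_congr_mul hB (1 + Matrix.replicateCol Unit u * Matrix.replicateRow Unit v)
  rw [Matrix.det_one_add_replicateCol_mul_replicateRow] at key
  rw [natPf, Finset.sum_range]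
  refine Eq.trans ?_ key
  refine natPf_congr (m := 2 * h) hm (B := fun i j => skew A i j + s i *
    (∑ l ∈ Finset.range (2 * h), t l * skew A l j) -
      s j * ∑ l ∈ Finset.range (2 * h), t l * skew A l i)
    (fun i j hij _ => by rw [skew_of_lt hij]) |>.trans ?_
  rw [natPf]
  congr 1
  ext i j
  have h1 : ∀ i : Fin (2 * h), (∑ l : Fin (2 * h), skew A i l * t l) =
      -∑ l : Fin (2 * h), t l * skew A l i := fun i => by
    rw [← Finset.sum_neg_distrib]
    exact Finset.sum_congr rfl fun l _ => by rw [skew_swap i.1 l.1]; ring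
  have h2 : ∑ l : Fin (2 * h), (∑ k : Fin (2 * h), t k * skew A k l) * t l = 0 := by
    rw [← sum_mul_skew_mul (2 * h) A t, Fintype.sum_prod_type, Finset.sum_comm]
    simp only [Finset.sum_mul]
  simp only [Matrix.of_apply, Finset.sum_range]
  simp only [Matrix.add_mul, Matrix.mul_add, Matrix.transpose_add, Matrix.transpose_one,
    Matrix.one_mul, Matrix.mul_one, Matrix.transpose_mul, Matrix.add_apply]
  have e1 : (Matrix.replicateCol Unit u * Matrix.replicateRow Unit v *
      Matrix.of fun i j : Fin (2 * h) => skew A i j) =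
      Matrix.of fun i j : Fin (2 * h) => s i * ∑ l : Fin (2 * h), t l * skew A l j := by
    ext i j
    simp [Matrix.mul_apply, u, v, Finset.mul_sum, mul_assoc]
  have e2 : ((Matrix.of fun i j : Fin (2 * h) => skew A i j) *
      ((Matrix.replicateRow Unit v)ᵀ * (Matrix.replicateCol Unit u)ᵀ)) i j =
      -(s j * ∑ l : Fin (2 * h), t l * skew A l i) := by
    have := h1 i
    simp only [Matrix.mul_apply, u, v, Matrix.of_apply, Matrix.transpose_apply,
      Matrix.replicateRow_apply, Matrix.replicateCol_apply, Finset.univ_unique,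
      Finset.sum_singleton, ← mul_assoc, ← Finset.sum_mul]
    rw [this]
    ring
  rw [e1, e2]
  have e3 : ((Matrix.of fun i j : Fin (2 * h) => s i * ∑ l : Fin (2 * h), t l * skew A l j) *
      ((Matrix.replicateRow Unit v)ᵀ * (Matrix.replicateCol Unit u)ᵀ)) i j = 0 := by
    refine Eq.trans ?_ (mul_eq_zero_of_right (s i * s j) h2)
    rw [Finset.mul_sum, Matrix.mul_apply]
    refine Finset.sum_congr rfl fun l _ => ?_
    simp only [Matrix.mul_apply, u, v, Matrix.of_apply, Matrix.transpose_apply,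
      Matrix.replicateRow_apply, Matrix.replicateCol_apply, Finset.univ_unique,
      Finset.sum_singleton]
    ring
  rw [e3, Matrix.of_apply, Matrix.of_apply]
  ring

/-- Adding multiples of the vertex `r` to all vertices. -/
lemma natPf_add_vertex {m r : ℕ} (hm : Even m) (hr : r < m) (A : ℕ → ℕ → R) (s : ℕ → R) :
    natPf m (fun i j => A i j + s i * skew A r j - s j * skew A r i) =
      (1 + s r) * natPf m A := by
  have := natPf_rank_one hm A s (Pi.single r 1)
  simpa [Pi.single_apply, hr] using this

/-- Pivoting on the last pair of indices. -/
lemma natPf_pivot {m : ℕ} (hm : Even m) {A : ℕ → ℕ → R} {u : R} (hu : A m (m + 1) = u)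
    (huu : u * u = 1) :
    natPf (m + 2) A = u * natPf m
      (fun i j => A i j - u * (A i m * A j (m + 1) - A i (m + 1) * A j m)) := by
  have h1 := natPf_add_vertex (m := m + 2) (r := m) (by grind) (by omega) A
    fun i => if i < m then -u * A i (m + 1) else 0
  simp only [lt_irrefl, if_false, add_zero, one_mul] at h1
  rw [← h1, natPf_split hm]
  · simp only [lt_irrefl, if_false, add_zero, zero_mul, hu, Nat.not_lt.2 (Nat.le_succ m), sub_zero]
    congr 1
    refine natPf_congr hm fun i j hij hj => ?_
    rw [if_pos hj, if_pos (hij.trans hj), skew_of_gt hj, skew_of_gt (hij.trans hj)]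
    ring
  · right
    intro i hi
    rw [if_pos hi, if_neg (by omega), skew_of_lt (Nat.lt_succ_self m), hu]
    linear_combination (-A i (m + 1)) * huu

/-- The correction to the entry of two circuit vertices with positions `p`, `p'` and
weights `w`, `w'`. -/
def correction (p p' : ℕ) (w w' : R) : R :=
  if p < p' then (-1) ^ (p + p') * w * w'
  else if p' < p then -((-1) ^ (p + p') * w * w') else 0

lemma correction_step (k p p' : ℕ) (w w' : R) :
    ((-1) ^ (p + 1) * w * ((if p = 2 * k + 1 then 1 else 0) + if p = 2 * k + 2 then 1 else 0)) *
        ((-1) ^ (p' + 1) * w' * if 2 * k + 2 ≤ p' then 1 else 0) -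
      ((-1) ^ (p + 1) * w * if 2 * k + 2 ≤ p then 1 else 0) *
        ((-1) ^ (p' + 1) * w' *
          ((if p' = 2 * k + 1 then 1 else 0) + if p' = 2 * k + 2 then 1 else 0)) +
      (if p ≤ 2 * k ∨ p' ≤ 2 * k then correction p p' w w' else 0) =
    if p ≤ 2 * (k + 1) ∨ p' ≤ 2 * (k + 1) then correction p p' w w' else 0 := by
  have h (a : ℕ) : a ≤ 2 * k ∨ a = 2 * k + 1 ∨ a = 2 * k + 2 ∨ 2 * k + 3 ≤ a := by omega
  unfold correction
  rcases h p with hp | hp | hp | hp <;> rcases h p' with hp' | hp' | hp' | hp' <;>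
    simp (disch := omega) only [if_pos, if_neg] <;> ring

/-- Elimination of a path of `2 * k + 1` vertices, down to its first vertex. -/
lemma natPf_path {m : ℕ} (hm : Odd m) (q : ℕ → ℕ) (w : ℕ → R) (k : ℕ) (A : ℕ → ℕ → R)
    (hout : ∀ x < m, ∀ j < 2 * k, A x (m + j) =
      (-1) ^ (q x + 1) * w x * ((if q x = j then 1 else 0) + if q x = j + 1 then 1 else 0))
    (hend : ∀ x < m, A x (m + 2 * k) = (-1) ^ (q x + 1) * w x * if 2 * k ≤ q x then 1 else 0)
    (hin : ∀ j j', j < j' → j' ≤ 2 * k →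
      A (m + j) (m + j') = if j' = j + 1 then -1 else 0) :
    natPf (m + 2 * k + 1) A = (-1) ^ (k + 1) * natPf (m + 1)
      (fun x x' => if x' < m then
          A x x' + if q x ≤ 2 * k ∨ q x' ≤ 2 * k then correction (q x) (q x') (w x) (w x') else 0
        else (-1) ^ q x * w x) := by
  induction k generalizing A with
  | zero =>
    have hm1 : Even (m + 1) := by grind
    have h1 := natPf_add_vertex (r := m) hm1 (by omega) A
      fun x => if x = m then -2 else if q x = 0 then w x else 0
    simp only [if_true] at h1
    rw [show (1 + -2 : R) = -1 by norm_num] at h1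
    rw [show natPf (m + 2 * 0 + 1) A = -1 * (-1 * natPf (m + 1) A) by simp, ← h1, zero_add, pow_one]
    congr 1
    refine natPf_congr hm1 fun x x' hx hx' => ?_
    have hxm : x < m := by omega
    have e1 : A x m = (-1) ^ (q x + 1) * w x := by simpa using hend x hxm
    rcases Nat.lt_succ_iff_lt_or_eq.1 hx' with hx'm | rfl
    · have e2 : A x' m = (-1) ^ (q x' + 1) * w x' := by simpa using hend x' hx'm
      rw [skew_of_gt hxm, skew_of_gt hx'm, e1, e2]
      simp only [hxm.ne, hx'm.ne, hx'm, if_true, if_false, correction]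
      generalize q x = p, q x' = p'
      split_ifs <;> first | omega | (subst_vars; ring)
    · rw [skew_self, skew_of_gt hxm, e1]
      simp only [hxm.ne, if_true, if_false, lt_irrefl]
      ring
  | succ k ih =>
    have hM : Even (m + 2 * k + 1) := by grind
    have hp := natPf_pivot hM (A := A) (u := -1) (by
      have := hin (2 * k + 1) (2 * k + 2) (by omega) (by omega)
      simpa [add_assoc] using this) (by norm_num)
    rw [show m + 2 * (k + 1) + 1 = m + 2 * k + 1 + 2 by ring, hp]
    have hc : ∀ x < m, A x (m + 2 * k + 1) = (-1) ^ (q x + 1) * w x *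
        ((if q x = 2 * k + 1 then 1 else 0) + if q x = 2 * k + 2 then 1 else 0) := fun x hx =>
      hout x hx (2 * k + 1) (by omega)
    have hd : ∀ x < m, A x (m + 2 * k + 1 + 1) = (-1) ^ (q x + 1) * w x *
        if 2 * k + 2 ≤ q x then 1 else 0 := fun x hx => hend x hx
    have hbc : ∀ j ≤ 2 * k, A (m + j) (m + 2 * k + 1) = if j = 2 * k then -1 else 0 :=
      fun j hj => by
        have := hin j (2 * k + 1) (by omega) (by omega)
        rw [← add_assoc] at this
        rw [this]
        congr 1
        simp only [eq_iff_iff]; omega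
    have hbd : ∀ j ≤ 2 * k, A (m + j) (m + 2 * k + 1 + 1) = 0 := fun j hj => by
      have := hin j (2 * k + 2) (by omega) (by omega)
      rw [if_neg (by omega)] at this
      exact this
    rw [ih]
    · rw [← mul_assoc, pow_succ' (-1 : R) (k + 1)]
      congr 1
      refine natPf_congr (by grind) fun x x' hx hx' => ?_
      have hxm : x < m := by omega
      rcases Nat.lt_succ_iff_lt_or_eq.1 hx' with hx'm | rfl
      · rw [if_pos hx'm, if_pos hx'm, hc x hxm, hc x' hx'm, hd x hxm, hd x' hx'm,
          ← correction_step]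
        ring
      · simp
    · intro x hx j hj
      rw [hc x hx, hd x hx, hbc j (by omega), hbd j (by omega), hout x hx j (by omega),
        if_neg (show j ≠ 2 * k by omega)]
      ring
    · intro x hx
      rw [hd x hx, hbc _ le_rfl, hbd _ le_rfl, hout x hx _ (by omega), if_pos rfl]
      generalize q x = p
      split_ifs <;> first | omega | ring
    · intro j j' hj hj'
      rw [hbd j (by omega), hbd j' (by omega), hin j j' hj (by omega)]
      ring

/-- The entry between the circuit vertex in position `p`, of weight `w`, and the inner vertex in
position `j`, for a circuit with `2 * k + 2` vertices. -/
def blade (k p j : ℕ) (w : R) : R :=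
  (-1) ^ (p + 1) * w *
    ((if p = j then 1 else 0) + if p = j + 1 ∨ p = 0 ∧ j = 2 * k + 1 then 1 else 0)

/-- The entry between the inner vertices in positions `j < j'`, for a circuit with `2 * k + 2`
vertices. -/
def rim (R : Type*) [CommRing R] (k j j' : ℕ) : R :=
  if j' = j + 1 then -1 else if j = 0 ∧ j' = 2 * k + 1 then 1 else 0

/-- Elimination of the inner block of a circuit with `2 * (k + 1)` vertices, down to a virtual
vertex. -/
lemma natPf_circuit {m : ℕ} (hm : Odd m) (q : ℕ → ℕ) (w : ℕ → R) {k : ℕ} (hk : k ≠ 0)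
    (A : ℕ → ℕ → R) (hq : ∀ x < m, q x < 2 * k + 2)
    (hout : ∀ x < m, ∀ j < 2 * k + 2, A x (m + j) = blade k (q x) j (w x))
    (hin : ∀ j j', j < j' → j' < 2 * k + 2 → A (m + j) (m + j') = rim R k j j')
    (hlast : ∀ j < 2 * k + 2, A (m + j) (m + (2 * k + 2)) = (-1) ^ (j + 1)) :
    natPf (m + 2 * k + 3) A = (-1) ^ (k + 1) * (2 * (k + 1) : ℕ) * natPf (m + 1)
      (fun x x' => if x' < m then A x x' + correction (q x) (q x') (w x) (w x')
        else (-1) ^ q x * w x) := by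
  have hM : Even (m + 2 * k + 1) := by grind
  simp only [blade] at hout
  simp only [rim] at hin
  set s : ℕ → R := fun l => if l = m + 2 * k + 1 then 1 else 0 with hs
  set t : ℕ → R := fun l => if m ≤ l ∧ l < m + 2 * k + 1 then (-1) ^ (l - m + 1) else 0 with ht
  have hsum (f : ℕ → R) : ∑ l ∈ Finset.range (m + 2 * k + 3), t l * f l =
      ∑ i ∈ Finset.range (2 * k + 1), (-1) ^ (i + 1) * f (m + i) := by
    rw [show m + 2 * k + 3 = m + (2 * k + 1) + 1 + 1 by ring, Finset.sum_range_succ,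
      Finset.sum_range_succ, Finset.sum_range_add, Finset.sum_eq_zero, zero_add]
    · simp only [ht]
      rw [if_neg (by omega), if_neg (by omega), zero_mul, add_zero, zero_mul, add_zero]
      refine Finset.sum_congr rfl fun i hi => ?_
      rw [Finset.mem_range] at hi
      rw [if_pos (by omega), Nat.add_sub_cancel_left]
    · intro l hl
      rw [Finset.mem_range] at hl
      simp only [ht]
      rw [if_neg (by omega), zero_mul]
  have h1 := natPf_rank_one (m := m + 2 * k + 3) (by grind) A s t
  simp only [hsum] at h1
  rw [Finset.sum_eq_zero (fun i hi => by
    rw [Finset.mem_range] at hi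
    simp only [hs]
    rw [if_neg (by omega), mul_zero]), add_zero, one_mul] at h1
  rw [← h1, natPf_split hM (Or.inl fun i hi => ?_)]
  · have hcong : natPf (m + 2 * k + 1) (fun i j =>
        A i j + s i * ∑ l ∈ Finset.range (2 * k + 1), (-1) ^ (l + 1) * skew A (m + l) j -
          s j * ∑ l ∈ Finset.range (2 * k + 1), (-1) ^ (l + 1) * skew A (m + l) i) =
        natPf (m + 2 * k + 1) A := by
      refine natPf_congr hM fun i j hij hj => ?_
      simp only [hs]
      rw [if_neg (by omega), if_neg (by omega)]
      ring
    rw [hcong, natPf_path hm q w k A]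
    · have hval : A (m + 2 * k + 1) (m + 2 * k + 1 + 1) +
          s (m + 2 * k + 1) * ∑ l ∈ Finset.range (2 * k + 1),
            (-1) ^ (l + 1) * skew A (m + l) (m + 2 * k + 1 + 1) -
          s (m + 2 * k + 1 + 1) * ∑ l ∈ Finset.range (2 * k + 1),
            (-1) ^ (l + 1) * skew A (m + l) (m + 2 * k + 1) = (2 * (k + 1) : ℕ) := by
        have e1 : A (m + 2 * k + 1) (m + 2 * k + 1 + 1) = 1 := by
          have := hlast (2 * k + 1) (by omega)
          rw [show m + 2 * k + 1 + 1 = m + (2 * k + 2) by ring,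
            show m + 2 * k + 1 = m + (2 * k + 1) by ring, this]
          exact Even.neg_one_pow (by grind)
        have e2 : ∀ l ∈ Finset.range (2 * k + 1),
            (-1) ^ (l + 1) * skew A (m + l) (m + 2 * k + 1 + 1) = 1 := fun l hl => by
          rw [Finset.mem_range] at hl
          rw [skew_of_lt (by omega), show m + 2 * k + 1 + 1 = m + (2 * k + 2) by ring,
            hlast l (by omega), ← mul_pow]
          simp
        rw [Finset.sum_congr rfl e2, e1]
        simp [hs]
        ring
      rw [hval, ← mul_assoc, mul_comm ((2 * (k + 1) : ℕ) : R)]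
      congr 1
      refine natPf_congr (by grind) fun x x' hx hx' => ?_
      by_cases hx'm : x' < m
      · rw [if_pos hx'm, if_pos hx'm]
        have := hq x (by omega)
        have := hq x' hx'm
        split_ifs with hp
        · rfl
        · rw [correction, if_neg (by omega), if_neg (by omega)]
      · rw [if_neg hx'm, if_neg hx'm]
    · intro x hx j hj
      rw [hout x hx j (by omega)]
      congr 3
      simp only [eq_iff_iff]; omega
    · intro x hx
      have := hq x hx
      rw [hout x hx _ (by omega)]
      split_ifs <;> first | omega | ring
    · intro j j' hj hj'
      rw [hin j j' hj (by omega)]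
      split_ifs <;> first | omega | rfl
  · have hsi : s i = 0 := if_neg (by omega)
    have hsr : s (m + 2 * k + 1) = 1 := if_pos rfl
    rw [hsi, hsr, zero_mul, add_zero, one_mul]
    by_cases him : i < m
    · have := hq i him
      have e (l) (hl : l ∈ Finset.range (2 * k + 1)) : (-1) ^ (l + 1) * skew A (m + l) i =
          (-1) ^ (q i + 1) * w i * (((-1) ^ (l + 1 + 1) * if q i = l + 1 then 1 else 0) -
            (-1) ^ (l + 1) * if q i = l then 1 else 0) := by
        rw [Finset.mem_range] at hl
        rw [skew_of_gt (by omega), hout i him l (by omega)]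
        simp only [show l ≠ 2 * k + 1 by omega, and_false, or_false]
        ring
      rw [Finset.sum_congr rfl e, ← Finset.mul_sum,
        Finset.sum_range_sub fun l => (-1 : R) ^ (l + 1) * if q i = l then 1 else 0]
      have := hout i him (2 * k + 1) (by omega)
      rw [← add_assoc] at this
      rw [this, Even.neg_one_pow (by grind : Even (2 * k + 1 + 1))]
      split_ifs <;> first | omega | ring
    · obtain ⟨a, rfl⟩ := Nat.exists_eq_add_of_le (not_lt.1 him)
      have e (l) (hl : l ∈ Finset.range (2 * k + 1)) : (-1) ^ (l + 1) * skew A (m + l) (m + a) =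
          (if a + 1 = l then (-1) ^ (l + 1) else 0) -
            if a = l + 1 then (-1) ^ (l + 1) else 0 := by
        rw [Finset.mem_range] at hl
        rcases lt_trichotomy l a with h | rfl | h
        · rw [skew_of_lt (by omega), hin l a h (by omega)]
          split_ifs <;> first | omega | ring
        · simp [skew_self]
        · rw [skew_of_gt (by omega), hin a l h (by omega)]
          split_ifs <;> first | omega | ring
      rw [Finset.sum_congr rfl e, Finset.sum_sub_distrib, Finset.sum_ite_eq]
      have := hin a (2 * k + 1) (by omega) (by omega)
      rw [← add_assoc] at this
      rw [this]
      rcases a with _ | a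
      · simp [hk, Nat.pos_of_ne_zero hk]
      · simp only [add_left_inj, Finset.sum_ite_eq, Finset.mem_range, Nat.add_eq_zero_iff,
          one_ne_zero, and_false, false_and, if_false]
        by_cases ha : a + 1 = 2 * k
        · have : Even (a + 1) := by grind
          rw [if_pos (by omega), if_neg (by omega), if_pos (by omega), this.neg_one_pow]
          ring
        · rw [if_neg (by omega), if_pos (by omega), if_pos (by omega)]
          ring

/-- The position, before rotating the segment `[a, a + L]` by `k` places, of the vertex which the
rotation puts in position `i`. -/
def rotate (a L k i : ℕ) : ℕ := if i < a then i else a + (i - a + k) % (L + 1)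

lemma finRotate_pow_val (L k : ℕ) (i : Fin (L + 1)) :
    ((finRotate (L + 1) ^ k) i : ℕ) = (i + k) % (L + 1) := by
  induction k with
  | zero => simp [Nat.mod_eq_of_lt i.2]
  | succ k ih =>
    rw [pow_succ', Equiv.Perm.mul_apply, finRotate_apply, Fin.val_add, ih]
    simp [add_assoc]

lemma exists_perm_rotate (a L k : ℕ) : ∃ σ : Equiv.Perm (Fin (a + (L + 1))),
    Equiv.Perm.sign σ = (-1) ^ (L * k) ∧ ∀ i, (σ i : ℕ) = rotate a L k i := by
  refine ⟨finSumFinEquiv.permCongr (Equiv.Perm.sumCongr 1 (finRotate (L + 1) ^ k)), ?_, ?_⟩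
  · rw [Equiv.Perm.sign_permCongr, Equiv.Perm.sign_sumCongr, map_pow, sign_finRotate, map_one,
      one_mul, pow_mul, Nat.add_sub_cancel]
  · intro i
    obtain ⟨i, rfl⟩ := finSumFinEquiv.surjective i
    rw [Equiv.permCongr_apply, Equiv.symm_apply_apply]
    rcases i with i | i
    · simp [rotate]
    · simp [rotate, finRotate_pow_val]

lemma natPf_rotate {a L : ℕ} (hm : Even (a + (L + 1))) (k : ℕ) (A : ℕ → ℕ → R) :
    natPf (a + (L + 1)) (fun i j => skew A (rotate a L k i) (rotate a L k j)) =
      (-1) ^ (L * k) * natPf (a + (L + 1)) A := by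
  rw [natPf_congr hm (A := A) (B := skew A) fun i j hij _ => (skew_of_lt hij).symm]
  obtain ⟨σ, hs, hσ⟩ := exists_perm_rotate a L k
  generalize a + (L + 1) = m at *
  obtain ⟨h, rfl⟩ := even_iff_two_dvd.1 hm
  have hB : IsAlt (Matrix.of fun i j : Fin (2 * h) => skew A i j) :=
    ⟨fun i j => skew_swap _ _, fun i => skew_self _⟩
  have key := pf_congr_mul hB (σ.permMatrix R)
  rw [Matrix.det_permutation, hs] at key
  simp only [natPf]
  convert key using 1
  · congr 1
    ext i j
    rw [Matrix.transpose_permMatrix, Equiv.Perm.permMatrix, Equiv.Perm.permMatrix,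
      PEquiv.toMatrix_toPEquiv_mul, PEquiv.mul_toMatrix_toPEquiv]
    simp [hσ, Equiv.Perm.inv_def]
  · simp

/-- Elimination of the inner blocks of two circuits with `2 * (k₁ + 1)` and `2 * (k₂ + 1)`
vertices. -/
lemma natPf_two_circuits {k₁ k₂ N₁ N₂ : ℕ} (hk₁ : k₁ ≠ 0) (hk₂ : k₂ ≠ 0) (hN₁ : N₁ = 2 * k₁ + 2)
    (hN₂ : N₂ = 2 * k₂ + 2) (W A M : ℕ → ℕ → R) (y₁ y₂ : ℕ → R)
    (hA₁₁ : ∀ i j, i < j → j < N₁ → A i j = W i j)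
    (hA₁₂ : ∀ i < N₁, ∀ j < N₂, A i (N₁ + (N₁ + 1 + j)) = W i (N₁ + j))
    (hA₂₂ : ∀ i j, i < j → j < N₂ →
      A (N₁ + (N₁ + 1 + i)) (N₁ + (N₁ + 1 + j)) = W (N₁ + i) (N₁ + j))
    (hA₁ : ∀ i < N₁, ∀ j < N₁, A i (N₁ + j) = blade k₁ i j (y₁ i))
    (hA₂ : ∀ i < N₂, ∀ j < N₂,
      A (N₁ + (N₁ + 1 + i)) (N₁ + (N₁ + 1 + (N₂ + j))) = blade k₂ i j (y₂ i))
    (hB₁ : ∀ j j', j < j' → j' < N₁ → A (N₁ + j) (N₁ + j') = rim R k₁ j j')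
    (hB₂ : ∀ j j', j < j' → j' < N₂ →
      A (N₁ + (N₁ + 1 + (N₂ + j))) (N₁ + (N₁ + 1 + (N₂ + j'))) = rim R k₂ j j')
    (hL₁ : ∀ j < N₁, A (N₁ + j) (N₁ + N₁) = (-1) ^ (j + 1))
    (hL₂ : ∀ j < N₂,
      A (N₁ + (N₁ + 1 + (N₂ + j))) (N₁ + (N₁ + 1 + (N₂ + N₂))) = (-1) ^ (j + 1))
    (hO₁ : ∀ j ≤ N₁, ∀ t < N₂ + N₂, A (N₁ + j) (N₁ + (N₁ + 1 + t)) = 0)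
    (hO₂ : ∀ i < N₁, ∀ j < N₂, A i (N₁ + (N₁ + 1 + (N₂ + j))) = 0)
    (hM₁₁ : ∀ i j, i < j → j < N₁ → M i j = W i j + (-1) ^ (i + j) * y₁ i * y₁ j)
    (hM₁₂ : ∀ i < N₁, ∀ j < N₂, M i (N₁ + 1 + j) = W i (N₁ + j))
    (hM₂₂ : ∀ i j, i < j → j < N₂ → M (N₁ + 1 + i) (N₁ + 1 + j) =
      W (N₁ + i) (N₁ + j) + (-1) ^ (i + j) * y₂ i * y₂ j)
    (hV₁ : ∀ i < N₁, M i N₁ = (-1) ^ i * y₁ i)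
    (hV₂ : ∀ i < N₂, M (N₁ + 1 + i) (N₁ + 1 + N₂) = (-1) ^ i * y₂ i)
    (hU₁ : ∀ i < N₁, M i (N₁ + 1 + N₂) = 0)
    (hU₂ : ∀ j ≤ N₂, M N₁ (N₁ + 1 + j) = 0) :
    natPf (N₁ + (N₁ + 1 + (N₂ + (N₂ + 1)))) A =
      (-1) ^ (k₁ + 1 + (k₂ + 1)) * N₁ * N₂ * natPf (N₁ + 1 + (N₂ + 1)) M := by
  have he₁ : Even N₁ := by grind
  have he₂ : Even N₂ := by grind
  have low (x) (hx : x < N₁ + (N₁ + 1 + N₂)) : x < N₁ ∨ (∃ j ≤ N₁, x = N₁ + j) ∨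
      ∃ t < N₂, x = N₁ + (N₁ + 1 + t) := by
    by_cases h1 : x < N₁
    · exact Or.inl h1
    by_cases h2 : x < N₁ + (N₁ + 1)
    · exact Or.inr (Or.inl ⟨x - N₁, by omega, by omega⟩)
    · exact Or.inr (Or.inr ⟨x - (N₁ + (N₁ + 1)), by omega, by omega⟩)
  set q₂ : ℕ → ℕ := fun x => x - (N₁ + (N₁ + 1)) with hq₂
  set w₂ : ℕ → R := fun x => if x < N₁ + (N₁ + 1) then 0 else y₂ (x - (N₁ + (N₁ + 1))) with hw₂
  have q₂_add (t) : q₂ (N₁ + (N₁ + 1 + t)) = t := by simp only [hq₂]; omega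
  have w₂_add (t) : w₂ (N₁ + (N₁ + 1 + t)) = y₂ t := by
    simp only [hw₂]
    rw [if_neg (by omega)]
    congr 1
    omega
  have w₂_low (x) (hx : x < N₁ + (N₁ + 1)) : w₂ x = 0 := if_pos hx
  have h2 := natPf_circuit (m := N₁ + (N₁ + 1 + N₂)) (by grind) q₂ w₂ hk₂ A
    (fun x hx => by simp only [hq₂]; omega)
    (fun x hx j hj => by
      rw [show N₁ + (N₁ + 1 + N₂) + j = N₁ + (N₁ + 1 + (N₂ + j)) by ring]
      rcases low x hx with h | ⟨i, hi, rfl⟩ | ⟨t, ht, rfl⟩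
      · rw [hO₂ x h j (by omega), w₂_low x (by omega), blade]
        ring
      · rw [hO₁ i hi _ (by omega), w₂_low _ (by omega), blade]
        ring
      · rw [hA₂ t ht j (by omega), q₂_add, w₂_add])
    (fun j j' hj hj' => by simpa only [add_assoc] using hB₂ j j' hj (by omega))
    (fun j hj => by simpa only [add_assoc, hN₂] using hL₂ j (by omega))
  set X : ℕ → ℕ → R := fun x x' => if x' < N₁ + (N₁ + 1 + N₂) then
    A x x' + correction (q₂ x) (q₂ x') (w₂ x) (w₂ x') else (-1) ^ q₂ x * w₂ x with hX
  have X_low (x x') (hx : x < N₁ + (N₁ + 1)) (hx' : x' < N₁ + (N₁ + 1 + N₂)) :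
      X x x' = A x x' := by
    simp [hX, hx', correction, w₂_low x hx]
  have X_virtual (x) (hx : x < N₁ + (N₁ + 1)) : X x (N₁ + (N₁ + 1 + N₂)) = 0 := by
    simp [hX, w₂_low x hx]
  have hr := natPf_rotate (a := N₁) (L := N₁ + N₂ + 1) (by grind) (N₁ + 1) X
  rw [Odd.neg_one_pow (by grind)] at hr
  have g_low (x) (hx : x < N₁) : rotate N₁ (N₁ + N₂ + 1) (N₁ + 1) x = x := if_pos hx
  have g_mid (t) (ht : t ≤ N₂) :
      rotate N₁ (N₁ + N₂ + 1) (N₁ + 1) (N₁ + t) = N₁ + (N₁ + 1 + t) := by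
    rw [rotate, if_neg (by omega), Nat.add_sub_cancel_left, Nat.mod_eq_of_lt (by omega),
      add_comm t]
  have g_high (t) (ht : t ≤ N₁) :
      rotate N₁ (N₁ + N₂ + 1) (N₁ + 1) (N₁ + N₂ + 1 + t) = N₁ + t := by
    rw [rotate, if_neg (by omega),
      show N₁ + N₂ + 1 + t - N₁ + (N₁ + 1) = t + (N₁ + N₂ + 1 + 1) by omega, Nat.add_mod_right,
      Nat.mod_eq_of_lt (by omega)]
  set Y : ℕ → ℕ → R := fun i j => skew X (rotate N₁ (N₁ + N₂ + 1) (N₁ + 1) i)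
    (rotate N₁ (N₁ + N₂ + 1) (N₁ + 1) j) with hY
  set w₁ : ℕ → R := fun x => if x < N₁ then y₁ x else 0 with hw₁
  set q₁ : ℕ → ℕ := fun x => if x < N₁ then x else 0 with hq₁
  have h1 := natPf_circuit (m := N₁ + N₂ + 1) (by grind) q₁ w₁ hk₁ Y
    (fun x hx => by simp only [hq₁]; split_ifs <;> omega)
    (fun x hx j hj => by
      simp only [hY]
      rw [g_high j (by omega)]
      by_cases hx₁ : x < N₁
      · rw [g_low x hx₁, skew_of_lt (by omega), X_low _ _ (by omega) (by omega),
          hA₁ x hx₁ j (by omega)]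
        simp only [hq₁, hw₁, if_pos hx₁]
      · obtain ⟨t, rfl⟩ := Nat.exists_eq_add_of_le (not_lt.1 hx₁)
        rw [g_mid t (by omega), skew_of_gt (by omega)]
        have hw0 : w₁ (N₁ + t) = 0 := if_neg hx₁
        rw [hw0, blade]
        rcases (by omega : t < N₂ ∨ t = N₂) with ht | rfl
        · rw [X_low _ _ (by omega) (by omega), hO₁ j (by omega) t (by omega)]
          ring
        · rw [X_virtual _ (by omega)]
          ring)
    (fun j j' hj hj' => by
      simp only [hY]
      rw [g_high j (by omega), g_high j' (by omega), skew_of_lt (by omega),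
        X_low _ _ (by omega) (by omega), hB₁ j j' hj (by omega)])
    (fun j hj => by
      simp only [hY]
      rw [g_high j (by omega), g_high _ (by omega), skew_of_lt (by omega),
        X_low _ _ (by omega) (by omega), ← hN₁, hL₁ j (by omega)])
  have hs := natPf_rotate (a := N₁) (L := N₂ + 1) (by grind) 1 M
  rw [Odd.neg_one_pow (by grind)] at hs
  have f_low (x) (hx : x < N₁) : rotate N₁ (N₂ + 1) 1 x = x := if_pos hx
  have f_mid (t) (ht : t ≤ N₂) : rotate N₁ (N₂ + 1) 1 (N₁ + t) = N₁ + 1 + t := by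
    rw [rotate, if_neg (by omega), Nat.add_sub_cancel_left, Nat.mod_eq_of_lt (by omega)]
    omega
  have f_last : rotate N₁ (N₂ + 1) 1 (N₁ + N₂ + 1) = N₁ := by
    rw [rotate, if_neg (by omega), show N₁ + N₂ + 1 - N₁ + 1 = N₂ + 1 + 1 by omega, Nat.mod_self,
      add_zero]
  have hZ : natPf (N₁ + N₂ + 1 + 1) (fun x x' => if x' < N₁ + N₂ + 1 then
      Y x x' + correction (q₁ x) (q₁ x') (w₁ x) (w₁ x') else (-1) ^ q₁ x * w₁ x) =
      natPf (N₁ + N₂ + 1 + 1)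
        (fun i j => skew M (rotate N₁ (N₂ + 1) 1 i) (rotate N₁ (N₂ + 1) 1 j)) := by
    refine natPf_congr (by grind) fun x x' hx hx' => ?_
    simp only [hY]
    rcases Nat.lt_succ_iff_lt_or_eq.1 hx' with hx'm | rfl
    · rw [if_pos hx'm]
      by_cases hx₁ : x < N₁
      · by_cases hx'₁ : x' < N₁
        · simp only [hq₁, hw₁, if_pos hx₁, if_pos hx'₁, g_low _ hx₁, g_low _ hx'₁, f_low _ hx₁,
            f_low _ hx'₁, skew_of_lt hx, hM₁₁ _ _ hx hx'₁, correction, if_pos hx]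
          rw [X_low _ _ (by omega) (by omega), hA₁₁ _ _ hx hx'₁]
        · obtain ⟨t, rfl⟩ := Nat.exists_eq_add_of_le (not_lt.1 hx'₁)
          rw [g_low _ hx₁, f_low _ hx₁, g_mid t (by omega), f_mid t (by omega),
            skew_of_lt (by omega), skew_of_lt (by omega)]
          have hw0 : w₁ (N₁ + t) = 0 := if_neg hx'₁
          rw [hw0]
          rcases (by omega : t < N₂ ∨ t = N₂) with ht | rfl
          · rw [X_low _ _ (by omega) (by omega), hA₁₂ x hx₁ t ht, hM₁₂ x hx₁ t ht]
            simp [correction]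
          · rw [X_virtual _ (by omega), hU₁ x hx₁]
            simp [correction]
      · obtain ⟨s, rfl⟩ := Nat.exists_eq_add_of_le (not_lt.1 hx₁)
        obtain ⟨t, rfl⟩ := Nat.exists_eq_add_of_le (not_lt.1 hx₁ |>.trans hx.le)
        have hw0 : w₁ (N₁ + t) = 0 := if_neg (by omega)
        rw [hw0, g_mid s (by omega), f_mid s (by omega), g_mid t (by omega), f_mid t (by omega),
            skew_of_lt (by omega), skew_of_lt (by omega)]
        simp only [hX, q₂_add, w₂_add]
        rcases (by omega : t < N₂ ∨ t = N₂) with ht | rfl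
        · rw [if_pos (by omega), hA₂₂ s t (by omega) ht, hM₂₂ s t (by omega) ht]
          simp [correction, show s < t by omega]
        · rw [if_neg (by omega), hV₂ s (by omega)]
          simp [correction]
    · rw [if_neg (lt_irrefl _), f_last]
      by_cases hx₁ : x < N₁
      · rw [f_low _ hx₁, skew_of_lt hx₁, hV₁ x hx₁]
        simp only [hq₁, hw₁, if_pos hx₁]
      · obtain ⟨s, rfl⟩ := Nat.exists_eq_add_of_le (not_lt.1 hx₁)
        rw [f_mid s (by omega), skew_of_gt (by omega), hU₂ s (by omega)]
        simp [hw₁]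
  have d0 : N₁ + (N₁ + 1 + (N₂ + (N₂ + 1))) = N₁ + (N₁ + 1 + N₂) + 2 * k₂ + 3 := by omega
  have d1 : N₁ + (N₁ + 1 + N₂) + 1 = N₁ + (N₁ + N₂ + 1 + 1) := by omega
  have d2 : N₁ + (N₁ + N₂ + 1 + 1) = N₁ + N₂ + 1 + 2 * k₁ + 3 := by omega
  have d3 : N₁ + (N₂ + 1 + 1) = N₁ + N₂ + 1 + 1 := by omega
  have d4 : N₁ + 1 + (N₂ + 1) = N₁ + N₂ + 1 + 1 := by omega
  have hr' : natPf (N₁ + (N₁ + N₂ + 1 + 1)) X = -natPf (N₁ + (N₁ + N₂ + 1 + 1)) Y := by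
    rw [hr]; ring
  rw [d0, h2, d1, hr', d2, h1, hZ, ← d3, hs, d3, d4, show 2 * (k₁ + 1) = N₁ by omega,
    show 2 * (k₂ + 1) = N₂ by omega]
  ring

/-- The extension by zero of a finite matrix. -/
def extend {m : ℕ} (A : Matrix (Fin m) (Fin m) R) (i j : ℕ) : R :=
  if hij : i < m ∧ j < m then A ⟨i, hij.1⟩ ⟨j, hij.2⟩ else 0

lemma extend_val {m : ℕ} (A : Matrix (Fin m) (Fin m) R) (i j : Fin m) :
    extend A i j = A i j := dif_pos ⟨i.2, j.2⟩

lemma natPf_extend {m : ℕ} (A : Matrix (Fin m) (Fin m) R) : natPf m (extend A) = pf A := by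
  rw [natPf]
  congr 1
  ext i j
  exact extend_val A i j

lemma extend_reindex {m : ℕ} {ι : Type*} (e : ι ≃ Fin m) (A : Matrix ι ι R) (p q : ι) :
    extend (Matrix.reindex e e A) (e p) (e q) = A p q := by
  simp [extend_val]

/-- The extension by zero of a family of weights. -/
def extendVec {m : ℕ} (y : Fin m → R) (i : ℕ) : R := if hi : i < m then y ⟨i, hi⟩ else 0

lemma shurA1_eq_blade (k : ℕ) (y : Fin (2 * (k + 1)) → R) {i j : ℕ} (hi : i < 2 * (k + 1))
    (hj : j < 2 * (k + 1)) :
    shurA1 (2 * (k + 1)) y ⟨i, hi⟩ ⟨j, by omega⟩ = blade k i j (extendVec y i) := by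
  simp only [shurA1, blade, extendVec, dif_pos hi]
  split_ifs <;> first | omega | (subst_vars; ring)

lemma shurB1_eq_rim (k : ℕ) {j j' : ℕ} (hj : j < j') (hj' : j' < 2 * (k + 1)) :
    shurB1 (R := R) (2 * (k + 1)) ⟨j, by omega⟩ ⟨j', by omega⟩ = rim R k j j' := by
  simp only [shurB1, rim]
  split_ifs <;> first | omega | rfl

lemma shurB1_last {N j : ℕ} (hj : j < N) :
    shurB1 (R := R) N ⟨j, by omega⟩ ⟨N, by omega⟩ = (-1) ^ (j + 1) := by
  simp only [shurB1, true_and]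
  split_ifs <;> first | omega | rfl

lemma corr_of_lt {N : ℕ} (y : Fin N → R) {i j : ℕ} (hij : i < j) (hj : j < N) :
    corr N y ⟨i, by omega⟩ ⟨j, by omega⟩ = (-1) ^ (i + j) * extendVec y i * extendVec y j := by
  simp [corr, vWeight, extendVec, hij, hj, hij.trans hj]

lemma corr_last {N : ℕ} (hN : Even N) (y : Fin N → R) {i : ℕ} (hi : i < N) :
    corr N y ⟨i, by omega⟩ ⟨N, by omega⟩ = (-1) ^ i * extendVec y i := by
  simp [corr, vWeight, extendVec, hi, pow_add, hN.neg_one_pow]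

end Pfaffian

/-- **Equation (1) in the proof of Proposition 3.3, global form** (two boundary circuits
of odd monomer parity): for even `N1 = 2 n1 ≥ 4`, `N2 = 2 n2 ≥ 4`, any weights and any
skew-symmetric `(N1+N2) × (N1+N2)` matrix `W`, one has
`Pf(A) = (-1)^{n1+n2} N1 N2 Pf(M)`. -/
theorem pf_block_two_odd_circuits {R : Type*} [CommRing R] (n1 n2 : ℕ)
    (h1 : 2 ≤ n1) (h2 : 2 ≤ n2) (y1 : Fin (2 * n1) → R) (y2 : Fin (2 * n2) → R)
    (W : Matrix (Fin (2 * n1 + 2 * n2)) (Fin (2 * n1 + 2 * n2)) R) (hW : Wᵀ = -W) :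
    pf (Matrix.reindex
        ((Equiv.sumCongr (Equiv.refl (Fin (2 * n1)))
          ((Equiv.sumCongr (Equiv.refl (Fin (2 * n1 + 1))) finSumFinEquiv).trans
            finSumFinEquiv)).trans finSumFinEquiv)
        ((Equiv.sumCongr (Equiv.refl (Fin (2 * n1)))
          ((Equiv.sumCongr (Equiv.refl (Fin (2 * n1 + 1))) finSumFinEquiv).trans
            finSumFinEquiv)).trans finSumFinEquiv)
        (bigA (2 * n1) (2 * n2) W y1 y2)) =
      (-1 : R) ^ (n1 + n2) * (2 * n1 : ℕ) * (2 * n2 : ℕ) *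
        pf (Matrix.reindex finSumFinEquiv finSumFinEquiv (bigM (2 * n1) (2 * n2) W y1 y2)) := by
  obtain ⟨k₁, rfl⟩ := Nat.exists_eq_add_of_le' (by omega : 1 ≤ n1)
  obtain ⟨k₂, rfl⟩ := Nat.exists_eq_add_of_le' (by omega : 1 ≤ n2)
  rw [← Pfaffian.natPf_extend, ← Pfaffian.natPf_extend]
  have hA := Pfaffian.extend_reindex
    ((Equiv.sumCongr (Equiv.refl (Fin (2 * (k₁ + 1))))
      ((Equiv.sumCongr (Equiv.refl (Fin (2 * (k₁ + 1) + 1))) finSumFinEquiv).trans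
        finSumFinEquiv)).trans finSumFinEquiv)
    (bigA (2 * (k₁ + 1)) (2 * (k₂ + 1)) W y1 y2)
  have hM := Pfaffian.extend_reindex finSumFinEquiv
    (bigM (2 * (k₁ + 1)) (2 * (k₂ + 1)) W y1 y2)
  have hw := Pfaffian.extend_val W
  have he (k : ℕ) : Even (2 * (k + 1)) := even_two_mul _
  refine Pfaffian.natPf_two_circuits (k₁ := k₁) (k₂ := k₂)
    (N₁ := 2 * (k₁ + 1)) (N₂ := 2 * (k₂ + 1)) (by omega) (by omega) rfl rfl
    (Pfaffian.extend W) _ _ (Pfaffian.extendVec y1) (Pfaffian.extendVec y2) ?_ ?_ ?_ ?_ ?_ ?_ ?_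
    ?_ ?_ ?_ ?_ ?_ ?_ ?_ ?_ ?_ ?_ ?_
  · intro i j hij hj
    exact (hA (.inl ⟨i, by omega⟩) (.inl ⟨j, hj⟩)).trans (hw _ _).symm
  · intro i hi j hj
    exact (hA (.inl ⟨i, hi⟩) (.inr (.inr (.inl ⟨j, hj⟩)))).trans (hw _ _).symm
  · intro i j hij hj
    exact (hA (.inr (.inr (.inl ⟨i, by omega⟩))) (.inr (.inr (.inl ⟨j, hj⟩)))).trans (hw _ _).symm
  · intro i hi j hj
    exact (hA (.inl ⟨i, hi⟩) (.inr (.inl ⟨j, by omega⟩))).trans (Pfaffian.shurA1_eq_blade _ _ hi hj)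
  · intro i hi j hj
    exact (hA (.inr (.inr (.inl ⟨i, hi⟩))) (.inr (.inr (.inr ⟨j, by omega⟩)))).trans
      (Pfaffian.shurA1_eq_blade _ _ hi hj)
  · intro j j' hj hj'
    exact (hA (.inr (.inl ⟨j, by omega⟩)) (.inr (.inl ⟨j', by omega⟩))).trans
      (Pfaffian.shurB1_eq_rim _ hj hj')
  · intro j j' hj hj'
    exact (hA (.inr (.inr (.inr ⟨j, by omega⟩))) (.inr (.inr (.inr ⟨j', by omega⟩)))).trans
      (Pfaffian.shurB1_eq_rim _ hj hj')
  · intro j hj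
    exact (hA (.inr (.inl ⟨j, by omega⟩)) (.inr (.inl ⟨_, by omega⟩))).trans
      (Pfaffian.shurB1_last hj)
  · intro j hj
    exact (hA (.inr (.inr (.inr ⟨j, by omega⟩))) (.inr (.inr (.inr ⟨_, by omega⟩)))).trans
      (Pfaffian.shurB1_last hj)
  · intro j hj t ht
    by_cases ht' : t < 2 * (k₂ + 1)
    · exact hA (.inr (.inl ⟨j, by omega⟩)) (.inr (.inr (.inl ⟨t, ht'⟩)))
    · obtain ⟨t, rfl⟩ := Nat.exists_eq_add_of_le (not_lt.1 ht')
      exact hA (.inr (.inl ⟨j, by omega⟩)) (.inr (.inr (.inr ⟨t, by omega⟩)))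
  · intro i hi j hj
    exact hA (.inl ⟨i, hi⟩) (.inr (.inr (.inr ⟨j, by omega⟩)))
  · intro i j hij hj
    have hi : i < 2 * (k₁ + 1) := hij.trans hj
    refine (hM (.inl ⟨i, by omega⟩) (.inl ⟨j, by omega⟩)).trans ?_
    rw [← Pfaffian.corr_of_lt y1 hij hj]
    simp only [bigM, dif_pos hi, dif_pos hj]
    congr 1
    exact (hw _ _).symm
  · intro i hi j hj
    refine (hM (.inl ⟨i, by omega⟩) (.inr ⟨j, by omega⟩)).trans ?_
    simp only [bigM, dif_pos hi, dif_pos hj]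
    exact (hw _ _).symm
  · intro i j hij hj
    have hi : i < 2 * (k₂ + 1) := hij.trans hj
    refine (hM (.inr ⟨i, by omega⟩) (.inr ⟨j, by omega⟩)).trans ?_
    rw [← Pfaffian.corr_of_lt y2 hij hj]
    simp only [bigM, dif_pos hi, dif_pos hj]
    congr 1
    exact (hw _ _).symm
  · intro i hi
    refine (hM (.inl ⟨i, by omega⟩) (.inl ⟨_, by omega⟩)).trans ?_
    rw [← Pfaffian.corr_last (he k₁) y1 hi]
    simp [bigM]
  · intro i hi
    refine (hM (.inr ⟨i, by omega⟩) (.inr ⟨_, by omega⟩)).trans ?_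
    rw [← Pfaffian.corr_last (he k₂) y2 hi]
    simp [bigM]
  · intro i hi
    refine (hM (.inl ⟨i, by omega⟩) (.inr ⟨_, by omega⟩)).trans ?_
    simp [bigM]
  · intro j hj
    refine (hM (.inl ⟨_, by omega⟩) (.inr ⟨j, by omega⟩)).trans ?_
    simp [bigM]
end
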